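/- Smooth solvability of linear strongly parabolic systems on the torus (Theorem 2.6 for M = 𝕋^n with the trivial bundle): Let T > 0, let A^{aI}_b : ℝ^n × [0,T] → ℝ (|I| ≤ r, 1 ≤ a,b ≤ l) be C^∞ and ℤ^n-periodic in x, and assume the associated operators (L_t) are strongly elliptic with constant λ > 0. Let f : ℝ^n × [0,T] → ℝ^l be C^∞ and ℤ^n-periodic in x, and let u₀ : ℝ^n → ℝ^l be C^∞ and ℤ^n-periodic. Then there exists one and only one C^∞ function u : ℝ^n × [0,T] → ℝ^l, ℤ^n-periodic in x, satisfying ∂u/∂t = L_t u + f on ℝ^n × [0,T] and u(·,0) = u₀. -/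

import Mathlib

open scoped BigOperators
noncomputable section

/-- Euclidean space `ℝ^n`. -/
abbrev Vec (n : ℕ) := EuclideanSpace ℝ (Fin n)

/-- Iterated spatial partial derivative (within `D`) in the directions `I = (i_1, …, i_k)`. -/
def pderivW {n l : ℕ} (D : Set (Vec n)) (k : ℕ) (I : Fin k → Fin n)
    (w : Vec n → Vec l) : Vec n → Vec l :=
  fun x => iteratedFDerivWithin ℝ k w D x (fun j => EuclideanSpace.single (I j) 1)

/-- Spatial partial derivative `∂_I u(⋅,t)` of a space-time function (within `D`). -/
def spDerivW {n l : ℕ} (D : Set (Vec n)) (k : ℕ) (I : Fin k → Fin n)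
    (u : Vec n → ℝ → Vec l) : Vec n → ℝ → Vec l :=
  fun x t => pderivW D k I (fun y => u y t) x

/-- Time derivative `∂_t u` within the time interval `J`. -/
def tDerivW {n l : ℕ} (J : Set ℝ) (u : Vec n → ℝ → Vec l) : Vec n → ℝ → Vec l :=
  fun x t => derivWithin (fun s => u x s) J t

/-- Supremum norm `|w|_{0;Q}`. -/
def supQ {n l : ℕ} (Q : Set (Vec n × ℝ)) (w : Vec n → ℝ → Vec l) : ℝ :=
  sSup {c | ∃ p ∈ Q, c = ‖w p.1 p.2‖}

/-- The set of parabolic Hölder difference quotients of exponent `α` (parabolic order `r`). -/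
def holQuot {n l : ℕ} (r : ℕ) (α : ℝ) (Q : Set (Vec n × ℝ))
    (w : Vec n → ℝ → Vec l) : Set ℝ :=
  {c | ∃ p ∈ Q, ∃ q ∈ Q, p ≠ q ∧
    c = ‖w p.1 p.2 - w q.1 q.2‖ / (‖p.1 - q.1‖ ^ α + |p.2 - q.2| ^ (α / r))}

/-- Parabolic Hölder seminorm `[w]_{α;Q}`. -/
def parSemi {n l : ℕ} (r : ℕ) (α : ℝ) (Q : Set (Vec n × ℝ))
    (w : Vec n → ℝ → Vec l) : ℝ :=
  sSup (holQuot r α Q w)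

/-- Parabolic Hölder norm `‖u‖_{C^{r+α,1+α/r}(D × J)}`. -/
def parNorm {n l : ℕ} (r : ℕ) (α : ℝ) (D : Set (Vec n)) (J : Set ℝ)
    (u : Vec n → ℝ → Vec l) : ℝ :=
  (∑ k ∈ Finset.range (r + 1), ∑ I : Fin k → Fin n, supQ (D ×ˢ J) (spDerivW D k I u))
    + supQ (D ×ˢ J) (tDerivW J u)
    + (∑ I : Fin r → Fin n, parSemi r α (D ×ˢ J) (spDerivW D r I u))
    + parSemi r α (D ×ˢ J) (tDerivW J u)

/-- Membership in the parabolic Hölder space `C^{r+α,1+α/r}(D × J, ℝ^l)`. -/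
def MemPar {n l : ℕ} (r : ℕ) (α : ℝ) (D : Set (Vec n)) (J : Set ℝ)
    (u : Vec n → ℝ → Vec l) : Prop :=
  ContinuousOn (fun p : Vec n × ℝ => u p.1 p.2) (D ×ˢ J) ∧
  (∀ t ∈ J, ContDiffOn ℝ r (fun x => u x t) D) ∧
  (∀ x ∈ D, DifferentiableOn ℝ (fun s => u x s) J) ∧
  (∀ k, k ≤ r → ∀ I : Fin k → Fin n,
    ContinuousOn (fun p : Vec n × ℝ => spDerivW D k I u p.1 p.2) (D ×ˢ J)) ∧
  ContinuousOn (fun p : Vec n × ℝ => tDerivW J u p.1 p.2) (D ×ˢ J) ∧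
  (∀ I : Fin r → Fin n, BddAbove (holQuot r α (D ×ˢ J) (spDerivW D r I u))) ∧
  BddAbove (holQuot r α (D ×ˢ J) (tDerivW J u))

/-- The norm of `C^{α,α/r}(Q)`. -/
def lowNorm {n l : ℕ} (r : ℕ) (α : ℝ) (Q : Set (Vec n × ℝ))
    (f : Vec n → ℝ → Vec l) : ℝ :=
  supQ Q f + parSemi r α Q f

/-- Membership in `C^{α,α/r}(Q, ℝ^l)`. -/
def MemLow {n l : ℕ} (r : ℕ) (α : ℝ) (Q : Set (Vec n × ℝ))
    (f : Vec n → ℝ → Vec l) : Prop :=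
  ContinuousOn (fun p : Vec n × ℝ => f p.1 p.2) Q ∧ BddAbove (holQuot r α Q f)

/-- Spatial Hölder quotient set. -/
def spHolQuot {n l : ℕ} (D : Set (Vec n)) (α : ℝ) (w : Vec n → Vec l) : Set ℝ :=
  {c | ∃ x ∈ D, ∃ y ∈ D, x ≠ y ∧ c = ‖w x - w y‖ / ‖x - y‖ ^ α}

/-- The elliptic Hölder norm `‖u₀‖_{C^{r+α}(D)}`. -/
def spNorm {n l : ℕ} (r : ℕ) (α : ℝ) (D : Set (Vec n)) (u₀ : Vec n → Vec l) : ℝ :=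
  (∑ k ∈ Finset.range (r + 1), ∑ I : Fin k → Fin n,
    sSup {c | ∃ x ∈ D, c = ‖pderivW D k I u₀ x‖})
    + ∑ I : Fin r → Fin n, sSup (spHolQuot D α (pderivW D r I u₀))

/-- Membership in `C^{r+α}(D, ℝ^l)`. -/
def MemSp {n l : ℕ} (r : ℕ) (α : ℝ) (D : Set (Vec n)) (u₀ : Vec n → Vec l) : Prop :=
  ContDiffOn ℝ r u₀ D ∧ ∀ I : Fin r → Fin n, BddAbove (spHolQuot D α (pderivW D r I u₀))

/-- Action `(L_t u)(x)` of the time-dependent linear differential operator of order `r` with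
coefficients `A k I a b` (`k = |I| ≤ r`). -/
def applyL {n l : ℕ} (r : ℕ) (D : Set (Vec n))
    (A : (k : ℕ) → (Fin k → Fin n) → Fin l → Fin l → Vec n → ℝ → ℝ)
    (u : Vec n → ℝ → Vec l) : Vec n → ℝ → Vec l :=
  fun x t => (EuclideanSpace.equiv (Fin l) ℝ).symm fun a =>
    ∑ k ∈ Finset.range (r + 1), ∑ I : Fin k → Fin n, ∑ b : Fin l,
      A k I a b x t * spDerivW D k I u x t b

/-- Legendre–Hadamard strong ellipticity with constant `lam` on `Q`. -/
def StrongEllip {n l : ℕ} (r : ℕ)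
    (A : (k : ℕ) → (Fin k → Fin n) → Fin l → Fin l → Vec n → ℝ → ℝ)
    (Q : Set (Vec n × ℝ)) (lam : ℝ) : Prop :=
  ∀ p ∈ Q, ∀ ξ : Vec n, ∀ v : Vec l,
    lam * ‖ξ‖ ^ r * ‖v‖ ^ 2 ≤
      (-1 : ℝ) ^ (r / 2 - 1) *
        ∑ I : Fin r → Fin n, ∑ a : Fin l, ∑ b : Fin l,
          A r I a b p.1 p.2 * (∏ j, ξ (I j)) * v a * v b

/-- `ℤ^n`-periodicity. -/
def PerZ {n : ℕ} {β : Type*} (g : Vec n → β) : Prop :=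
  ∀ x : Vec n, ∀ m : Fin n → ℤ,
    g (x + (EuclideanSpace.equiv (Fin n) ℝ).symm fun i => (m i : ℝ)) = g x

/-- Real-valued functions viewed as `ℝ^1`-valued. -/
def toV1 {n : ℕ} (g : Vec n → ℝ → ℝ) : Vec n → ℝ → Vec 1 :=
  fun x t => (EuclideanSpace.equiv (Fin 1) ℝ).symm fun _ => g x t

namespace TorusParabolic

section Weights

variable {n : ℕ}

/-- The weight `1 + ‖k‖` on the lattice `ℤ^n`. -/
def wt (k : Fin n → ℤ) : ℝ := 1 + ‖k‖

lemma one_le_wt (k : Fin n → ℤ) : 1 ≤ wt k := by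
  unfold wt; linarith [norm_nonneg k]

lemma wt_pos (k : Fin n → ℤ) : 0 < wt k := lt_of_lt_of_le one_pos (one_le_wt k)

lemma norm_le_wt (k : Fin n → ℤ) : ‖k‖ ≤ wt k := by unfold wt; linarith

lemma wt_neg (k : Fin n → ℤ) : wt (-k) = wt k := by simp [wt]

lemma wt_sub_comm (k m : Fin n → ℤ) : wt (k - m) = wt (m - k) := by
  rw [← wt_neg, neg_sub]

lemma wt_add_le (k m : Fin n → ℤ) : wt (k + m) ≤ wt k * wt m := by
  unfold wt
  nlinarith [norm_add_le k m, norm_nonneg k, norm_nonneg m,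
    mul_nonneg (norm_nonneg k) (norm_nonneg m)]

lemma wt_le_sub_mul (k m : Fin n → ℤ) : wt k ≤ wt (k - m) * wt m := by
  simpa using wt_add_le (k - m) m

lemma one_le_wt_pow (k : Fin n → ℤ) (s : ℕ) : 1 ≤ wt k ^ s := one_le_pow₀ (one_le_wt k)

lemma wt_pow_pos (k : Fin n → ℤ) (s : ℕ) : 0 < wt k ^ s := pow_pos (wt_pos k) s

lemma wt_pow_mono (k : Fin n → ℤ) {s t : ℕ} (h : s ≤ t) : wt k ^ s ≤ wt k ^ t :=
  pow_le_pow_right₀ (one_le_wt k) h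

lemma wt_pow_le_sub_mul (k m : Fin n → ℤ) (s : ℕ) : wt k ^ s ≤ wt (k - m) ^ s * wt m ^ s := by
  rw [← mul_pow]; exact pow_le_pow_left₀ (wt_pos k).le (wt_le_sub_mul k m) s

lemma wt_pow_le_sub_mul' (k m : Fin n → ℤ) (s : ℕ) :
    wt m ^ s ≤ wt (k - m) ^ s * wt k ^ s := by
  rw [wt_sub_comm]; exact wt_pow_le_sub_mul m k s

lemma abs_wt_sub_wt_le (k m : Fin n → ℤ) : |wt k - wt m| ≤ wt (k - m) := by
  unfold wt
  have h := abs_norm_sub_norm_le k m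
  calc |1 + ‖k‖ - (1 + ‖m‖)| = |‖k‖ - ‖m‖| := by ring_nf
    _ ≤ ‖k - m‖ := h
    _ ≤ _ := by linarith

lemma abs_wt_pow_sub_wt_pow_le (k m : Fin n → ℤ) (s : ℕ) :
    |wt k ^ s - wt m ^ s| * wt m ≤ s * wt (k - m) ^ (s + 1) * wt m ^ s := by
  induction s with
  | zero => simp
  | succ s ih =>
    have e : wt k ^ (s + 1) - wt m ^ (s + 1)
        = wt k * (wt k ^ s - wt m ^ s) + wt m ^ s * (wt k - wt m) := by ring
    have h1 := abs_wt_sub_wt_le k m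
    have h2 := wt_le_sub_mul k m
    have h3 := wt_pow_pos m s
    have hm := wt_pos m
    have hk := wt_pos k
    have hd := one_le_wt_pow (k - m) (s + 1)
    have hd0 := wt_pos (k - m)
    calc |wt k ^ (s + 1) - wt m ^ (s + 1)| * wt m
        ≤ (wt k * |wt k ^ s - wt m ^ s| + wt m ^ s * |wt k - wt m|) * wt m := by
          rw [e]
          gcongr
          refine (abs_add_le _ _).trans ?_
          rw [abs_mul, abs_mul, abs_of_pos hk, abs_of_pos h3]
      _ = wt k * (|wt k ^ s - wt m ^ s| * wt m) + wt m ^ (s + 1) * |wt k - wt m| := by ring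
      _ ≤ (wt (k - m) * wt m) * (s * wt (k - m) ^ (s + 1) * wt m ^ s)
          + wt m ^ (s + 1) * (wt (k - m) * wt (k - m) ^ (s + 1)) := by
          gcongr
          nlinarith
      _ = _ := by push_cast; ring

lemma abs_apply_le_norm (k : Fin n → ℤ) (i : Fin n) : |(k i : ℝ)| ≤ ‖k‖ := by
  have := norm_le_pi_norm k i
  rwa [Int.norm_eq_abs] at this

lemma summable_pi_prod {g : ℤ → ℝ} (hg : Summable g) (h0 : ∀ j, 0 ≤ g j) (n : ℕ) :
    Summable fun k : Fin n → ℤ => ∏ i, g (k i) := by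
  induction n with
  | zero => exact Summable.of_finite
  | succ n ih =>
    have h := hg.mul_of_nonneg ih h0 (fun k => Finset.prod_nonneg fun i _ => h0 _)
    rw [← (Fin.consEquiv fun _ : Fin (n + 1) => ℤ).summable_iff]
    refine h.congr fun x => ?_
    simp [Fin.prod_univ_succ, Fin.consEquiv]

lemma summable_inv_wt_pow (n : ℕ) : Summable fun k : Fin n → ℤ => (wt k ^ (2 * n))⁻¹ := by
  have h1 : Summable fun j : ℤ => ((1 + |(j : ℝ)|) ^ 2)⁻¹ := by
    have h := Real.summable_one_div_int_pow.mpr (one_lt_two)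
    refine Summable.of_norm_bounded_eventually (g := fun j : ℤ => 1 / (j : ℝ) ^ 2) h ?_
    refine (Set.finite_singleton (0 : ℤ)).subset fun j hj => ?_
    by_contra hne
    apply hj
    have hj0 : 0 < |(j : ℝ)| := abs_pos.mpr (Int.cast_ne_zero.mpr hne)
    change ‖((1 + |(j : ℝ)|) ^ 2)⁻¹‖ ≤ 1 / (j : ℝ) ^ 2
    rw [Real.norm_of_nonneg (by positivity), one_div, ← sq_abs (j : ℝ)]
    gcongr
    linarith
  refine Summable.of_nonneg_of_le (fun k => by have := wt_pow_pos k (2 * n); positivity) (fun k => ?_)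
    (summable_pi_prod h1 (fun j => by positivity) n)
  have : ∏ i, ((1 + |(k i : ℝ)|) ^ 2)⁻¹ = (∏ i, (1 + |(k i : ℝ)|) ^ 2)⁻¹ := by
    rw [Finset.prod_inv_distrib]
  rw [this]
  have hp : ∏ i, (1 + |(k i : ℝ)|) ^ 2 ≤ ∏ _i : Fin n, wt k ^ 2 := by
    refine Finset.prod_le_prod (fun i _ => by positivity) fun i _ => ?_
    have := abs_apply_le_norm k i
    unfold wt
    gcongr
  have hp0 : 0 < ∏ i, (1 + |(k i : ℝ)|) ^ 2 := Finset.prod_pos fun i _ => by positivity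
  have he : ∏ _i : Fin n, wt k ^ 2 = wt k ^ (2 * n) := by
    simp [Finset.prod_const, pow_mul]
  rw [he] at hp
  gcongr

/-- The lattice sum `∑ (1 + ‖k‖)^(-2 * n)`. -/
def latSum (n : ℕ) : ℝ := ∑' k : Fin n → ℤ, (wt k ^ (2 * n))⁻¹

lemma inv_wt_pow_nonneg (k : Fin n → ℤ) (s : ℕ) : 0 ≤ (wt k ^ s)⁻¹ :=
  inv_nonneg.mpr (wt_pow_pos k s).le

lemma latSum_nonneg (n : ℕ) : 0 ≤ latSum n := tsum_nonneg fun k => inv_wt_pow_nonneg k _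

lemma le_mul_inv_wt_pow {a K : ℝ} {k : Fin n → ℤ} {s : ℕ} (h : a * wt k ^ s ≤ K) :
    a ≤ K * (wt k ^ s)⁻¹ := by
  rw [← div_eq_mul_inv, le_div_iff₀ (wt_pow_pos k s)]; exact h

/-- A decay bound `h k * wt k ^ (2 n) ≤ K` bounds every finite sum of `h`. -/
lemma sum_le_of_wt_bound {h : (Fin n → ℤ) → ℝ} {K : ℝ} (hK : ∀ k, h k * wt k ^ (2 * n) ≤ K)
    (hK0 : 0 ≤ K) (S : Finset (Fin n → ℤ)) : ∑ k ∈ S, h k ≤ K * latSum n := by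
  calc ∑ k ∈ S, h k ≤ ∑ k ∈ S, K * (wt k ^ (2 * n))⁻¹ :=
        Finset.sum_le_sum fun k _ => le_mul_inv_wt_pow (hK k)
    _ = K * ∑ k ∈ S, (wt k ^ (2 * n))⁻¹ := by rw [Finset.mul_sum]
    _ ≤ K * latSum n := by
        gcongr
        exact (summable_inv_wt_pow n).sum_le_tsum S fun k _ => inv_wt_pow_nonneg k _

lemma sum_sub_le_of_wt_bound {h : (Fin n → ℤ) → ℝ} {K : ℝ} (hK : ∀ k, h k * wt k ^ (2 * n) ≤ K)
    (hK0 : 0 ≤ K) (S : Finset (Fin n → ℤ)) (m : Fin n → ℤ) :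
    ∑ k ∈ S, h (k - m) ≤ K * latSum n := by
  have := sum_le_of_wt_bound hK hK0 (S.image fun k => k - m)
  rwa [Finset.sum_image (fun a _ b _ hab => by simpa using hab)] at this

lemma sum_sub_le_of_wt_bound' {h : (Fin n → ℤ) → ℝ} {K : ℝ} (hK : ∀ k, h k * wt k ^ (2 * n) ≤ K)
    (hK0 : 0 ≤ K) (S : Finset (Fin n → ℤ)) (k : Fin n → ℤ) :
    ∑ m ∈ S, h (k - m) ≤ K * latSum n := by
  have := sum_le_of_wt_bound hK hK0 (S.image fun m => k - m)
  rwa [Finset.sum_image (fun a _ b _ hab => by simpa using hab)] at this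

lemma schur_right {h : (Fin n → ℤ) → ℝ} {K : ℝ} (hK : ∀ k, h k * wt k ^ (2 * n) ≤ K)
    (hK0 : 0 ≤ K) (S : Finset (Fin n → ℤ)) {α : (Fin n → ℤ) → ℝ} (hα : ∀ k, 0 ≤ α k) :
    ∑ k ∈ S, ∑ m ∈ S, h (k - m) * α m ≤ K * latSum n * ∑ m ∈ S, α m := by
  rw [Finset.sum_comm, Finset.mul_sum]
  refine Finset.sum_le_sum fun m _ => ?_
  rw [← Finset.sum_mul]
  exact mul_le_mul_of_nonneg_right (sum_sub_le_of_wt_bound hK hK0 S m) (hα m)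

lemma schur_left {h : (Fin n → ℤ) → ℝ} {K : ℝ} (hK : ∀ k, h k * wt k ^ (2 * n) ≤ K)
    (hK0 : 0 ≤ K) (S : Finset (Fin n → ℤ)) {α : (Fin n → ℤ) → ℝ} (hα : ∀ k, 0 ≤ α k) :
    ∑ k ∈ S, ∑ m ∈ S, h (k - m) * α k ≤ K * latSum n * ∑ m ∈ S, α m := by
  rw [Finset.mul_sum]
  refine Finset.sum_le_sum fun k _ => ?_
  rw [← Finset.sum_mul]
  exact mul_le_mul_of_nonneg_right (sum_sub_le_of_wt_bound' hK hK0 S k) (hα k)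

/-- The cube `{k : ‖k‖ ≤ N}` in `ℤ^n`. -/
def box (n N : ℕ) : Finset (Fin n → ℤ) :=
  Fintype.piFinset fun _ => Finset.Icc (-(N : ℤ)) N

lemma mem_box {N : ℕ} {k : Fin n → ℤ} : k ∈ box n N ↔ ‖k‖ ≤ N := by
  simp only [box, Fintype.mem_piFinset, Finset.mem_Icc]
  rw [pi_norm_le_iff_of_nonneg (by positivity)]
  refine forall_congr' fun i => ?_
  rw [Int.norm_eq_abs, ← abs_le]
  exact_mod_cast Iff.rfl

lemma box_mono {N M : ℕ} (h : N ≤ M) : box n N ⊆ box n M := fun k hk => by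
  rw [mem_box] at hk ⊢
  exact hk.trans (by exact_mod_cast h)

lemma lt_wt_of_notMem_box {N : ℕ} {k : Fin n → ℤ} (h : k ∉ box n N) : (N : ℝ) + 1 ≤ wt k := by
  rw [mem_box, not_le] at h
  unfold wt; linarith

lemma wt_le_of_mem_box {N : ℕ} {k : Fin n → ℤ} (h : k ∈ box n N) : wt k ≤ N + 1 := by
  rw [mem_box] at h
  unfold wt; linarith

end Weights

section Garding

variable {n : ℕ}

lemma pow_le_mul_pow_add_two_add {x δ : ℝ} (hx : 1 ≤ x) (hδ : 0 < δ) (ρ : ℕ) :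
    x ^ ρ ≤ δ * x ^ (ρ + 2) + (δ⁻¹) ^ ρ := by
  by_cases h : 1 ≤ δ * x ^ 2
  · have : x ^ ρ ≤ δ * x ^ (ρ + 2) := by
      calc x ^ ρ = 1 * x ^ ρ := (one_mul _).symm
        _ ≤ (δ * x ^ 2) * x ^ ρ := by gcongr
        _ = _ := by ring
    have h2 : 0 ≤ (δ⁻¹) ^ ρ := by positivity
    linarith
  · push Not at h
    have h1 : x ≤ δ⁻¹ := by
      rw [le_inv_comm₀ (by linarith) hδ]
      rw [le_inv_comm₀ hδ (by linarith)]
      rw [← one_div, le_div_iff₀ hδ]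
      nlinarith
    have h2 : x ^ ρ ≤ (δ⁻¹) ^ ρ := by gcongr
    have h3 : 0 ≤ δ * x ^ (ρ + 2) := by positivity
    linarith

/-- Forms of order `r - 1` are dominated by an arbitrarily small multiple of the form of order
`r` plus a multiple of the form of order zero. -/
lemma lower_order_form_le (ρ : ℕ) {K ε : ℝ} (hK0 : 0 ≤ K) (hε : 0 < ε) :
    ∃ C, 0 ≤ C ∧ ∀ (a : (Fin n → ℤ) → (Fin n → ℤ) → ℝ) (S : Finset (Fin n → ℤ))
      (v : (Fin n → ℤ) → ℝ),
      (∀ k m, a k m * wt (k - m) ^ (2 * n + (ρ + 2)) ≤ K * wt m ^ (ρ + 1)) →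
      (∀ k, 0 ≤ v k) →
      ∑ k ∈ S, ∑ m ∈ S, a k m * v m * v k ≤
        ε * ∑ k ∈ S, wt k ^ (ρ + 2) * v k ^ 2 + C * ∑ k ∈ S, v k ^ 2 := by
  set H := K * latSum n with hH
  have hH0 : 0 ≤ H := mul_nonneg hK0 (latSum_nonneg n)
  set δ := ε / (H + 1) with hδd
  have hδ : 0 < δ := by positivity
  have hδH : δ * H ≤ ε := by
    rw [hδd, div_mul_eq_mul_div, div_le_iff₀ (by positivity)]
    nlinarith
  refine ⟨δ⁻¹ / 2 * H * ((δ ^ 2)⁻¹) ^ ρ, by positivity, fun a S v ha hv => ?_⟩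
  set h : (Fin n → ℤ) → ℝ := fun j => K * (wt j ^ (2 * n + (ρ + 2)))⁻¹ with hh
  have hn0 : ∀ j, 0 ≤ h j := fun j => mul_nonneg hK0 (inv_wt_pow_nonneg _ _)
  have hcancel : ∀ j, h j * wt j ^ (ρ + 2) * wt j ^ (2 * n) ≤ K := fun j => by
    have e1 := (wt_pow_pos j (2 * n)).ne'
    have e2 := (wt_pow_pos j (ρ + 2)).ne'
    have e : h j * wt j ^ (ρ + 2) * wt j ^ (2 * n) = K := by
      rw [hh]; simp only; rw [pow_add (wt j) (2 * n)]
      generalize wt j ^ (2 * n) = x at *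
      generalize wt j ^ (ρ + 2) = y at *
      field_simp
    exact e.le
  have hb1 : ∀ j, h j * wt j ^ (2 * n) ≤ K := fun j => by
    refine le_trans ?_ (hcancel j)
    have h1 := one_le_wt_pow j (ρ + 2)
    have h2 : 0 ≤ h j * wt j ^ (2 * n) := mul_nonneg (hn0 j) (wt_pow_pos _ _).le
    nlinarith
  have hpt : ∀ k m, a k m * v m * v k ≤
      δ / 2 * (h (k - m) * (wt m ^ (ρ + 2) * v m ^ 2)) +
      δ⁻¹ / 2 * ((h (k - m) * wt (k - m) ^ (ρ + 2)) * (wt k ^ ρ * v k ^ 2)) := by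
    intro k m
    have h1 : a k m ≤ h (k - m) * wt m ^ (ρ + 1) := by
      have := le_mul_inv_wt_pow (ha k m)
      rw [hh]; simp only; linarith
    have h2 : wt m ^ (ρ + 1) * v m * v k ≤
        δ / 2 * (wt m ^ (ρ + 2) * v m ^ 2) + δ⁻¹ / 2 * (wt m ^ ρ * v k ^ 2) := by
      have e : δ / 2 * (wt m ^ (ρ + 2) * v m ^ 2) + δ⁻¹ / 2 * (wt m ^ ρ * v k ^ 2)
          - wt m ^ (ρ + 1) * v m * v k
          = δ⁻¹ / 2 * wt m ^ ρ * (δ * wt m * v m - v k) ^ 2 := by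
        field_simp; ring
      have : 0 ≤ δ⁻¹ / 2 * wt m ^ ρ * (δ * wt m * v m - v k) ^ 2 := by
        have := wt_pow_pos m ρ
        positivity
      linarith
    have h3 : wt m ^ ρ ≤ wt (k - m) ^ (ρ + 2) * wt k ^ ρ :=
      (wt_pow_le_sub_mul' k m ρ).trans
        (mul_le_mul_of_nonneg_right (wt_pow_mono _ (by omega)) (wt_pow_pos _ _).le)
    have hvv : 0 ≤ v m * v k := mul_nonneg (hv m) (hv k)
    calc a k m * v m * v k = a k m * (v m * v k) := by ring
      _ ≤ (h (k - m) * wt m ^ (ρ + 1)) * (v m * v k) := mul_le_mul_of_nonneg_right h1 hvv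
      _ = h (k - m) * (wt m ^ (ρ + 1) * v m * v k) := by ring
      _ ≤ h (k - m) * (δ / 2 * (wt m ^ (ρ + 2) * v m ^ 2) +
            δ⁻¹ / 2 * ((wt (k - m) ^ (ρ + 2) * wt k ^ ρ) * v k ^ 2)) := by
          refine mul_le_mul_of_nonneg_left (h2.trans ?_) (hn0 _)
          gcongr
      _ = _ := by ring
  have hs1 := schur_right hb1 hK0 S (α := fun m => wt m ^ (ρ + 2) * v m ^ 2)
    (fun m => mul_nonneg (wt_pow_pos _ _).le (sq_nonneg _))
  have hs2 := schur_left (h := fun j => h j * wt j ^ (ρ + 2)) hcancel hK0 S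
    (α := fun m => wt m ^ ρ * v m ^ 2)
    (fun m => mul_nonneg (wt_pow_pos _ _).le (sq_nonneg _))
  have hρ : ∑ m ∈ S, wt m ^ ρ * v m ^ 2 ≤
      δ ^ 2 * ∑ m ∈ S, wt m ^ (ρ + 2) * v m ^ 2 + ((δ ^ 2)⁻¹) ^ ρ * ∑ m ∈ S, v m ^ 2 := by
    rw [Finset.mul_sum, Finset.mul_sum, ← Finset.sum_add_distrib]
    refine Finset.sum_le_sum fun m _ => ?_
    have := pow_le_mul_pow_add_two_add (one_le_wt m) (pow_pos hδ 2) ρ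
    nlinarith [sq_nonneg (v m)]
  set X := ∑ m ∈ S, wt m ^ (ρ + 2) * v m ^ 2 with hX
  set Y := ∑ m ∈ S, v m ^ 2 with hY
  have hX0 : 0 ≤ X := Finset.sum_nonneg fun m _ => mul_nonneg (wt_pow_pos _ _).le (sq_nonneg _)
  calc ∑ k ∈ S, ∑ m ∈ S, a k m * v m * v k
      ≤ ∑ k ∈ S, ∑ m ∈ S, (δ / 2 * (h (k - m) * (wt m ^ (ρ + 2) * v m ^ 2)) +
      δ⁻¹ / 2 * ((h (k - m) * wt (k - m) ^ (ρ + 2)) * (wt k ^ ρ * v k ^ 2))) :=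
        Finset.sum_le_sum fun k _ => Finset.sum_le_sum fun m _ => hpt k m
    _ = δ / 2 * (∑ k ∈ S, ∑ m ∈ S, h (k - m) * (wt m ^ (ρ + 2) * v m ^ 2)) +
        δ⁻¹ / 2 * ∑ k ∈ S, ∑ m ∈ S, (h (k - m) * wt (k - m) ^ (ρ + 2)) * (wt k ^ ρ * v k ^ 2) := by
        simp only [Finset.sum_add_distrib, Finset.mul_sum]
    _ ≤ δ / 2 * (H * X) + δ⁻¹ / 2 * (H * (δ ^ 2 * X + ((δ ^ 2)⁻¹) ^ ρ * Y)) := by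
        gcongr
        exact hs2.trans (mul_le_mul_of_nonneg_left hρ hH0)
    _ = (δ * H) * X + δ⁻¹ / 2 * H * ((δ ^ 2)⁻¹) ^ ρ * Y := by
        field_simp; ring
    _ ≤ _ := by gcongr

/-- Schur bound for forms of order `r`. -/
lemma top_order_form_le (r : ℕ) {K : ℝ} (hK0 : 0 ≤ K)
    (a : (Fin n → ℤ) → (Fin n → ℤ) → ℝ) (S : Finset (Fin n → ℤ)) (v : (Fin n → ℤ) → ℝ)
    (ha : ∀ k m, a k m * wt (k - m) ^ (2 * n + r) ≤ K * wt m ^ r) (hv : ∀ k, 0 ≤ v k) :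
    ∑ k ∈ S, ∑ m ∈ S, a k m * v m * v k ≤
      K * latSum n * ∑ k ∈ S, wt k ^ r * v k ^ 2 := by
  set h : (Fin n → ℤ) → ℝ := fun j => K * (wt j ^ (2 * n + r))⁻¹ with hh
  have hn0 : ∀ j, 0 ≤ h j := fun j => mul_nonneg hK0 (inv_wt_pow_nonneg _ _)
  have hcancel : ∀ j, h j * wt j ^ r * wt j ^ (2 * n) ≤ K := fun j => by
    have e1 := (wt_pow_pos j (2 * n)).ne'
    have e2 := (wt_pow_pos j r).ne'
    have e : h j * wt j ^ r * wt j ^ (2 * n) = K := by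
      rw [hh]; simp only; rw [pow_add (wt j) (2 * n)]
      generalize wt j ^ (2 * n) = x at *
      generalize wt j ^ r = y at *
      field_simp
    exact e.le
  have hb1 : ∀ j, h j * wt j ^ (2 * n) ≤ K := fun j => by
    refine le_trans ?_ (hcancel j)
    have h1 := one_le_wt_pow j r
    have h2 : 0 ≤ h j * wt j ^ (2 * n) := mul_nonneg (hn0 j) (wt_pow_pos _ _).le
    nlinarith
  have hpt : ∀ k m, a k m * v m * v k ≤
      1 / 2 * (h (k - m) * (wt m ^ r * v m ^ 2)) +
      1 / 2 * ((h (k - m) * wt (k - m) ^ r) * (wt k ^ r * v k ^ 2)) := by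
    intro k m
    have h1 : a k m ≤ h (k - m) * wt m ^ r := by
      have := le_mul_inv_wt_pow (ha k m)
      rw [hh]; simp only; linarith
    have h3 : wt m ^ r ≤ wt (k - m) ^ r * wt k ^ r := wt_pow_le_sub_mul' k m r
    have hvv : 0 ≤ v m * v k := mul_nonneg (hv m) (hv k)
    have hm := wt_pow_pos m r
    calc a k m * v m * v k = a k m * (v m * v k) := by ring
      _ ≤ (h (k - m) * wt m ^ r) * (v m * v k) := mul_le_mul_of_nonneg_right h1 hvv
      _ = h (k - m) * (wt m ^ r * (v m * v k)) := by ring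
      _ ≤ h (k - m) * (1 / 2 * (wt m ^ r * v m ^ 2) +
            1 / 2 * ((wt (k - m) ^ r * wt k ^ r) * v k ^ 2)) := by
          refine mul_le_mul_of_nonneg_left ?_ (hn0 _)
          have : wt m ^ r * (v m * v k) ≤ 1 / 2 * (wt m ^ r * v m ^ 2) +
              1 / 2 * (wt m ^ r * v k ^ 2) := by
            nlinarith [mul_nonneg hm.le (sq_nonneg (v m - v k))]
          refine this.trans ?_
          gcongr
      _ = _ := by ring
  have hs1 := schur_right hb1 hK0 S (α := fun m => wt m ^ r * v m ^ 2)
    (fun m => mul_nonneg (wt_pow_pos _ _).le (sq_nonneg _))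
  have hs2 := schur_left (h := fun j => h j * wt j ^ r) hcancel hK0 S
    (α := fun m => wt m ^ r * v m ^ 2)
    (fun m => mul_nonneg (wt_pow_pos _ _).le (sq_nonneg _))
  calc ∑ k ∈ S, ∑ m ∈ S, a k m * v m * v k
      ≤ ∑ k ∈ S, ∑ m ∈ S, (1 / 2 * (h (k - m) * (wt m ^ r * v m ^ 2)) +
      1 / 2 * ((h (k - m) * wt (k - m) ^ r) * (wt k ^ r * v k ^ 2))) :=
        Finset.sum_le_sum fun k _ => Finset.sum_le_sum fun m _ => hpt k m
    _ = 1 / 2 * (∑ k ∈ S, ∑ m ∈ S, h (k - m) * (wt m ^ r * v m ^ 2)) +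
        1 / 2 * ∑ k ∈ S, ∑ m ∈ S, (h (k - m) * wt (k - m) ^ r) * (wt k ^ r * v k ^ 2) := by
        simp only [Finset.sum_add_distrib, Finset.mul_sum]
    _ ≤ _ := by linarith

lemma card_filter_Icc_sub_notMem_le (R : ℕ) (j : ℤ) :
    ((Finset.Icc (-(R : ℤ)) R).filter fun s => s - j ∉ Finset.Icc (-(R : ℤ)) R).card
      ≤ j.natAbs := by
  rcases le_total 0 j with hj | hj
  · calc _ ≤ (Finset.Ico (-(R : ℤ)) (-R + j)).card := by
          refine Finset.card_le_card fun s hs => ?_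
          simp only [Finset.mem_filter, Finset.mem_Icc, Finset.mem_Ico] at hs ⊢
          omega
      _ = j.natAbs := by rw [Int.card_Ico]; omega
  · calc _ ≤ (Finset.Ioc ((R : ℤ) + j) R).card := by
          refine Finset.card_le_card fun s hs => ?_
          simp only [Finset.mem_filter, Finset.mem_Icc, Finset.mem_Ioc] at hs ⊢
          omega
      _ = j.natAbs := by rw [Int.card_Ioc]; omega

lemma card_box (n R : ℕ) : (box n R).card = (2 * R + 1) ^ n := by
  have : ((R : ℤ) + 1 + (R : ℤ)).toNat = 2 * R + 1 := by omega
  simp [box, Fintype.card_piFinset, Int.card_Icc, this]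

/-- Only a small fraction of a large cube leaves the cube under translation by `j`. -/
lemma card_filter_box_sub_notMem_le (R : ℕ) (j : Fin n → ℤ) :
    (((box n R).filter fun η => η - j ∉ box n R).card : ℝ) * (2 * R + 1) ≤
      n * ‖j‖ * (box n R).card := by
  classical
  set I := Finset.Icc (-(R : ℤ)) R with hI
  set piece : Fin n → Finset (Fin n → ℤ) := fun i =>
    Fintype.piFinset (Function.update (fun _ => I) i (I.filter fun s => s - j i ∉ I)) with hp
  have hsub : ((box n R).filter fun η => η - j ∉ box n R) ⊆ Finset.univ.biUnion piece := by
    intro η hη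
    rw [Finset.mem_filter] at hη
    obtain ⟨h1, h2⟩ := hη
    rw [box, Fintype.mem_piFinset] at h1 h2
    push Not at h2
    obtain ⟨i, hi⟩ := h2
    rw [Finset.mem_biUnion]
    refine ⟨i, Finset.mem_univ _, ?_⟩
    rw [hp]
    simp only [Fintype.mem_piFinset]
    intro i'
    by_cases h : i' = i
    · subst h
      simp only [Function.update_self, Finset.mem_filter]
      exact ⟨h1 i', hi⟩
    · simp only [Function.update_of_ne h]
      exact h1 i'
  have hcI : I.card = 2 * R + 1 := by
    rw [hI, Int.card_Icc]; omega
  have hpiece : ∀ i, ((piece i).card : ℝ) * (2 * R + 1) ≤ ‖j‖ * (box n R).card := by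
    intro i
    have e : (piece i).card = (I.filter fun s => s - j i ∉ I).card * (2 * R + 1) ^ (n - 1) := by
      rw [hp]
      simp only [Fintype.card_piFinset]
      rw [Fintype.prod_eq_mul_prod_compl i]
      have h2 : ∀ i' ∈ ({i}ᶜ : Finset (Fin n)), (Function.update (fun _ => I) i
          (I.filter fun s => s - j i ∉ I) i').card = 2 * R + 1 := by
        intro i' hi'
        rw [Function.update_of_ne (by simpa using hi')]
        exact hcI
      rw [Finset.prod_congr rfl h2, Function.update_self, Finset.prod_const,
        Finset.card_compl, Finset.card_singleton, Fintype.card_fin]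
    have hn : n - 1 + 1 = n := by have := i.2; omega
    have hb : ((box n R).card : ℝ) = (2 * R + 1) ^ (n - 1) * (2 * R + 1) := by
      rw [card_box, ← pow_succ, hn]; push_cast; rfl
    rw [e, hb]
    push_cast
    have h3 : (((I.filter fun s => s - j i ∉ I).card : ℕ) : ℝ) ≤ ‖j‖ := by
      refine le_trans ?_ (abs_apply_le_norm j i)
      have := card_filter_Icc_sub_notMem_le R (j i)
      have h4 : (((j i).natAbs : ℕ) : ℝ) = |(j i : ℝ)| := by
        rw [Nat.cast_natAbs, Int.cast_abs]
      rw [← h4]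
      exact_mod_cast this
    rw [mul_assoc]
    gcongr
  have hcard := (Finset.card_le_card hsub).trans Finset.card_biUnion_le
  have hcard' : (((box n R).filter fun η => η - j ∉ box n R).card : ℝ)
      ≤ ∑ i, ((piece i).card : ℝ) := by exact_mod_cast hcard
  calc _ ≤ (∑ i, ((piece i).card : ℝ)) * (2 * R + 1) := by gcongr
    _ = ∑ i, ((piece i).card : ℝ) * (2 * R + 1) := by rw [Finset.sum_mul]
    _ ≤ ∑ _i : Fin n, ‖j‖ * (box n R).card := Finset.sum_le_sum fun i _ => hpiece i
    _ = _ := by simp; ring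

end Garding

section Garding

open scoped InnerProductSpace

variable {n : ℕ} {E : Type*} [NormedAddCommGroup E] [InnerProductSpace ℂ E]

/-- Nonpositivity (with a gain of `ρ + 2` derivatives) of the quantization with constant frequency
`ξ` of a symbol `p`. -/
def NegForm (ρ : ℕ) (lam : ℝ) (p : (Fin n → ℤ) → (Fin n → ℤ) → E →L[ℂ] E) : Prop :=
  ∀ (ξ : Fin n → ℤ) (S : Finset (Fin n → ℤ)) (w : (Fin n → ℤ) → E),
    ∑ k ∈ S, ∑ m ∈ S, (⟪w k, p (k - m) ξ (w m)⟫_ℂ).re ≤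
      -lam * ‖ξ‖ ^ (ρ + 2) * ∑ k ∈ S, ‖w k‖ ^ 2

lemma sum_translate_finset {M : Type*} [AddCommMonoid M] (S B : Finset (Fin n → ℤ))
    {m : Fin n → ℤ} (hm : m ∈ S) (G : (Fin n → ℤ) → M) :
    ∑ ξ ∈ Finset.image₂ (· + ·) S B, (if ξ - m ∈ B then G ξ else 0) = ∑ η ∈ B, G (m + η) := by
  rw [← Finset.sum_filter]
  refine Finset.sum_nbij' (fun ξ => ξ - m) (fun η => m + η) ?_ ?_ ?_ ?_ ?_
  · intro ξ h; exact (Finset.mem_filter.mp h).2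
  · intro η h
    rw [Finset.mem_filter]
    exact ⟨Finset.mem_image₂_of_mem hm h, by simpa using h⟩
  · intro ξ _; abel
  · intro η _; simp
  · intro ξ _; congr 1; abel

lemma smoothing_sum_le {ρ : ℕ} {lam : ℝ} {p : (Fin n → ℤ) → (Fin n → ℤ) → E →L[ℂ] E}
    (hp : NegForm ρ lam p) (S B : Finset (Fin n → ℤ)) (v : (Fin n → ℤ) → E) :
    ∑ k ∈ S, ∑ m ∈ S, ∑ η ∈ B,
        (if m + η - k ∈ B then (⟪v k, p (k - m) (m + η) (v m)⟫_ℂ).re else 0) ≤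
      -lam * ∑ m ∈ S, ∑ η ∈ B, ‖m + η‖ ^ (ρ + 2) * ‖v m‖ ^ 2 := by
  set Ξ := Finset.image₂ (· + ·) S B with hΞ
  have h : ∀ ξ, ∑ k ∈ S, ∑ m ∈ S, (if ξ - m ∈ B then
      (if ξ - k ∈ B then (⟪v k, p (k - m) ξ (v m)⟫_ℂ).re else 0) else 0) ≤
      ∑ m ∈ S, if ξ - m ∈ B then -lam * (‖ξ‖ ^ (ρ + 2) * ‖v m‖ ^ 2) else 0 := by
    intro ξ
    have := hp ξ S fun m => if ξ - m ∈ B then v m else 0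
    rw [Finset.mul_sum] at this
    refine le_trans (le_of_eq ?_) (this.trans (le_of_eq ?_))
    · refine Finset.sum_congr rfl fun k _ => Finset.sum_congr rfl fun m _ => ?_
      split_ifs <;> simp
    · refine Finset.sum_congr rfl fun m _ => ?_
      split_ifs
      · ring
      · simp
  have h2 := Finset.sum_le_sum fun ξ (_ : ξ ∈ Ξ) => h ξ
  refine le_trans (le_of_eq ?_) (h2.trans (le_of_eq ?_))
  · refine Eq.symm ?_
    rw [Finset.sum_comm]
    refine Finset.sum_congr rfl fun k _ => ?_
    rw [Finset.sum_comm]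
    refine Finset.sum_congr rfl fun m hm => ?_
    rw [hΞ, sum_translate_finset S B hm]
  · rw [Finset.sum_comm, Finset.mul_sum]
    refine Finset.sum_congr rfl fun m hm => ?_
    rw [hΞ, sum_translate_finset S B hm, Finset.mul_sum]

lemma wt_pow_le_of_mem_box {R r : ℕ} {m η : Fin n → ℤ} (hη : η ∈ box n R) :
    wt m ^ r ≤ 2 ^ r * ((1 + R) ^ r + ‖m + η‖ ^ r) := by
  have h1 : wt m ≤ (1 + R) + ‖m + η‖ := by
    have h2 := norm_sub_le (m + η) η
    rw [add_sub_cancel_right] at h2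
    have := mem_box.mp hη
    unfold wt; linarith
  have h3 : wt m ≤ 2 * max (1 + (R : ℝ)) ‖m + η‖ := by
    linarith [le_max_left (1 + (R : ℝ)) ‖m + η‖, le_max_right (1 + (R : ℝ)) ‖m + η‖]
  calc wt m ^ r ≤ (2 * max (1 + (R : ℝ)) ‖m + η‖) ^ r := pow_le_pow_left₀ (wt_pos m).le h3 r
    _ = 2 ^ r * (max (1 + (R : ℝ)) ‖m + η‖) ^ r := by rw [mul_pow]
    _ ≤ _ := by
        refine mul_le_mul_of_nonneg_left ?_ (by positivity)
        have a1 : 0 ≤ (1 + (R : ℝ)) ^ r := by positivity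
        have a2 : 0 ≤ ‖m + η‖ ^ r := by positivity
        rcases max_choice (1 + (R : ℝ)) ‖m + η‖ with h | h <;> rw [h] <;> linarith

lemma re_inner_le (x y : E) : (⟪x, y⟫_ℂ).re ≤ ‖x‖ * ‖y‖ :=
  (Complex.re_le_norm _).trans (norm_inner_le_norm x y)

lemma re_inner_clm_le (A : E →L[ℂ] E) (x y : E) : (⟪x, A y⟫_ℂ).re ≤ ‖A‖ * ‖y‖ * ‖x‖ := by
  refine (re_inner_le x (A y)).trans ?_
  rw [mul_comm]
  exact mul_le_mul_of_nonneg_right (A.le_opNorm y) (norm_nonneg x)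

/-- Gårding's inequality for the principal part. -/
lemma garding_principal (ρ : ℕ) {K lam : ℝ} (hK : 0 ≤ K) (hlam : 0 < lam) :
    ∃ c C, 0 < c ∧ 0 ≤ C ∧ ∀ p : (Fin n → ℤ) → (Fin n → ℤ) → E →L[ℂ] E,
      (∀ j ξ, ‖p j ξ‖ * wt j ^ (2 * n + (ρ + 2) + 1) ≤ K * wt ξ ^ (ρ + 2)) →
      (∀ j ξ η, ‖p j ξ - p j (ξ + η)‖ * wt j ^ (2 * n + (ρ + 2)) ≤
        K * wt η ^ (ρ + 2) * wt ξ ^ (ρ + 1)) →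
      NegForm ρ lam p → ∀ (S : Finset (Fin n → ℤ)) (v : (Fin n → ℤ) → E),
      ∑ k ∈ S, ∑ m ∈ S, (⟪v k, p (k - m) m (v m)⟫_ℂ).re ≤
        -c * ∑ k ∈ S, wt k ^ (ρ + 2) * ‖v k‖ ^ 2 + C * ∑ k ∈ S, ‖v k‖ ^ 2 := by
  set c₀ : ℝ := lam / 2 ^ (ρ + 2) with hc₀
  have hc₀p : 0 < c₀ := by positivity
  obtain ⟨R, hR⟩ := exists_nat_ge (n * K * latSum n / (c₀ / 4))
  have hR' : n * K / (2 * R + 1) * latSum n ≤ c₀ / 4 := by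
    rw [div_le_iff₀ (by positivity)] at hR
    rw [div_mul_eq_mul_div, div_le_iff₀ (by positivity)]
    nlinarith
  have hK1 : 0 ≤ K * (1 + R : ℝ) ^ (ρ + 2) := by positivity
  obtain ⟨C₁, hC₁, hlow⟩ := lower_order_form_le (n := n) ρ hK1 (ε := c₀ / 4) (by positivity)
  refine ⟨c₀ / 2, lam * (1 + R) ^ (ρ + 2) + C₁, by positivity, by positivity,
    fun p H1 H2 hp S v => ?_⟩
  set B := box n R with hB
  set ν : ℝ := ((B.card : ℕ) : ℝ) with hν
  have hνp : 0 < ν := by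
    rw [hν, hB, card_box]; positivity
  set a₁ : (Fin n → ℤ) → (Fin n → ℤ) → ℝ := fun k m =>
    K * (1 + R : ℝ) ^ (ρ + 2) * wt m ^ (ρ + 1) * (wt (k - m) ^ (2 * n + (ρ + 2)))⁻¹ with ha₁
  set a₂ : (Fin n → ℤ) → (Fin n → ℤ) → ℝ := fun k m =>
    n * ‖k - m‖ / (2 * R + 1) * ‖p (k - m) m‖ with ha₂
  have hl1 := hlow a₁ S (fun k => ‖v k‖) (fun k m => by
    have := (wt_pow_pos (k - m) (2 * n + (ρ + 2))).ne'
    rw [ha₁]; simp only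
    rw [mul_assoc, inv_mul_cancel₀ this, mul_one]) fun k => norm_nonneg _
  have hl2 := top_order_form_le (n := n) (ρ + 2) (K := n * K / (2 * R + 1)) (by positivity)
    a₂ S (fun k => ‖v k‖) (fun k m => by
      have h := H1 (k - m) m
      rw [pow_succ] at h
      have h3 := norm_le_wt (k - m)
      have h4 : ‖k - m‖ * ‖p (k - m) m‖ * wt (k - m) ^ (2 * n + (ρ + 2)) ≤ K * wt m ^ (ρ + 2) := by
        refine le_trans ?_ h
        have := mul_le_mul_of_nonneg_right h3
          (mul_nonneg (norm_nonneg (p (k - m) m)) (wt_pow_pos (k - m) (2 * n + (ρ + 2))).le)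
        linarith
      have h5 : (0 : ℝ) ≤ n / (2 * R + 1) := by positivity
      have := mul_le_mul_of_nonneg_left h4 h5
      rw [ha₂]; simp only
      calc _ = n / (2 * R + 1) * (‖k - m‖ * ‖p (k - m) m‖ * wt (k - m) ^ (2 * n + (ρ + 2))) := by
            ring
        _ ≤ _ := this
        _ = _ := by ring) fun k => norm_nonneg _
  set X := ∑ k ∈ S, wt k ^ (ρ + 2) * ‖v k‖ ^ 2 with hX
  set Y := ∑ k ∈ S, ‖v k‖ ^ 2 with hY
  have hX0 : 0 ≤ X := Finset.sum_nonneg fun k _ => mul_nonneg (wt_pow_pos _ _).le (sq_nonneg _)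
  have hpt : ∀ k m, ν * (⟪v k, p (k - m) m (v m)⟫_ℂ).re ≤
      (∑ η ∈ B, if m + η - k ∈ B then (⟪v k, p (k - m) (m + η) (v m)⟫_ℂ).re else 0) +
      (ν * (a₁ k m * ‖v m‖ * ‖v k‖) + ν * (a₂ k m * ‖v m‖ * ‖v k‖)) := by
    intro k m
    set z := (⟪v k, p (k - m) m (v m)⟫_ℂ).re with hz
    have e1 : ν * z = ∑ η ∈ B, ((if m + η - k ∈ B then
        (⟪v k, p (k - m) (m + η) (v m)⟫_ℂ).re else 0) +
        ((if m + η - k ∈ B then z - (⟪v k, p (k - m) (m + η) (v m)⟫_ℂ).re else 0) +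
        (if η - (k - m) ∉ B then z else 0))) := by
      rw [hν, ← nsmul_eq_mul, ← Finset.sum_const]
      refine Finset.sum_congr rfl fun η _ => ?_
      have : m + η - k = η - (k - m) := by abel
      rw [this]
      split_ifs <;> simp_all
    have e2 : ∑ η ∈ B, (if m + η - k ∈ B then z - (⟪v k, p (k - m) (m + η) (v m)⟫_ℂ).re else 0)
        ≤ ν * (a₁ k m * ‖v m‖ * ‖v k‖) := by
      rw [hν, ← nsmul_eq_mul]
      refine Finset.sum_le_card_nsmul _ _ _ fun η hη => ?_
      have ha0 : 0 ≤ a₁ k m := by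
        have := inv_wt_pow_nonneg (k - m) (2 * n + (ρ + 2))
        have := wt_pow_pos m (ρ + 1)
        rw [ha₁]; positivity
      split_ifs
      · have h1 : z - (⟪v k, p (k - m) (m + η) (v m)⟫_ℂ).re =
            (⟪v k, (p (k - m) m - p (k - m) (m + η)) (v m)⟫_ℂ).re := by
          rw [sub_apply, inner_sub_right, Complex.sub_re]
        rw [h1]
        refine (re_inner_clm_le _ _ _).trans ?_
        gcongr
        refine (le_mul_inv_wt_pow (H2 (k - m) m η)).trans ?_
        have hwη : wt η ≤ 1 + R := by have := wt_le_of_mem_box hη; linarith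
        have h6 := inv_wt_pow_nonneg (k - m) (2 * n + (ρ + 2))
        have h7 := wt_pow_pos m (ρ + 1)
        have h8 : wt η ^ (ρ + 2) ≤ (1 + R : ℝ) ^ (ρ + 2) := pow_le_pow_left₀ (wt_pos η).le hwη _
        exact mul_le_mul_of_nonneg_right (mul_le_mul_of_nonneg_right
          (mul_le_mul_of_nonneg_left h8 hK) h7.le) h6
      · positivity
    have e3 : ∑ η ∈ B, (if η - (k - m) ∉ B then z else 0) ≤ ν * (a₂ k m * ‖v m‖ * ‖v k‖) := by
      rw [← Finset.sum_filter, Finset.sum_const, nsmul_eq_mul]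
      have h1 := card_filter_box_sub_notMem_le R (k - m)
      have h2 : z ≤ ‖p (k - m) m‖ * ‖v m‖ * ‖v k‖ := re_inner_clm_le _ _ _
      set cc : ℝ := ((((box n R).filter fun η => η - (k - m) ∉ box n R).card : ℕ) : ℝ) with hcc
      have hcc0 : 0 ≤ cc := by positivity
      have h3 : cc ≤ n * ‖k - m‖ / (2 * R + 1) * ν := by
        rw [div_mul_eq_mul_div, le_div_iff₀ (by positivity)]
        exact h1
      calc cc * z ≤ cc * (‖p (k - m) m‖ * ‖v m‖ * ‖v k‖) := by gcongr
        _ ≤ n * ‖k - m‖ / (2 * R + 1) * ν * (‖p (k - m) m‖ * ‖v m‖ * ‖v k‖) := by gcongr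
        _ = _ := by rw [ha₂]; ring
    rw [e1, Finset.sum_add_distrib, Finset.sum_add_distrib]
    linarith
  have hsm := smoothing_sum_le hp S B v
  have hlow2 : ν * (c₀ * X - lam * (1 + R) ^ (ρ + 2) * Y) ≤
      lam * ∑ m ∈ S, ∑ η ∈ B, ‖m + η‖ ^ (ρ + 2) * ‖v m‖ ^ 2 := by
    have : ∀ m, ν * (c₀ * (wt m ^ (ρ + 2) * ‖v m‖ ^ 2) -
        lam * (1 + R) ^ (ρ + 2) * ‖v m‖ ^ 2) ≤
        lam * ∑ η ∈ B, ‖m + η‖ ^ (ρ + 2) * ‖v m‖ ^ 2 := by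
      intro m
      rw [hν, ← nsmul_eq_mul, Finset.mul_sum]
      refine Finset.card_nsmul_le_sum _ _ _ fun η hη => ?_
      have h1 := wt_pow_le_of_mem_box (r := ρ + 2) (m := m) hη
      have h2 : c₀ * wt m ^ (ρ + 2) ≤ lam * ((1 + R) ^ (ρ + 2) + ‖m + η‖ ^ (ρ + 2)) := by
        rw [hc₀, div_mul_eq_mul_div, div_le_iff₀ (by positivity)]
        have := mul_le_mul_of_nonneg_left h1 hlam.le
        linarith
      nlinarith [mul_le_mul_of_nonneg_right h2 (sq_nonneg ‖v m‖)]
    have h2 := Finset.sum_le_sum fun m (_ : m ∈ S) => this m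
    rw [← Finset.mul_sum, Finset.sum_sub_distrib, ← Finset.mul_sum, ← Finset.mul_sum,
      ← Finset.mul_sum] at h2
    exact h2
  have htot : ν * ∑ k ∈ S, ∑ m ∈ S, (⟪v k, p (k - m) m (v m)⟫_ℂ).re ≤
      (∑ k ∈ S, ∑ m ∈ S, ∑ η ∈ B,
        (if m + η - k ∈ B then (⟪v k, p (k - m) (m + η) (v m)⟫_ℂ).re else 0)) +
      (ν * (∑ k ∈ S, ∑ m ∈ S, a₁ k m * ‖v m‖ * ‖v k‖) +
       ν * (∑ k ∈ S, ∑ m ∈ S, a₂ k m * ‖v m‖ * ‖v k‖)) := by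
    simp only [Finset.mul_sum, ← Finset.sum_add_distrib]
    exact Finset.sum_le_sum fun k _ => Finset.sum_le_sum fun m _ => hpt k m
  have hl2' := hl2.trans (mul_le_mul_of_nonneg_right hR' hX0)
  refine le_of_mul_le_mul_left (htot.trans ?_) hνp
  have h9 := mul_le_mul_of_nonneg_left hl1 hνp.le
  have h10 := mul_le_mul_of_nonneg_left hl2' hνp.le
  linarith

/-- Gårding's inequality in the weighted norm of order `s`. -/
lemma garding (ρ s : ℕ) {K lam : ℝ} (hK : 0 ≤ K) (hlam : 0 < lam) :
    ∃ C, 0 ≤ C ∧ ∀ p q : (Fin n → ℤ) → (Fin n → ℤ) → E →L[ℂ] E,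
      (∀ j ξ, ‖p j ξ‖ * wt j ^ (2 * n + (ρ + 2) + (s + 1)) ≤ K * wt ξ ^ (ρ + 2)) →
      (∀ j ξ η, ‖p j ξ - p j (ξ + η)‖ * wt j ^ (2 * n + (ρ + 2) + (s + 1)) ≤
        K * wt η ^ (ρ + 2) * wt ξ ^ (ρ + 1)) →
      (∀ j ξ, ‖q j ξ‖ * wt j ^ (2 * n + (ρ + 2) + (s + 1)) ≤ K * wt ξ ^ (ρ + 1)) →
      NegForm ρ lam p → ∀ (S : Finset (Fin n → ℤ)) (v : (Fin n → ℤ) → E),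
      ∑ k ∈ S, ∑ m ∈ S, wt k ^ (2 * s) * (⟪v k, (p (k - m) m + q (k - m) m) (v m)⟫_ℂ).re ≤
        C * ∑ k ∈ S, wt k ^ (2 * s) * ‖v k‖ ^ 2 := by
  obtain ⟨c, C₀, hc, hC₀, hprin⟩ := garding_principal (n := n) (E := E) ρ hK hlam
  obtain ⟨C₁, hC₁, hlow⟩ := lower_order_form_le (n := n) ρ
    (K := (s + 1) * K) (by positivity) hc
  refine ⟨C₀ + C₁, by positivity, fun p q H1 H2 H3 hp S v => ?_⟩
  set V : (Fin n → ℤ) → E := fun k => ((wt k ^ s : ℝ) : ℂ) • v k with hV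
  have hVn : ∀ k, ‖V k‖ = wt k ^ s * ‖v k‖ := fun k => by
    rw [hV]; simp only
    rw [norm_smul, Complex.norm_real, Real.norm_of_nonneg (wt_pow_pos k s).le]
  have hVn2 : ∀ k, ‖V k‖ ^ 2 = wt k ^ (2 * s) * ‖v k‖ ^ 2 := fun k => by
    rw [hVn]; ring
  set b : (Fin n → ℤ) → (Fin n → ℤ) → ℝ := fun k m =>
    |wt k ^ s - wt m ^ s| / wt m ^ s * ‖p (k - m) m‖ + wt k ^ s / wt m ^ s * ‖q (k - m) m‖ with hb
  have hbb : ∀ k m, b k m * wt (k - m) ^ (2 * n + (ρ + 2)) ≤ (s + 1) * K * wt m ^ (ρ + 1) := by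
    intro k m
    have hm := wt_pos m
    have hms := wt_pow_pos m s
    have hj := wt_pow_pos (k - m) (2 * n + (ρ + 2))
    have h1 : |wt k ^ s - wt m ^ s| / wt m ^ s * wt m ≤ s * wt (k - m) ^ (s + 1) := by
      rw [div_mul_eq_mul_div, div_le_iff₀ hms]
      exact abs_wt_pow_sub_wt_pow_le k m s
    have h2 : wt k ^ s / wt m ^ s ≤ wt (k - m) ^ (s + 1) := by
      rw [div_le_iff₀ hms]
      refine (wt_pow_le_sub_mul k m s).trans ?_
      exact mul_le_mul_of_nonneg_right (wt_pow_mono _ (by omega)) hms.le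
    have g1 := H1 (k - m) m
    have g3 := H3 (k - m) m
    rw [pow_add] at g1 g3
    set J := wt (k - m) ^ (2 * n + (ρ + 2)) with hJ
    set J' := wt (k - m) ^ (s + 1) with hJ'
    have t1 : |wt k ^ s - wt m ^ s| / wt m ^ s * ‖p (k - m) m‖ * J ≤ s * (K * wt m ^ (ρ + 1)) := by
      refine le_of_mul_le_mul_right ?_ hm
      calc _ = (|wt k ^ s - wt m ^ s| / wt m ^ s * wt m) * (‖p (k - m) m‖ * J) := by ring
        _ ≤ (s * J') * (‖p (k - m) m‖ * J) :=
            mul_le_mul_of_nonneg_right h1 (mul_nonneg (norm_nonneg _) hj.le)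
        _ = s * (‖p (k - m) m‖ * (J * J')) := by ring
        _ ≤ s * (K * wt m ^ (ρ + 2)) := by gcongr
        _ = _ := by ring
    have t2 : wt k ^ s / wt m ^ s * ‖q (k - m) m‖ * J ≤ K * wt m ^ (ρ + 1) := by
      calc _ = wt k ^ s / wt m ^ s * (‖q (k - m) m‖ * J) := by ring
        _ ≤ J' * (‖q (k - m) m‖ * J) :=
            mul_le_mul_of_nonneg_right h2 (mul_nonneg (norm_nonneg _) hj.le)
        _ = ‖q (k - m) m‖ * (J * J') := by ring
        _ ≤ _ := g3
    calc b k m * J = |wt k ^ s - wt m ^ s| / wt m ^ s * ‖p (k - m) m‖ * J +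
          wt k ^ s / wt m ^ s * ‖q (k - m) m‖ * J := by rw [hb]; ring
      _ ≤ s * (K * wt m ^ (ρ + 1)) + K * wt m ^ (ρ + 1) := add_le_add t1 t2
      _ = _ := by ring
  have hpt : ∀ k m, wt k ^ (2 * s) * (⟪v k, (p (k - m) m + q (k - m) m) (v m)⟫_ℂ).re ≤
      (⟪V k, p (k - m) m (V m)⟫_ℂ).re + b k m * ‖V m‖ * ‖V k‖ := by
    intro k m
    have hms := wt_pow_pos m s
    have hks := wt_pow_pos k s
    set z₁ := (⟪v k, p (k - m) m (v m)⟫_ℂ).re with hz₁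
    set z₂ := (⟪v k, q (k - m) m (v m)⟫_ℂ).re with hz₂
    have e0 : (⟪V k, p (k - m) m (V m)⟫_ℂ).re = wt k ^ s * wt m ^ s * z₁ := by
      rw [hV]; simp only
      rw [map_smul, inner_smul_left, inner_smul_right, Complex.conj_ofReal, Complex.re_ofReal_mul,
        Complex.re_ofReal_mul]; ring
    have e1 : (⟪v k, (p (k - m) m + q (k - m) m) (v m)⟫_ℂ).re = z₁ + z₂ := by
      rw [add_apply, inner_add_right, Complex.add_re]
    have b1 : |z₁| ≤ ‖p (k - m) m‖ * ‖v m‖ * ‖v k‖ := by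
      refine (Complex.abs_re_le_norm _).trans ((norm_inner_le_norm _ _).trans ?_)
      rw [mul_comm]
      exact mul_le_mul_of_nonneg_right ((p (k - m) m).le_opNorm _) (norm_nonneg _)
    have b2 : z₂ ≤ ‖q (k - m) m‖ * ‖v m‖ * ‖v k‖ := re_inner_clm_le _ _ _
    have b3 : wt k ^ s * (wt k ^ s - wt m ^ s) * z₁ ≤
        wt k ^ s * |wt k ^ s - wt m ^ s| * (‖p (k - m) m‖ * ‖v m‖ * ‖v k‖) := by
      rw [mul_assoc, mul_assoc]
      refine mul_le_mul_of_nonneg_left ?_ hks.le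
      refine (le_abs_self _).trans ?_
      rw [abs_mul]
      exact mul_le_mul_of_nonneg_left b1 (abs_nonneg _)
    have b4 : wt k ^ (2 * s) * z₂ ≤ wt k ^ (2 * s) * (‖q (k - m) m‖ * ‖v m‖ * ‖v k‖) :=
      mul_le_mul_of_nonneg_left b2 (wt_pow_pos _ _).le
    have e2 : b k m * ‖V m‖ * ‖V k‖ =
        wt k ^ s * |wt k ^ s - wt m ^ s| * (‖p (k - m) m‖ * ‖v m‖ * ‖v k‖) +
        wt k ^ (2 * s) * (‖q (k - m) m‖ * ‖v m‖ * ‖v k‖) := by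
      rw [hVn, hVn, hb, mul_comm 2 s, pow_mul]; simp only
      field_simp
    rw [e0, e1, e2]
    have : wt k ^ (2 * s) = wt k ^ s * wt k ^ s := by rw [← pow_add]; congr 1; ring
    rw [this] at b4 ⊢
    nlinarith
  have h1 := hprin p (fun j ξ => le_trans (mul_le_mul_of_nonneg_left
      (wt_pow_mono j (by omega)) (norm_nonneg _)) (H1 j ξ))
    (fun j ξ η => le_trans (mul_le_mul_of_nonneg_left
      (wt_pow_mono j (by omega)) (norm_nonneg _)) (H2 j ξ η)) hp S V
  have h2 := hlow b S (fun k => ‖V k‖) hbb fun k => norm_nonneg _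
  have h3 := Finset.sum_le_sum fun k (_ : k ∈ S) => Finset.sum_le_sum fun m (_ : m ∈ S) => hpt k m
  simp only [Finset.sum_add_distrib] at h3
  simp only [← hVn2]
  linarith

end Garding

section LinearODE

open Set
open scoped NNReal

variable {F : Type*} [NormedAddCommGroup F] [NormedSpace ℝ F]

lemma hasDerivWithinAt_glue {a b c : ℝ} (hab : a ≤ b) (hbc : b ≤ c) {x y : ℝ → F} {f : ℝ → F → F}
    (hx : ∀ t ∈ Icc a b, HasDerivWithinAt x (f t (x t)) (Icc a b) t)
    (hy : ∀ t ∈ Icc b c, HasDerivWithinAt y (f t (y t)) (Icc b c) t) (hxy : y b = x b) :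
    ∀ t ∈ Icc a c, HasDerivWithinAt (fun t => if t ≤ b then x t else y t)
      (f t (if t ≤ b then x t else y t)) (Icc a c) t := by
  intro t ht
  rw [← Icc_union_Icc_eq_Icc hab hbc]
  have hzx : ∀ s ∈ Icc a b, (if s ≤ b then x s else y s) = x s := fun s hs => if_pos hs.2
  have hzy : ∀ s ∈ Icc b c, (if s ≤ b then x s else y s) = y s := fun s hs => by
    split_ifs with h
    · have : s = b := le_antisymm h hs.1
      rw [this, hxy]
    · rfl
  refine HasDerivWithinAt.union ?_ ?_
  · by_cases h : t ∈ Icc a b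
    · rw [hzx t h]
      exact (hx t h).congr hzx (hzx t h)
    · refine HasFDerivWithinAt.of_notMem_closure ?_
      rwa [isClosed_Icc.closure_eq]
  · by_cases h : t ∈ Icc b c
    · rw [hzy t h]
      exact (hy t h).congr hzy (hzy t h)
    · refine HasFDerivWithinAt.of_notMem_closure ?_
      rwa [isClosed_Icc.closure_eq]

variable [CompleteSpace F]

lemma exists_linear_ode_short {a b : ℝ} (hab : a ≤ b) {A : ℝ → F →L[ℝ] F} {g : ℝ → F} {M B : ℝ}
    (hA : ContinuousOn A (Icc a b)) (hg : ContinuousOn g (Icc a b))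
    (hM : ∀ t ∈ Icc a b, ‖A t‖ ≤ M) (hB : ∀ t ∈ Icc a b, ‖g t‖ ≤ B)
    (hsmall : (2 * M + B) * (b - a) ≤ 1) (x₀ : F) :
    ∃ x : ℝ → F, x a = x₀ ∧
      ∀ t ∈ Icc a b, HasDerivWithinAt x (A t (x t) + g t) (Icc a b) t := by
  have hM0 : 0 ≤ M := (norm_nonneg _).trans (hM a ⟨le_rfl, hab⟩)
  have hB0 : 0 ≤ B := (norm_nonneg _).trans (hB a ⟨le_rfl, hab⟩)
  set R : ℝ≥0 := ‖x₀‖₊ + 1 with hR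
  have hRc : (R : ℝ) = ‖x₀‖ + 1 := by rw [hR]; simp
  set L : ℝ≥0 := ⟨(2 * M + B) * R, by positivity⟩ with hL
  have hpl : IsPicardLindelof (fun t x => A t x + g t) (⟨a, le_rfl, hab⟩ : Icc a b) x₀ R 0 L
      ⟨M, hM0⟩ := by
    constructor
    · intro t ht
      refine LipschitzOnWith.of_dist_le_mul fun x _ y _ => ?_
      rw [dist_add_right, dist_eq_norm, ← map_sub, dist_eq_norm]
      exact (A t).le_of_opNorm_le (hM t ht) _
    · intro x _
      exact (hA.clm_apply continuousOn_const).add hg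
    · intro t ht x hx
      rw [Metric.mem_closedBall, dist_eq_norm] at hx
      have h1 : ‖x‖ ≤ ‖x₀‖ + R := by
        have := norm_le_norm_add_norm_sub' x x₀; linarith
      have h2 : ‖A t x‖ ≤ M * (‖x₀‖ + R) :=
        ((A t).le_of_opNorm_le (hM t ht) x).trans (mul_le_mul_of_nonneg_left h1 hM0)
      have h3 := hB t ht
      refine (norm_add_le _ _).trans ((add_le_add h2 h3).trans ?_)
      change _ ≤ (2 * M + B) * (R : ℝ)
      have := norm_nonneg x₀
      rw [hRc]
      nlinarith [mul_nonneg hB0 this]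
    · have h1 : max (b - a) (a - a) = b - a := max_eq_left (by linarith)
      simp only [h1]
      change (2 * M + B) * (R : ℝ) * (b - a) ≤ (R : ℝ) - ((0 : ℝ≥0) : ℝ)
      have : (0 : ℝ) ≤ R := R.2
      rw [NNReal.coe_zero, sub_zero]
      nlinarith
  obtain ⟨x, hx0, hx⟩ := hpl.exists_eq_forall_mem_Icc_hasDerivWithinAt₀
  exact ⟨x, hx0, hx⟩

/-- Global existence for linear ordinary differential equations on a compact interval. -/
lemma exists_linear_ode {T : ℝ} (hT : 0 ≤ T) {A : ℝ → F →L[ℝ] F} {g : ℝ → F}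
    (hA : ContinuousOn A (Icc 0 T)) (hg : ContinuousOn g (Icc 0 T)) (x₀ : F) :
    ∃ x : ℝ → F, x 0 = x₀ ∧
      ∀ t ∈ Icc 0 T, HasDerivWithinAt x (A t (x t) + g t) (Icc 0 T) t := by
  obtain ⟨M, hM⟩ := isCompact_Icc.exists_bound_of_continuousOn hA
  obtain ⟨B, hB⟩ := isCompact_Icc.exists_bound_of_continuousOn hg
  have hM0 : 0 ≤ M := (norm_nonneg _).trans (hM 0 ⟨le_rfl, hT⟩)
  have hB0 : 0 ≤ B := (norm_nonneg _).trans (hB 0 ⟨le_rfl, hT⟩)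
  obtain ⟨N, hN⟩ := exists_nat_ge ((2 * M + B) * T)
  have hN1 : (0 : ℝ) < N + 1 := by positivity
  set h : ℝ := T / (N + 1) with hh
  have hh0 : 0 ≤ h := by positivity
  have hstep : (2 * M + B) * h ≤ 1 := by
    rw [hh, ← mul_div_assoc, div_le_one hN1]; linarith
  have key : ∀ j : ℕ, j ≤ N + 1 → ∃ x : ℝ → F, x 0 = x₀ ∧
      ∀ t ∈ Icc 0 (j * h), HasDerivWithinAt x (A t (x t) + g t) (Icc 0 (j * h)) t := by
    intro j
    induction j with
    | zero =>
      intro _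
      refine ⟨fun _ => x₀, rfl, fun t ht => ?_⟩
      simp only [Nat.cast_zero, zero_mul, Icc_self] at ht ⊢
      rw [mem_singleton_iff.mp ht]
      exact HasFDerivWithinAt.of_subsingleton Set.subsingleton_singleton
    | succ j ih =>
      intro hj
      obtain ⟨x, hx0, hx⟩ := ih (by omega)
      have hle : ((j : ℝ) + 1) * h ≤ T := by
        have h1 : ((j : ℝ) + 1) ≤ N + 1 := by exact_mod_cast hj
        calc ((j : ℝ) + 1) * h ≤ (N + 1) * h := by gcongr
          _ = T := by rw [hh]; field_simp
      have h0 : 0 ≤ (j : ℝ) * h := by positivity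
      have hjj : (j : ℝ) * h ≤ ((j : ℝ) + 1) * h := by gcongr; linarith
      have hsub : Icc ((j : ℝ) * h) (((j : ℝ) + 1) * h) ⊆ Icc 0 T :=
        Icc_subset_Icc h0 hle
      obtain ⟨y, hy0, hy⟩ := exists_linear_ode_short hjj (hA.mono hsub) (hg.mono hsub)
        (fun t ht => hM t (hsub ht)) (fun t ht => hB t (hsub ht))
        (by have : ((j : ℝ) + 1) * h - j * h = h := by ring
            rw [this]; exact hstep) (x (j * h))
      push_cast
      refine ⟨fun t => if t ≤ j * h then x t else y t, by simp [h0, hx0], ?_⟩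
      exact hasDerivWithinAt_glue (f := fun t z => A t z + g t) h0 hjj hx hy hy0
  obtain ⟨x, hx0, hx⟩ := key (N + 1) le_rfl
  have e : ((N + 1 : ℕ) : ℝ) * h = T := by rw [hh]; push_cast; field_simp
  rw [e] at hx
  exact ⟨x, hx0, hx⟩

end LinearODE

section LimitDerivative

open Set Filter Topology

variable {X F ι : Type*} [NormedAddCommGroup X] [NormedSpace ℝ X] [NormedAddCommGroup F]
  [NormedSpace ℝ F]

/-- Termwise differentiation within a convex set. -/
lemma hasFDerivWithinAt_of_tendstoUniformlyOn {l : Filter ι} [l.NeBot] {s : Set X}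
    (hs : Convex ℝ s) {f : ι → X → F} {f' : ι → X → X →L[ℝ] F} {g : X → F} {g' : X → X →L[ℝ] F}
    (hf : ∀ᶠ i in l, ∀ x ∈ s, HasFDerivWithinAt (f i) (f' i x) s x)
    (hfg : ∀ x ∈ s, Tendsto (fun i => f i x) l (𝓝 (g x)))
    (hfg' : TendstoUniformlyOn f' g' l s) {x : X} (hx : x ∈ s) :
    HasFDerivWithinAt g (g' x) s x := by
  refine HasFDerivWithinAt.of_isLittleO ?_
  rw [Asymptotics.isLittleO_iff]
  intro ε hε
  have hε4 : 0 < ε / 4 := by positivity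
  rw [Metric.tendstoUniformlyOn_iff] at hfg'
  have hev := (hfg' (ε / 4) hε4).and hf
  obtain ⟨N, hN, hfN⟩ := hev.exists
  have hd := (hfN x hx).isLittleO
  rw [Asymptotics.isLittleO_iff] at hd
  filter_upwards [hd hε4, self_mem_nhdsWithin] with y hy hys
  have h1 : ∀ᶠ i in l, ‖(f i y - f N y) - (f i x - f N x)‖ ≤ ε / 2 * ‖y - x‖ := by
    filter_upwards [hev] with i hi
    refine hs.norm_image_sub_le_of_norm_hasFDerivWithin_le (f := fun z => f i z - f N z)
      (f' := fun z => f' i z - f' N z)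
      (fun z hz => (hi.2 z hz).sub (hfN z hz)) (fun z hz => ?_) hx hys
    have a1 := hi.1 z hz
    have a2 := hN z hz
    rw [dist_eq_norm] at a1 a2
    calc ‖f' i z - f' N z‖ = ‖(g' z - f' N z) - (g' z - f' i z)‖ := by congr 1; abel
      _ ≤ ‖g' z - f' N z‖ + ‖g' z - f' i z‖ := norm_sub_le _ _
      _ ≤ ε / 2 := by linarith
  have h2 : ‖(g y - f N y) - (g x - f N x)‖ ≤ ε / 2 * ‖y - x‖ :=
    le_of_tendsto ((((hfg y hys).sub_const _).sub ((hfg x hx).sub_const _)).norm) h1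
  have h3 : ‖(f' N x - g' x) (y - x)‖ ≤ ε / 4 * ‖y - x‖ := by
    refine ContinuousLinearMap.le_of_opNorm_le _ ?_ _
    have := hN x hx
    rw [dist_eq_norm, norm_sub_rev] at this
    exact this.le
  have e : g y - g x - g' x (y - x) = ((g y - f N y) - (g x - f N x)) +
      (f N y - f N x - f' N x (y - x)) + (f' N x - g' x) (y - x) := by
    rw [sub_apply]; abel
  rw [e]
  refine (norm_add_le _ _).trans ?_
  have := norm_add_le ((g y - f N y) - (g x - f N x)) (f N y - f N x - f' N x (y - x))
  linarith

lemma hasDerivWithinAt_of_tendstoUniformlyOn {l : Filter ι} [l.NeBot] {s : Set ℝ}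
    (hs : Convex ℝ s) {f : ι → ℝ → F} {f' : ι → ℝ → F} {g : ℝ → F} {g' : ℝ → F}
    (hf : ∀ᶠ i in l, ∀ x ∈ s, HasDerivWithinAt (f i) (f' i x) s x)
    (hfg : ∀ x ∈ s, Tendsto (fun i => f i x) l (𝓝 (g x)))
    (hfg' : TendstoUniformlyOn f' g' l s) {x : ℝ} (hx : x ∈ s) :
    HasDerivWithinAt g (g' x) s x := by
  have h := hasFDerivWithinAt_of_tendstoUniformlyOn hs (f := f)
    (f' := fun i x => ContinuousLinearMap.toSpanSingleton ℝ (f' i x)) (g := g)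
    (g' := fun x => ContinuousLinearMap.toSpanSingleton ℝ (g' x))
    (hf.mono fun i hi x hx => (hi x hx).hasFDerivWithinAt) hfg ?_ hx
  · exact h.hasDerivWithinAt.congr_deriv (by simp)
  · rw [Metric.tendstoUniformlyOn_iff] at hfg' ⊢
    intro ε hε
    filter_upwards [hfg' ε hε] with i hi z hz
    have := hi z hz
    rw [dist_eq_norm] at this ⊢
    refine lt_of_le_of_lt ?_ this
    refine ContinuousLinearMap.opNorm_le_bound _ (norm_nonneg _) fun c => ?_
    simp [← smul_sub, norm_smul, mul_comm]

/-- Differentiation of a series within a convex set. -/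
lemma hasFDerivWithinAt_tsum_of_bound [CompleteSpace F] {s : Set X}
    (hs : Convex ℝ s) {f : ι → X → F} {f' : ι → X → X →L[ℝ] F} {a : ι → ℝ} (ha : Summable a)
    (hf : ∀ i, ∀ x ∈ s, HasFDerivWithinAt (f i) (f' i x) s x)
    (hsum : ∀ x ∈ s, Summable fun i => f i x)
    (hbd : ∀ i, ∀ x ∈ s, ‖f' i x‖ ≤ a i) {x : X} (hx : x ∈ s) :
    HasFDerivWithinAt (fun x => ∑' i, f i x) (∑' i, f' i x) s x :=
  hasFDerivWithinAt_of_tendstoUniformlyOn (l := (atTop : Filter (Finset ι))) hs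
    (f := fun S x => ∑ i ∈ S, f i x) (f' := fun S x => ∑ i ∈ S, f' i x)
    (g := fun x => ∑' i, f i x) (g' := fun x => ∑' i, f' i x)
    (Eventually.of_forall fun _ x hx => HasFDerivWithinAt.fun_sum fun i _ => hf i x hx)
    (fun x hx => (hsum x hx).hasSum) (tendstoUniformlyOn_tsum ha hbd) hx

lemma hasDerivWithinAt_tsum_of_bound [CompleteSpace F] {s : Set ℝ}
    (hs : Convex ℝ s) {f : ι → ℝ → F} {f' : ι → ℝ → F} {a : ι → ℝ} (ha : Summable a)
    (hf : ∀ i, ∀ x ∈ s, HasDerivWithinAt (f i) (f' i x) s x)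
    (hsum : ∀ x ∈ s, Summable fun i => f i x)
    (hbd : ∀ i, ∀ x ∈ s, ‖f' i x‖ ≤ a i) {x : ℝ} (hx : x ∈ s) :
    HasDerivWithinAt (fun x => ∑' i, f i x) (∑' i, f' i x) s x :=
  hasDerivWithinAt_of_tendstoUniformlyOn (l := (atTop : Filter (Finset ι))) hs
    (f := fun S x => ∑ i ∈ S, f i x) (f' := fun S x => ∑ i ∈ S, f' i x)
    (g := fun x => ∑' i, f i x) (g' := fun x => ∑' i, f' i x)
    (Eventually.of_forall fun _ x hx => HasDerivWithinAt.fun_sum fun i _ => hf i x hx)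
    (fun x hx => (hsum x hx).hasSum) (tendstoUniformlyOn_tsum ha hbd) hx

end LimitDerivative

section Energy

open Set
open scoped InnerProductSpace

variable {n : ℕ} {E : Type*} [NormedAddCommGroup E] [InnerProductSpace ℂ E]

/-- Gronwall's inequality on `[0, T]`. -/
lemma le_exp_of_deriv_le {T c G : ℝ} (hc : 0 ≤ c) (hG : 0 ≤ G) {e e' : ℝ → ℝ}
    (he : ∀ t ∈ Icc 0 T, HasDerivWithinAt e (e' t) (Icc 0 T) t)
    (hle : ∀ t ∈ Icc 0 T, e' t ≤ c * e t + G) (he0 : 0 ≤ e 0) {t : ℝ} (ht : t ∈ Icc 0 T) :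
    e t ≤ (e 0 + T * G) * Real.exp (c * T) := by
  set φ : ℝ → ℝ := fun t => Real.exp (-(c * t)) * e t - G * t with hφ
  have hexp : ∀ t, HasDerivAt (fun t => Real.exp (-(c * t))) (Real.exp (-(c * t)) * (-c)) t := by
    intro t
    have h : HasDerivAt (fun t => -(c * t)) (-c) t := by
      simpa using ((hasDerivAt_id t).const_mul c).fun_neg
    exact h.exp
  have hφ' : ∀ t ∈ Icc 0 T, HasDerivWithinAt φ
      (Real.exp (-(c * t)) * (-c) * e t + Real.exp (-(c * t)) * e' t - G * 1) (Icc 0 T) t :=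
    fun t ht => ((hexp t).hasDerivWithinAt.mul (he t ht)).sub
      ((hasDerivWithinAt_id t _).const_mul G)
  have hanti : AntitoneOn φ (Icc 0 T) := by
    refine antitoneOn_of_deriv_nonpos (convex_Icc 0 T)
      (fun t ht => (hφ' t ht).continuousWithinAt) ?_ ?_
    · intro t ht
      exact ((hφ' t (interior_subset ht)).mono interior_subset).differentiableWithinAt
    · intro t ht
      have ht' := interior_subset ht
      have hd := (hφ' t ht').hasDerivAt (mem_interior_iff_mem_nhds.mp ht)
      rw [hd.deriv]
      have h1 := hle t ht'
      have h2 : Real.exp (-(c * t)) ≤ 1 := by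
        rw [Real.exp_le_one_iff]
        have := mul_nonneg hc ht'.1
        linarith
      have h3 := Real.exp_pos (-(c * t))
      nlinarith
  have h0 : (0 : ℝ) ∈ Icc 0 T := ⟨le_rfl, ht.1.trans ht.2⟩
  have h := hanti h0 ht ht.1
  simp only [hφ, mul_zero, neg_zero, Real.exp_zero, one_mul, sub_zero] at h
  have h1 : Real.exp (-(c * t)) * e t ≤ e 0 + T * G := by
    have := mul_le_mul_of_nonneg_right ht.2 hG
    linarith
  have h2 : e t ≤ (e 0 + T * G) * Real.exp (c * t) := by
    have h4 := mul_le_mul_of_nonneg_right h1 (Real.exp_pos (c * t)).le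
    have h5 : Real.exp (-(c * t)) * Real.exp (c * t) = 1 := by
      rw [← Real.exp_add]; simp
    calc e t = (Real.exp (-(c * t)) * Real.exp (c * t)) * e t := by rw [h5, one_mul]
      _ = Real.exp (-(c * t)) * e t * Real.exp (c * t) := by ring
      _ ≤ _ := h4
  have hT : 0 ≤ T := ht.1.trans ht.2
  refine h2.trans (mul_le_mul_of_nonneg_left ?_ (by positivity))
  exact Real.exp_le_exp.mpr (mul_le_mul_of_nonneg_left ht.2 hc)

/-- The weighted energy estimate for finite systems. -/
lemma energy_estimate {T C G : ℝ} {s : ℕ} (hC : 0 ≤ C) (hG : 0 ≤ G) {S : Finset (Fin n → ℤ)}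
    {M : ℝ → (Fin n → ℤ) → (Fin n → ℤ) → E →L[ℂ] E}
    (hM : ∀ t ∈ Icc 0 T, ∀ v : (Fin n → ℤ) → E,
      ∑ k ∈ S, ∑ m ∈ S, wt k ^ (2 * s) * (⟪v k, M t k m (v m)⟫_ℂ).re ≤
        C * ∑ k ∈ S, wt k ^ (2 * s) * ‖v k‖ ^ 2)
    {w g : (Fin n → ℤ) → ℝ → E}
    (hw : ∀ k ∈ S, ∀ t ∈ Icc 0 T,
      HasDerivWithinAt (w k) (∑ m ∈ S, M t k m (w m t) + g k t) (Icc 0 T) t)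
    (hg : ∀ t ∈ Icc 0 T, ∑ k ∈ S, wt k ^ (2 * s) * ‖g k t‖ ^ 2 ≤ G) {t : ℝ} (ht : t ∈ Icc 0 T) :
    ∑ k ∈ S, wt k ^ (2 * s) * ‖w k t‖ ^ 2 ≤
      (∑ k ∈ S, wt k ^ (2 * s) * ‖w k 0‖ ^ 2 + T * G) * Real.exp ((2 * C + 1) * T) := by
  refine le_exp_of_deriv_le (e := fun t => ∑ k ∈ S, wt k ^ (2 * s) * ‖w k t‖ ^ 2)
    (e' := fun t => ∑ k ∈ S, wt k ^ (2 * s) *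
      (2 * (⟪w k t, ∑ m ∈ S, M t k m (w m t) + g k t⟫_ℂ).re)) (by positivity) hG ?_ ?_ ?_ ht
  · intro t ht
    refine HasDerivWithinAt.fun_sum fun k hk => HasDerivWithinAt.const_mul _ ?_
    let _ : InnerProductSpace ℝ E := InnerProductSpace.complexToReal
    have h := HasDerivWithinAt.norm_sq (F := E) (hw k hk t ht)
    rwa [real_inner_eq_re_inner ℂ] at h
  · intro t ht
    have h1 := hM t ht fun k => w k t
    have h2 := hg t ht
    have e1 : ∑ k ∈ S, wt k ^ (2 * s) * (2 * (⟪w k t, ∑ m ∈ S, M t k m (w m t) + g k t⟫_ℂ).re) =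
        2 * (∑ k ∈ S, ∑ m ∈ S, wt k ^ (2 * s) * (⟪w k t, M t k m (w m t)⟫_ℂ).re) +
        ∑ k ∈ S, wt k ^ (2 * s) * (2 * (⟪w k t, g k t⟫_ℂ).re) := by
      rw [Finset.mul_sum, ← Finset.sum_add_distrib]
      refine Finset.sum_congr rfl fun k _ => ?_
      rw [inner_add_right, inner_sum, Complex.add_re, Complex.re_sum, ← Finset.mul_sum]
      ring
    have h3 : ∑ k ∈ S, wt k ^ (2 * s) * (2 * (⟪w k t, g k t⟫_ℂ).re) ≤
        ∑ k ∈ S, wt k ^ (2 * s) * ‖w k t‖ ^ 2 + ∑ k ∈ S, wt k ^ (2 * s) * ‖g k t‖ ^ 2 := by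
      rw [← Finset.sum_add_distrib]
      refine Finset.sum_le_sum fun k _ => ?_
      rw [← mul_add]
      refine mul_le_mul_of_nonneg_left ?_ (wt_pow_pos _ _).le
      nlinarith [re_inner_le (w k t) (g k t), sq_nonneg (‖w k t‖ - ‖g k t‖)]
    rw [e1]
    linarith
  · exact Finset.sum_nonneg fun k _ => mul_nonneg (wt_pow_pos _ _).le (sq_nonneg _)

end Energy

section Galerkin

open Set Filter Topology
open scoped InnerProductSpace

variable {n : ℕ} {E : Type*} [NormedAddCommGroup E] [InnerProductSpace ℂ E]

/-- Off-diagonal decay of a family of infinite matrices over `ℤ^n` of order `r` in the column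
index, uniformly on `[0, T]`. -/
def OffDiagDecay (T : ℝ) (r : ℕ) (M : ℝ → (Fin n → ℤ) → (Fin n → ℤ) → E →L[ℂ] E) : Prop :=
  ∀ j : ℕ, ∃ K, 0 ≤ K ∧ ∀ t ∈ Icc 0 T, ∀ k m, ‖M t k m‖ * wt (k - m) ^ j ≤ K * wt m ^ r

/-- A family of infinite matrices over `ℤ^n` of order `r` in the column index, decaying rapidly
off the diagonal, and satisfying Gårding's inequality in all weighted norms. -/
structure IsGarding (T : ℝ) (r : ℕ) (M : ℝ → (Fin n → ℤ) → (Fin n → ℤ) → E →L[ℂ] E) : Prop where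
  cont : ∀ k m, ContinuousOn (fun t => M t k m) (Icc 0 T)
  bound : OffDiagDecay T r M
  garding : ∀ s : ℕ, ∃ C, 0 ≤ C ∧ ∀ t ∈ Icc 0 T, ∀ (S : Finset (Fin n → ℤ))
    (v : (Fin n → ℤ) → E),
    ∑ k ∈ S, ∑ m ∈ S, wt k ^ (2 * s) * (⟪v k, M t k m (v m)⟫_ℂ).re ≤
      C * ∑ k ∈ S, wt k ^ (2 * s) * ‖v k‖ ^ 2

/-- Rapid decay in the frequency, uniformly on `[0, T]`. -/
def RapidDecay {F : Type*} [NormedAddCommGroup F] (T : ℝ) (g : (Fin n → ℤ) → ℝ → F) : Prop :=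
  ∀ j : ℕ, ∃ K, 0 ≤ K ∧ ∀ k, ∀ t ∈ Icc 0 T, ‖g k t‖ * wt k ^ j ≤ K

variable {T : ℝ} {r : ℕ} {M : ℝ → (Fin n → ℤ) → (Fin n → ℤ) → E →L[ℂ] E}

lemma OffDiagDecay.apply_bound (hM : OffDiagDecay T r M) (j : ℕ) :
    ∃ K, 0 ≤ K ∧ ∀ t ∈ Icc 0 T, ∀ k m, ∀ (x : E) (Q : ℝ), ‖x‖ * wt m ^ (r + j + 2 * n) ≤ Q →
      ‖M t k m x‖ * wt k ^ j ≤ K * Q * (wt m ^ (2 * n))⁻¹ := by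
  obtain ⟨K, hK, h⟩ := hM j
  refine ⟨K, hK, fun t ht k m x Q hQ => ?_⟩
  have hm := wt_pow_pos m (2 * n)
  rw [← div_eq_mul_inv, le_div_iff₀ hm]
  have h1 := h t ht k m
  have h2 := wt_pow_le_sub_mul k m j
  have h3 := (M t k m).le_opNorm x
  have hk := wt_pow_pos k j
  have hmj := wt_pow_pos m j
  calc ‖M t k m x‖ * wt k ^ j * wt m ^ (2 * n)
      ≤ (‖M t k m‖ * ‖x‖) * (wt (k - m) ^ j * wt m ^ j) * wt m ^ (2 * n) := by gcongr
    _ = (‖M t k m‖ * wt (k - m) ^ j) * (‖x‖ * wt m ^ j * wt m ^ (2 * n)) := by ring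
    _ ≤ (K * wt m ^ r) * (‖x‖ * wt m ^ j * wt m ^ (2 * n)) := by gcongr
    _ = K * (‖x‖ * wt m ^ (r + j + 2 * n)) := by rw [pow_add, pow_add]; ring
    _ ≤ K * Q := by gcongr

lemma sum_inv_wt_pow_le (S : Finset (Fin n → ℤ)) : ∑ m ∈ S, (wt m ^ (2 * n))⁻¹ ≤ latSum n :=
  (summable_inv_wt_pow n).sum_le_tsum S fun m _ => inv_wt_pow_nonneg m _

lemma OffDiagDecay.sum_bound [CompleteSpace E] (hM : OffDiagDecay T r M) (j : ℕ) :
    ∃ K, 0 ≤ K ∧ ∀ t ∈ Icc 0 T, ∀ k, ∀ (x : (Fin n → ℤ) → E) (Q : ℝ), 0 ≤ Q →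
      (∀ m, ‖x m‖ * wt m ^ (r + j + 2 * n) ≤ Q) →
      (Summable fun m => M t k m (x m)) ∧
      (∀ S : Finset (Fin n → ℤ), ‖∑ m ∈ S, M t k m (x m)‖ * wt k ^ j ≤ K * Q) ∧
      ‖∑' m, M t k m (x m)‖ * wt k ^ j ≤ K * Q := by
  obtain ⟨K, hK, h⟩ := hM.apply_bound j
  refine ⟨K * latSum n, mul_nonneg hK (latSum_nonneg n), fun t ht k x Q hQ hx => ?_⟩
  have hb := fun m => h t ht k m (x m) Q (hx m)
  have hs : Summable fun m => M t k m (x m) := by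
    refine Summable.of_norm_bounded ((summable_inv_wt_pow n).mul_left (K * Q)) fun m => ?_
    refine le_trans ?_ (hb m)
    have := one_le_wt_pow k j
    nlinarith [norm_nonneg (M t k m (x m))]
  have hfin : ∀ S : Finset (Fin n → ℤ),
      ‖∑ m ∈ S, M t k m (x m)‖ * wt k ^ j ≤ K * latSum n * Q := by
    intro S
    calc ‖∑ m ∈ S, M t k m (x m)‖ * wt k ^ j
        ≤ (∑ m ∈ S, ‖M t k m (x m)‖) * wt k ^ j :=
          mul_le_mul_of_nonneg_right (norm_sum_le _ _) (wt_pow_pos _ _).le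
      _ = ∑ m ∈ S, ‖M t k m (x m)‖ * wt k ^ j := by rw [Finset.sum_mul]
      _ ≤ ∑ m ∈ S, K * Q * (wt m ^ (2 * n))⁻¹ := Finset.sum_le_sum fun m _ => hb m
      _ = K * Q * ∑ m ∈ S, (wt m ^ (2 * n))⁻¹ := by rw [Finset.mul_sum]
      _ ≤ K * Q * latSum n := mul_le_mul_of_nonneg_left (sum_inv_wt_pow_le S) (by positivity)
      _ = _ := by ring
  exact ⟨hs, hfin, le_of_tendsto ((hs.hasSum.norm).mul_const _) (Eventually.of_forall hfin)⟩

lemma sum_wt_sq_le {F : Type*} [NormedAddCommGroup F] {s : ℕ} {Q : ℝ}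
    {S : Finset (Fin n → ℤ)} {g : (Fin n → ℤ) → F}
    (hg : ∀ k ∈ S, ‖g k‖ * wt k ^ (s + n) ≤ Q) :
    ∑ k ∈ S, wt k ^ (2 * s) * ‖g k‖ ^ 2 ≤ Q ^ 2 * latSum n := by
  calc ∑ k ∈ S, wt k ^ (2 * s) * ‖g k‖ ^ 2 ≤ ∑ k ∈ S, Q ^ 2 * (wt k ^ (2 * n))⁻¹ := by
        refine Finset.sum_le_sum fun k hk => le_mul_inv_wt_pow ?_
        have h0 : 0 ≤ ‖g k‖ * wt k ^ (s + n) := mul_nonneg (norm_nonneg _) (wt_pow_pos _ _).le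
        calc _ = (‖g k‖ * wt k ^ (s + n)) ^ 2 := by ring
          _ ≤ Q ^ 2 := pow_le_pow_left₀ h0 (hg k hk) 2
    _ = Q ^ 2 * ∑ k ∈ S, (wt k ^ (2 * n))⁻¹ := by rw [Finset.mul_sum]
    _ ≤ _ := mul_le_mul_of_nonneg_left (sum_inv_wt_pow_le S) (sq_nonneg _)

/-- Sup-norm form of the energy estimate. -/
lemma IsGarding.energy_sup (hT : 0 ≤ T) (hM : IsGarding T r M) (s : ℕ) :
    ∃ D, 0 ≤ D ∧ ∀ (S : Finset (Fin n → ℤ)) (w g : (Fin n → ℤ) → ℝ → E) (Q : ℝ), 0 ≤ Q →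
      (∀ k ∈ S, ∀ t ∈ Icc 0 T,
        HasDerivWithinAt (w k) (∑ m ∈ S, M t k m (w m t) + g k t) (Icc 0 T) t) →
      (∀ k ∈ S, ‖w k 0‖ * wt k ^ (s + n) ≤ Q) →
      (∀ k ∈ S, ∀ t ∈ Icc 0 T, ‖g k t‖ * wt k ^ (s + n) ≤ Q) →
      ∀ k ∈ S, ∀ t ∈ Icc 0 T, ‖w k t‖ * wt k ^ s ≤ D * Q := by
  obtain ⟨C, hC, hG⟩ := hM.garding s
  have hL := latSum_nonneg n
  refine ⟨Real.sqrt ((1 + T) * latSum n * Real.exp ((2 * C + 1) * T)), Real.sqrt_nonneg _,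
    fun S w g Q hQ hw hw0 hg k hk t ht => ?_⟩
  have h1 := energy_estimate hC (G := Q ^ 2 * latSum n) (by positivity) (fun t ht v => hG t ht S v)
    hw (fun t ht => sum_wt_sq_le fun k hk => hg k hk t ht) ht
  have h2 : ∑ k ∈ S, wt k ^ (2 * s) * ‖w k 0‖ ^ 2 ≤ Q ^ 2 * latSum n := sum_wt_sq_le hw0
  have h3 : wt k ^ (2 * s) * ‖w k t‖ ^ 2 ≤ ∑ k ∈ S, wt k ^ (2 * s) * ‖w k t‖ ^ 2 :=
    Finset.single_le_sum (f := fun k => wt k ^ (2 * s) * ‖w k t‖ ^ 2)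
      (fun k _ => mul_nonneg (wt_pow_pos _ _).le (sq_nonneg _)) hk
  refine abs_le_of_sq_le_sq' ?_ (mul_nonneg (Real.sqrt_nonneg _) hQ) |>.2
  rw [mul_pow (Real.sqrt _), Real.sq_sqrt (by positivity)]
  have h4 := Real.exp_pos ((2 * C + 1) * T)
  calc (‖w k t‖ * wt k ^ s) ^ 2 = wt k ^ (2 * s) * ‖w k t‖ ^ 2 := by ring
    _ ≤ _ := h3.trans h1
    _ ≤ (Q ^ 2 * latSum n + T * (Q ^ 2 * latSum n)) * Real.exp ((2 * C + 1) * T) := by gcongr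
    _ = _ := by ring

/-- Galerkin approximation. -/
lemma IsGarding.exists_galerkin [CompleteSpace E] (hT : 0 ≤ T) (hM : IsGarding T r M)
    {f : (Fin n → ℤ) → ℝ → E} (hf : ∀ k, ContinuousOn (f k) (Icc 0 T)) (u₀ : (Fin n → ℤ) → E)
    (S : Finset (Fin n → ℤ)) :
    ∃ u : (Fin n → ℤ) → ℝ → E, (∀ k ∉ S, ∀ t, u k t = 0) ∧ (∀ k ∈ S, u k 0 = u₀ k) ∧
      ∀ k ∈ S, ∀ t ∈ Icc 0 T,
        HasDerivWithinAt (u k) (∑ m ∈ S, M t k m (u m t) + f k t) (Icc 0 T) t := by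
  classical
  set A : ℝ → (S → E) →L[ℝ] (S → E) := fun t => ∑ k : S, ∑ m : S,
    (ContinuousLinearMap.single ℝ (fun _ : S => E) k) ∘L
      (((M t k m).restrictScalars ℝ) ∘L (ContinuousLinearMap.proj m)) with hA
  have hAc : ContinuousOn A (Icc 0 T) := by
    refine continuousOn_finsetSum _ fun k _ => continuousOn_finsetSum _ fun m _ => ?_
    refine ContinuousOn.clm_comp continuousOn_const (ContinuousOn.clm_comp ?_ continuousOn_const)
    exact (ContinuousLinearMap.continuous_restrictScalars ℝ).comp_continuousOn (hM.cont k m)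
  have hAa : ∀ t (x : S → E) (k : S), A t x k = ∑ m : S, M t k m (x m) := by
    intro t x k
    rw [hA]
    simp only [sum_apply, ContinuousLinearMap.comp_apply, Finset.sum_apply]
    rw [Finset.sum_eq_single k]
    · simp
    · intro b _ hb
      simp [hb.symm]
    · simp
  obtain ⟨x, hx0, hx⟩ := exists_linear_ode hT hAc (g := fun t (k : S) => f k t)
    (continuousOn_pi.mpr fun k => hf k) (fun k : S => u₀ k)
  refine ⟨fun k t => if h : k ∈ S then x t ⟨k, h⟩ else 0, fun k hk t => by simp [hk],
    fun k hk => by simp [hk, hx0], fun k hk t ht => ?_⟩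
  have h := (hasDerivWithinAt_pi.mp (hx t ht)) ⟨k, hk⟩
  rw [Pi.add_apply, hAa] at h
  simp only [hk, dite_true]
  refine h.congr_deriv ?_
  congr 1
  rw [← Finset.sum_coe_sort S]
  refine Finset.sum_congr rfl fun m _ => ?_
  simp [m.2]

/-- Uniform bounds and Cauchy property of the Galerkin approximations. -/
lemma IsGarding.galerkin_estimates [CompleteSpace E] (hT : 0 ≤ T) (hM : IsGarding T r M)
    {f : (Fin n → ℤ) → ℝ → E} (hf : RapidDecay T f) {u₀ : (Fin n → ℤ) → E}
    (hu₀ : ∀ j : ℕ, ∃ K, 0 ≤ K ∧ ∀ k, ‖u₀ k‖ * wt k ^ j ≤ K) {u : ℕ → (Fin n → ℤ) → ℝ → E}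
    (hoff : ∀ N, ∀ k ∉ box n N, ∀ t, u N k t = 0) (hini : ∀ N, ∀ k ∈ box n N, u N k 0 = u₀ k)
    (hode : ∀ N, ∀ k ∈ box n N, ∀ t ∈ Icc 0 T,
        HasDerivWithinAt (u N k) (∑ m ∈ box n N, M t k m (u N m t) + f k t) (Icc 0 T) t) (s : ℕ) :
    ∃ D, 0 ≤ D ∧ (∀ N k, ∀ t ∈ Icc 0 T, ‖u N k t‖ * wt k ^ s ≤ D) ∧
      ∀ N N', N ≤ N' → ∀ k, ∀ t ∈ Icc 0 T, ‖u N' k t - u N k t‖ * wt k ^ s ≤ D / (N + 1) := by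
  classical
  have hbd : ∀ s : ℕ, ∃ D, 0 ≤ D ∧ ∀ N k, ∀ t ∈ Icc 0 T, ‖u N k t‖ * wt k ^ s ≤ D := by
    intro s
    obtain ⟨D, hD, h⟩ := hM.energy_sup hT s
    obtain ⟨K₁, hK₁, h₁⟩ := hf (s + n)
    obtain ⟨K₂, hK₂, h₂⟩ := hu₀ (s + n)
    refine ⟨D * (K₁ + K₂), by positivity, fun N k t ht => ?_⟩
    by_cases hk : k ∈ box n N
    · refine h (box n N) (u N) f (K₁ + K₂) (by positivity) (hode N) (fun k hk => ?_)
        (fun k _ t ht => ?_) k hk t ht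
      · rw [hini N k hk]; linarith [h₂ k]
      · linarith [h₁ k t ht]
    · rw [hoff N k hk]
      simp only [norm_zero, zero_mul]
      positivity
  obtain ⟨D₀, hD₀, h₀⟩ := hbd s
  obtain ⟨D, hD, h⟩ := hM.energy_sup hT s
  obtain ⟨K₁, hK₁, h₁⟩ := hf (s + n + 1)
  obtain ⟨K₂, hK₂, h₂⟩ := hu₀ (s + n + 1)
  obtain ⟨K₃, hK₃, h₃⟩ := hM.bound.sum_bound (s + n + 1)
  obtain ⟨D₁, hD₁, h₄⟩ := hbd (r + (s + n + 1) + 2 * n)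
  refine ⟨D₀ + D * (K₁ + K₂ + K₃ * D₁), by positivity,
    fun N k t ht => (h₀ N k t ht).trans (by
      have : 0 ≤ D * (K₁ + K₂ + K₃ * D₁) := by positivity
      linarith), fun N N' hN k t ht => ?_⟩
  have hN1 : (0 : ℝ) < N + 1 := by positivity
  have hNN := box_mono (n := n) hN
  have hgain : ∀ (x : E) (Q : ℝ) (k : Fin n → ℤ), k ∉ box n N → ‖x‖ * wt k ^ (s + n + 1) ≤ Q →
      ‖x‖ * wt k ^ (s + n) ≤ Q / (N + 1) := by
    intro x Q k hk hx
    rw [le_div_iff₀ hN1]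
    refine le_trans ?_ hx
    rw [pow_succ, ← mul_assoc]
    exact mul_le_mul_of_nonneg_left (lt_wt_of_notMem_box hk)
      (mul_nonneg (norm_nonneg _) (wt_pow_pos _ _).le)
  have hQ0 : 0 ≤ (K₁ + K₂ + K₃ * D₁) / (N + 1) := by positivity
  by_cases hk : k ∈ box n N'
  · refine (h (box n N') (fun k t => u N' k t - u N k t)
      (fun k t => if k ∈ box n N then 0 else f k t + ∑ m ∈ box n N', M t k m (u N m t))
      ((K₁ + K₂ + K₃ * D₁) / (N + 1)) hQ0 ?_ ?_ ?_ k hk t ht).trans ?_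
    · intro k hk t ht
      have hd : HasDerivWithinAt (u N k)
          (if k ∈ box n N then ∑ m ∈ box n N', M t k m (u N m t) + f k t else 0) (Icc 0 T) t := by
        split_ifs with hkN
        · refine (hode N k hkN t ht).congr_deriv ?_
          congr 1
          refine Finset.sum_subset hNN fun m _ hm => ?_
          rw [hoff N m hm, map_zero]
        · have : u N k = fun _ => 0 := funext fun t => hoff N k hkN t
          rw [this]
          exact hasDerivWithinAt_const _ _ _
      refine ((hode N' k hk t ht).sub hd).congr_deriv ?_
      simp only [map_sub, Finset.sum_sub_distrib]
      split_ifs <;> abel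
    · intro k hk
      by_cases hkN : k ∈ box n N
      · simp only [hini N k hkN, hini N' k hk, sub_self, norm_zero, zero_mul]
        exact hQ0
      · simp only [hini N' k hk, hoff N k hkN, sub_zero]
        refine hgain _ _ k hkN ((h₂ k).trans ?_)
        have : 0 ≤ K₃ * D₁ := by positivity
        linarith
    · intro k hk t ht
      by_cases hkN : k ∈ box n N
      · simp only [hkN, if_true, norm_zero, zero_mul]
        exact hQ0
      · simp only [hkN, if_false]
        refine hgain _ _ k hkN ?_
        have a1 := h₁ k t ht
        have a2 := (h₃ t ht k (fun m => u N m t) D₁ hD₁ fun m => h₄ N m t ht).2.1 (box n N')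
        have a3 := mul_le_mul_of_nonneg_right
          (norm_add_le (f k t) (∑ m ∈ box n N', M t k m (u N m t)))
          (wt_pow_pos k (s + n + 1)).le
        linarith
    · rw [← mul_div_assoc]
      gcongr
      linarith
  · have hk' : k ∉ box n N := fun h => hk (hNN h)
    simp only [hoff N' k hk, hoff N k hk', sub_zero, norm_zero, zero_mul]
    positivity

/-- Solvability of the Fourier system. -/
theorem IsGarding.exists_solution [CompleteSpace E] (hT : 0 ≤ T) (hM : IsGarding T r M)
    {f : (Fin n → ℤ) → ℝ → E} (hfc : ∀ k, ContinuousOn (f k) (Icc 0 T)) (hf : RapidDecay T f)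
    {u₀ : (Fin n → ℤ) → E} (hu₀ : ∀ j : ℕ, ∃ K, 0 ≤ K ∧ ∀ k, ‖u₀ k‖ * wt k ^ j ≤ K) :
    ∃ u : (Fin n → ℤ) → ℝ → E, RapidDecay T u ∧ (∀ k, u k 0 = u₀ k) ∧
      ∀ k, ∀ t ∈ Icc 0 T,
        HasDerivWithinAt (u k) (∑' m, M t k m (u m t) + f k t) (Icc 0 T) t := by
  choose v hoff hini hode using fun N => hM.exists_galerkin hT hfc u₀ (box n N)
  have hest := hM.galerkin_estimates hT hf hu₀ hoff hini hode
  have hlim0 : Tendsto (fun N : ℕ => (1 : ℝ) / (N + 1)) atTop (𝓝 0) :=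
    tendsto_one_div_add_atTop_nhds_zero_nat
  have hcau : ∀ k, ∀ t ∈ Icc 0 T, CauchySeq fun N => v N k t := by
    intro k t ht
    obtain ⟨D, hD, -, h⟩ := hest 0
    refine cauchySeq_of_le_tendsto_0' (fun N : ℕ => D / ((N : ℝ) + 1)) (fun N N' hN => ?_) ?_
    · rw [dist_eq_norm, norm_sub_rev]
      simpa using h N N' hN k t ht
    · simpa [div_eq_mul_inv] using hlim0.const_mul D
  set u : (Fin n → ℤ) → ℝ → E := fun k t => limUnder atTop fun N => v N k t with hu
  have htend : ∀ k, ∀ t ∈ Icc 0 T, Tendsto (fun N => v N k t) atTop (𝓝 (u k t)) :=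
    fun k t ht => (hcau k t ht).tendsto_limUnder
  have hdecay : RapidDecay T u := by
    intro s
    obtain ⟨D, hD, h, -⟩ := hest s
    exact ⟨D, hD, fun k t ht => le_of_tendsto ((htend k t ht).norm.mul_const _)
      (Eventually.of_forall fun N => h N k t ht)⟩
  have hrate : ∀ s : ℕ, ∃ D, 0 ≤ D ∧ ∀ N k, ∀ t ∈ Icc 0 T,
      ‖u k t - v N k t‖ * wt k ^ s ≤ D / (N + 1) := by
    intro s
    obtain ⟨D, hD, -, h⟩ := hest s
    refine ⟨D, hD, fun N k t ht => ?_⟩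
    refine le_of_tendsto (((htend k t ht).sub_const (v N k t)).norm.mul_const _) ?_
    filter_upwards [eventually_ge_atTop N] with N' hN'
    exact h N N' hN' k t ht
  have hkbox : ∀ k : Fin n → ℤ, ∀ᶠ N in atTop, k ∈ box n N := by
    intro k
    obtain ⟨N, hN⟩ := exists_nat_ge ‖k‖
    filter_upwards [eventually_ge_atTop N] with N' hN'
    rw [mem_box]
    exact hN.trans (by exact_mod_cast hN')
  refine ⟨u, hdecay, fun k => ?_, fun k t ht => ?_⟩
  · refine tendsto_nhds_unique (htend k 0 ⟨le_rfl, hT⟩) ?_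
    refine tendsto_const_nhds.congr' ?_
    filter_upwards [hkbox k] with N hN
    exact (hini N k hN).symm
  · refine hasDerivWithinAt_of_tendstoUniformlyOn (l := atTop) (convex_Icc 0 T)
      (f := fun N => v N k) (f' := fun N t => ∑ m ∈ box n N, M t k m (v N m t) + f k t)
      (g' := fun t => ∑' m, M t k m (u m t) + f k t) ?_ (htend k) ?_ ht
    · filter_upwards [hkbox k] with N hN
      exact hode N k hN
    · obtain ⟨D, hD, h⟩ := hrate (r + 0 + 2 * n)
      obtain ⟨K, hK, hsum⟩ := hM.bound.sum_bound 0
      obtain ⟨D₂, hD₂, h₂⟩ := hdecay (r + 0 + 2 * n)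
      obtain ⟨D₃, hD₃, h₃, -⟩ := hest (r + 0 + 2 * n)
      rw [Metric.tendstoUniformlyOn_iff]
      intro ε hε
      have hl : Tendsto (fun N : ℕ => K * D * ((1 : ℝ) / (N + 1))) atTop (𝓝 0) := by
        simpa using hlim0.const_mul (K * D)
      filter_upwards [hl.eventually (gt_mem_nhds hε)] with N hN t ht
      refine lt_of_le_of_lt ?_ hN
      rw [dist_add_right, dist_eq_norm]
      have e1 : ∑ m ∈ box n N, M t k m (v N m t) = ∑' m, M t k m (v N m t) :=
        (tsum_eq_sum fun m hm => by rw [hoff N m hm, map_zero]).symm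
      have s1 := (hsum t ht k (fun m => u m t) D₂ hD₂ fun m => h₂ m t ht).1
      have s2 := (hsum t ht k (fun m => v N m t) D₃ hD₃ fun m => h₃ N m t ht).1
      have s3 := (hsum t ht k (fun m => u m t - v N m t) (D / (N + 1)) (by positivity)
        fun m => h N m t ht).2.2
      rw [e1, ← s1.tsum_sub s2]
      simp only [map_sub, pow_zero, mul_one] at s3
      refine s3.trans (le_of_eq ?_)
      ring

/-- Uniqueness for the Fourier system. -/
theorem IsGarding.eq_zero_of_homogeneous [CompleteSpace E] (hT : 0 ≤ T) (hM : IsGarding T r M)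
    {u : (Fin n → ℤ) → ℝ → E} (hu : RapidDecay T u) (hu₀ : ∀ k, u k 0 = 0)
    (hode : ∀ k, ∀ t ∈ Icc 0 T,
        HasDerivWithinAt (u k) (∑' m, M t k m (u m t)) (Icc 0 T) t) :
    ∀ k, ∀ t ∈ Icc 0 T, u k t = 0 := by
  classical
  intro k t ht
  obtain ⟨D, hD, h⟩ := hM.energy_sup hT 0
  obtain ⟨K, hK, hsum⟩ := hM.bound.sum_bound (0 + n)
  obtain ⟨D₂, hD₂, h₂⟩ := hu (r + (0 + n) + 2 * n)
  obtain ⟨D₃, hD₃, h₃⟩ := hu (r + (0 + n) + 2 * n + 1)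
  have key : ∀ N : ℕ, k ∈ box n N → ‖u k t‖ ≤ D * (K * D₃) * (1 / ((N : ℝ) + 1)) := by
    intro N hk
    have hN1 : (0 : ℝ) < N + 1 := by positivity
    have hQ0 : 0 ≤ D₃ / ((N : ℝ) + 1) := by positivity
    have htr : ∀ t ∈ Icc 0 T, ∀ m,
        ‖(if m ∈ box n N then 0 else u m t)‖ * wt m ^ (r + (0 + n) + 2 * n) ≤ D₃ / (N + 1) := by
      intro t ht m
      split_ifs with hm
      · simpa using hQ0
      · rw [le_div_iff₀ hN1]
        refine le_trans ?_ (h₃ m t ht)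
        rw [pow_succ, ← mul_assoc]
        exact mul_le_mul_of_nonneg_left (lt_wt_of_notMem_box hm)
          (mul_nonneg (norm_nonneg _) (wt_pow_pos _ _).le)
    have := h (box n N) u (fun k t => ∑' m, M t k m (if m ∈ box n N then 0 else u m t))
      (K * (D₃ / (N + 1))) (by positivity) ?_ ?_ ?_ k hk t ht
    · simp only [pow_zero, mul_one] at this
      refine this.trans (le_of_eq ?_)
      ring
    · intro k _ t ht
      refine (hode k t ht).congr_deriv ?_
      have s1 := (hsum t ht k (fun m => u m t) D₂ hD₂ fun m => h₂ m t ht).1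
      have s2 := (hsum t ht k _ _ hQ0 (htr t ht)).1
      have e : ∑ m ∈ box n N, M t k m (u m t) =
          ∑' m, M t k m (if m ∈ box n N then u m t else 0) := by
        rw [tsum_eq_sum (s := box n N) fun m hm => by rw [if_neg hm, map_zero]]
        exact Finset.sum_congr rfl fun m hm => by rw [if_pos hm]
      have s3 : Summable fun m => M t k m (if m ∈ box n N then u m t else 0) :=
        summable_of_ne_finset_zero (s := box n N) fun m hm => by rw [if_neg hm, map_zero]
      rw [e, ← s3.tsum_add s2]
      refine tsum_congr fun m => ?_
      split_ifs <;> simp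
    · intro k _
      rw [hu₀ k]
      simp only [norm_zero, zero_mul]
      positivity
    · intro k _ t ht
      exact (hsum t ht k _ _ hQ0 (htr t ht)).2.2
  have hlim : Tendsto (fun N : ℕ => D * (K * D₃) * ((1 : ℝ) / (N + 1))) atTop (𝓝 0) := by
    simpa using (tendsto_one_div_add_atTop_nhds_zero_nat (𝕜 := ℝ)).const_mul (D * (K * D₃))
  obtain ⟨N, hN⟩ := exists_nat_ge ‖k‖
  have : ‖u k t‖ ≤ 0 := by
    refine ge_of_tendsto hlim ?_
    filter_upwards [eventually_ge_atTop N] with N' hN'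
    refine key N' ?_
    rw [mem_box]
    exact hN.trans (by exact_mod_cast hN')
  exact norm_le_zero_iff.mp this

end Galerkin

section TimeRegularity

open Set Filter Topology

variable {n : ℕ} {T : ℝ}

/-- Rapid decay of a family and of its first `p` time derivatives on `[0, T]`. -/
def TimeReg {F : Type*} [NormedAddCommGroup F] [NormedSpace ℝ F] (T : ℝ) :
    ℕ → ((Fin n → ℤ) → ℝ → F) → Prop
  | 0, g => RapidDecay T g ∧ ∀ k, ContinuousOn (g k) (Icc 0 T)
  | p + 1, g => RapidDecay T g ∧ ∃ g' : (Fin n → ℤ) → ℝ → F,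
      (∀ k, ∀ t ∈ Icc 0 T, HasDerivWithinAt (g k) (g' k t) (Icc 0 T) t) ∧ TimeReg T p g'

section General

variable {F : Type*} [NormedAddCommGroup F] [NormedSpace ℝ F]

lemma RapidDecay.add {F : Type*} [NormedAddCommGroup F] {g h : (Fin n → ℤ) → ℝ → F}
    (hg : RapidDecay T g) (hh : RapidDecay T h) :
    RapidDecay T fun k t => g k t + h k t := by
  intro j
  obtain ⟨K, hK, h1⟩ := hg j
  obtain ⟨L, hL, h2⟩ := hh j
  refine ⟨K + L, add_nonneg hK hL, fun k t ht => ?_⟩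
  calc ‖g k t + h k t‖ * wt k ^ j ≤ (‖g k t‖ + ‖h k t‖) * wt k ^ j :=
        mul_le_mul_of_nonneg_right (norm_add_le _ _) (wt_pow_pos _ _).le
    _ ≤ K + L := by rw [add_mul]; exact add_le_add (h1 k t ht) (h2 k t ht)

lemma RapidDecay.clm {F' : Type*} [NormedAddCommGroup F'] [NormedSpace ℝ F']
    {g : (Fin n → ℤ) → ℝ → F} (hg : RapidDecay T g) (L : (Fin n → ℤ) → F →L[ℝ] F') {q : ℕ} {C : ℝ}
    (hC : 0 ≤ C) (hL : ∀ k, ‖L k‖ ≤ C * wt k ^ q) : RapidDecay T fun k t => L k (g k t) := by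
  intro j
  obtain ⟨K, hK, h1⟩ := hg (q + j)
  refine ⟨C * K, mul_nonneg hC hK, fun k t ht => ?_⟩
  have hj := wt_pow_pos k j
  calc ‖L k (g k t)‖ * wt k ^ j ≤ (C * wt k ^ q * ‖g k t‖) * wt k ^ j := by
        gcongr; exact (L k).le_of_opNorm_le (hL k) _
    _ = C * (‖g k t‖ * wt k ^ (q + j)) := by rw [pow_add]; ring
    _ ≤ C * K := by gcongr; exact h1 k t ht

lemma TimeReg.rapidDecay {p : ℕ} {g : (Fin n → ℤ) → ℝ → F} (hg : TimeReg T p g) :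
    RapidDecay T g := by
  cases p <;> exact hg.1

lemma TimeReg.continuousOn {p : ℕ} {g : (Fin n → ℤ) → ℝ → F} (hg : TimeReg T p g) (k) :
    ContinuousOn (g k) (Icc 0 T) := by
  cases p with
  | zero => exact hg.2 k
  | succ p =>
    obtain ⟨_, g', h, _⟩ := hg
    exact fun t ht => (h k t ht).continuousWithinAt

lemma TimeReg.pred {p : ℕ} {g : (Fin n → ℤ) → ℝ → F} (hg : TimeReg T (p + 1) g) :
    TimeReg T p g := by
  induction p generalizing g with
  | zero => exact ⟨hg.rapidDecay, hg.continuousOn⟩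
  | succ p ih =>
    obtain ⟨h0, g', h, hg'⟩ := hg
    exact ⟨h0, g', h, ih hg'⟩

lemma TimeReg.add {p : ℕ} {g h : (Fin n → ℤ) → ℝ → F} (hg : TimeReg T p g) (hh : TimeReg T p h) :
    TimeReg T p fun k t => g k t + h k t := by
  induction p generalizing g h with
  | zero => exact ⟨hg.1.add hh.1, fun k => (hg.2 k).add (hh.2 k)⟩
  | succ p ih =>
    obtain ⟨h0, g', h1, hg'⟩ := hg
    obtain ⟨k0, h', k1, hh'⟩ := hh
    exact ⟨h0.add k0, _, fun k t ht => (h1 k t ht).add (k1 k t ht), ih hg' hh'⟩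

lemma TimeReg.clm {F' : Type*} [NormedAddCommGroup F'] [NormedSpace ℝ F'] {p : ℕ}
    {g : (Fin n → ℤ) → ℝ → F} (hg : TimeReg T p g) (L : (Fin n → ℤ) → F →L[ℝ] F') {q : ℕ} {C : ℝ}
    (hC : 0 ≤ C) (hL : ∀ k, ‖L k‖ ≤ C * wt k ^ q) : TimeReg T p fun k t => L k (g k t) := by
  induction p generalizing g with
  | zero => exact ⟨hg.1.clm L hC hL, fun k => (L k).continuous.comp_continuousOn (hg.2 k)⟩
  | succ p ih =>
    obtain ⟨h0, g', h1, hg'⟩ := hg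
    exact ⟨h0.clm L hC hL, _, fun k t ht => (L k).hasFDerivAt.comp_hasDerivWithinAt t (h1 k t ht),
      ih hg'⟩

end General

section Matrices

variable {E : Type*} [NormedAddCommGroup E] [InnerProductSpace ℂ E] {r : ℕ}

/-- Off-diagonal decay of a family of matrices and of its first `p` time derivatives. -/
def MatReg (T : ℝ) (r : ℕ) : ℕ → (ℝ → (Fin n → ℤ) → (Fin n → ℤ) → E →L[ℂ] E) → Prop
  | 0, M => OffDiagDecay T r M ∧ ∀ k m, ContinuousOn (fun t => M t k m) (Icc 0 T)
  | p + 1, M => OffDiagDecay T r M ∧ ∃ M' : ℝ → (Fin n → ℤ) → (Fin n → ℤ) → E →L[ℂ] E,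
      (∀ k m, ∀ t ∈ Icc 0 T, HasDerivWithinAt (fun t => M t k m) (M' t k m) (Icc 0 T) t) ∧
      MatReg T r p M'

variable {M N : ℝ → (Fin n → ℤ) → (Fin n → ℤ) → E →L[ℂ] E}

lemma MatReg.offDiagDecay {p : ℕ} (hM : MatReg T r p M) : OffDiagDecay T r M := by
  cases p <;> exact hM.1

lemma MatReg.continuousOn {p : ℕ} (hM : MatReg T r p M) (k m) :
    ContinuousOn (fun t => M t k m) (Icc 0 T) := by
  cases p with
  | zero => exact hM.2 k m
  | succ p =>
    obtain ⟨_, M', h, _⟩ := hM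
    exact fun t ht => (h k m t ht).continuousWithinAt

lemma MatReg.pred {p : ℕ} (hM : MatReg T r (p + 1) M) : MatReg T r p M := by
  induction p generalizing M with
  | zero => exact ⟨hM.offDiagDecay, hM.continuousOn⟩
  | succ p ih =>
    obtain ⟨h0, M', h, hM'⟩ := hM
    exact ⟨h0, M', h, ih hM'⟩

lemma OffDiagDecay.add (hM : OffDiagDecay T r M) (hN : OffDiagDecay T r N) :
    OffDiagDecay T r fun t k m => M t k m + N t k m := by
  intro j
  obtain ⟨K, hK, h1⟩ := hM j
  obtain ⟨L, hL, h2⟩ := hN j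
  refine ⟨K + L, add_nonneg hK hL, fun t ht k m => ?_⟩
  calc ‖M t k m + N t k m‖ * wt (k - m) ^ j ≤ (‖M t k m‖ + ‖N t k m‖) * wt (k - m) ^ j :=
        mul_le_mul_of_nonneg_right (norm_add_le _ _) (wt_pow_pos _ _).le
    _ ≤ (K + L) * wt m ^ r := by
        rw [add_mul, add_mul]; exact add_le_add (h1 t ht k m) (h2 t ht k m)

lemma MatReg.add {p : ℕ} (hM : MatReg T r p M) (hN : MatReg T r p N) :
    MatReg T r p fun t k m => M t k m + N t k m := by
  induction p generalizing M N with
  | zero => exact ⟨hM.1.add hN.1, fun k m => (hM.2 k m).add (hN.2 k m)⟩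
  | succ p ih =>
    obtain ⟨h0, M', h1, hM'⟩ := hM
    obtain ⟨k0, N', k1, hN'⟩ := hN
    exact ⟨h0.add k0, _, fun k m t ht => (h1 k m t ht).add (k1 k m t ht), ih hM' hN'⟩

lemma matReg_zero (p : ℕ) :
    MatReg (n := n) T r p fun _ _ _ => (0 : E →L[ℂ] E) := by
  have h0 : OffDiagDecay (n := n) T r fun _ _ _ => (0 : E →L[ℂ] E) :=
    fun j => ⟨0, le_rfl, fun t ht k m => by simp⟩
  induction p with
  | zero => exact ⟨h0, fun k m => continuousOn_const⟩
  | succ p ih => exact ⟨h0, _, fun k m t ht => hasDerivWithinAt_const _ _ _, ih⟩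

lemma MatReg.sum {p : ℕ} {ι : Type*} (S : Finset ι)
    {M : ι → ℝ → (Fin n → ℤ) → (Fin n → ℤ) → E →L[ℂ] E} (hM : ∀ i ∈ S, MatReg T r p (M i)) :
    MatReg T r p fun t k m => ∑ i ∈ S, M i t k m := by
  classical
  induction S using Finset.induction_on with
  | empty => simpa using matReg_zero p
  | insert a S ha ih =>
    have := (hM a (Finset.mem_insert_self a S)).add
      (ih fun i hi => hM i (Finset.mem_insert_of_mem hi))
    simpa only [Finset.sum_insert ha] using this

/-- A convolution matrix with a polynomially bounded column multiplier. -/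
lemma TimeReg.matReg_smul {p : ℕ} {a : (Fin n → ℤ) → ℝ → E →L[ℂ] E} (ha : TimeReg T p a)
    {c : (Fin n → ℤ) → ℂ} {C : ℝ} (hC : 0 ≤ C) (hc : ∀ m, ‖c m‖ ≤ C * wt m ^ r) :
    MatReg T r p fun t k m => c m • a (k - m) t := by
  have h0 : ∀ b : (Fin n → ℤ) → ℝ → E →L[ℂ] E, RapidDecay T b →
      OffDiagDecay T r fun t k m => c m • b (k - m) t := by
    intro b hb j
    obtain ⟨K, hK, h⟩ := hb j
    refine ⟨C * K, mul_nonneg hC hK, fun t ht k m => ?_⟩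
    have h1 := h (k - m) t ht
    have h2 := wt_pow_pos m r
    rw [norm_smul]
    calc ‖c m‖ * ‖b (k - m) t‖ * wt (k - m) ^ j
        = ‖c m‖ * (‖b (k - m) t‖ * wt (k - m) ^ j) := by ring
      _ ≤ (C * wt m ^ r) * K := by
        refine mul_le_mul (hc m) h1 ?_ (by positivity)
        exact mul_nonneg (norm_nonneg _) (wt_pow_pos _ _).le
      _ = _ := by ring
  induction p generalizing a with
  | zero => exact ⟨h0 a ha.1, fun k m => (ha.2 (k - m)).const_smul (c m)⟩
  | succ p ih =>
    obtain ⟨k0, a', h1, ha'⟩ := ha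
    exact ⟨h0 a k0, _, fun k m t ht => (h1 (k - m) t ht).const_smul (c m), ih ha'⟩

lemma OffDiagDecay.summable_bound (hM : OffDiagDecay T r M) {u : (Fin n → ℤ) → ℝ → E}
    (hu : RapidDecay T u) :
    ∃ K, ∀ k, ∀ t ∈ Icc 0 T, ∀ m, ‖M t k m (u m t)‖ ≤ K * (wt m ^ (2 * n))⁻¹ := by
  obtain ⟨K, hK, h⟩ := hM.apply_bound 0
  obtain ⟨Q, hQ, hq⟩ := hu (r + 0 + 2 * n)
  refine ⟨K * Q, fun k t ht m => ?_⟩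
  simpa using h t ht k m (u m t) Q (hq m t ht)

lemma OffDiagDecay.summable [CompleteSpace E] (hM : OffDiagDecay T r M)
    {u : (Fin n → ℤ) → ℝ → E} (hu : RapidDecay T u) (k : Fin n → ℤ) {t : ℝ} (ht : t ∈ Icc 0 T) :
    Summable fun m => M t k m (u m t) := by
  obtain ⟨K, h⟩ := hM.summable_bound hu
  exact Summable.of_norm_bounded ((summable_inv_wt_pow n).mul_left K) (h k t ht)

lemma OffDiagDecay.rapidDecay_tsum [CompleteSpace E] (hM : OffDiagDecay T r M)
    {u : (Fin n → ℤ) → ℝ → E} (hu : RapidDecay T u) :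
    RapidDecay T fun k t => ∑' m, M t k m (u m t) := by
  intro j
  obtain ⟨K, hK, h⟩ := hM.sum_bound j
  obtain ⟨Q, hQ, hq⟩ := hu (r + j + 2 * n)
  exact ⟨K * Q, mul_nonneg hK hQ, fun k t ht =>
    (h t ht k (fun m => u m t) Q hQ fun m => hq m t ht).2.2⟩

lemma MatReg.timeReg_tsum [CompleteSpace E] {p : ℕ} (hM : MatReg T r p M)
    {u : (Fin n → ℤ) → ℝ → E} (hu : TimeReg T p u) :
    TimeReg T p fun k t => ∑' m, M t k m (u m t) := by
  have h0 := hM.offDiagDecay.rapidDecay_tsum hu.rapidDecay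
  induction p generalizing M u with
  | zero =>
    refine ⟨h0, fun k => ?_⟩
    obtain ⟨K, h⟩ := hM.1.summable_bound hu.1
    exact continuousOn_tsum (fun m => (hM.2 k m).clm_apply (hu.2 m))
      ((summable_inv_wt_pow n).mul_left K) fun m t ht => h k t ht m
  | succ p ih =>
    have hMp := hM.pred
    have hup := hu.pred
    obtain ⟨hM0, M', hM1, hM'⟩ := hM
    obtain ⟨hu0, u', hu1, hu'⟩ := hu
    have hd := hM'.offDiagDecay
    have hr := hu'.rapidDecay
    obtain ⟨K, hK⟩ := hd.summable_bound hu0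
    obtain ⟨L, hL⟩ := hM0.summable_bound hr
    refine ⟨h0, _, fun k t ht => ?_,
      (ih hM' hup (hd.rapidDecay_tsum hu0)).add (ih hMp hu' (hM0.rapidDecay_tsum hr))⟩
    have := hasDerivWithinAt_tsum_of_bound (convex_Icc 0 T)
      (f := fun m t => M t k m (u m t)) (f' := fun m t => M' t k m (u m t) + M t k m (u' m t))
      (((summable_inv_wt_pow n).mul_left K).add ((summable_inv_wt_pow n).mul_left L))
      (fun m t ht => ?_) (fun t ht => hM0.summable hu0 k ht)
      (fun m t ht => (norm_add_le _ _).trans (add_le_add (hK k t ht m) (hL k t ht m))) ht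
    · rwa [(hd.summable hu0 k ht).tsum_add (hM0.summable hr k ht)] at this
    · exact ((ContinuousLinearMap.restrictScalarsL ℂ E E ℝ ℝ).hasFDerivAt.comp_hasDerivWithinAt t
        (hM1 k m t ht)).clm_apply (hu1 m t ht)

/-- Time regularity of solutions of the infinite linear system. -/
lemma MatReg.timeReg_of_ode [CompleteSpace E] (hM : ∀ p, MatReg T r p M)
    {u f : (Fin n → ℤ) → ℝ → E} (hf : ∀ p, TimeReg T p f) (hu : RapidDecay T u)
    (hode : ∀ k, ∀ t ∈ Icc 0 T,
      HasDerivWithinAt (u k) (∑' m, M t k m (u m t) + f k t) (Icc 0 T) t) (p : ℕ) :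
    TimeReg T p u := by
  induction p with
  | zero => exact ⟨hu, fun k t ht => (hode k t ht).continuousWithinAt⟩
  | succ p ih => exact ⟨hu, _, hode, ((hM p).timeReg_tsum ih).add (hf p)⟩

end Matrices

end TimeRegularity

section FourierCoefficients

open Set Filter Topology MeasureTheory UnitAddTorus
open scoped ComplexConjugate

variable {n : ℕ}

/-- The projection from Euclidean space onto the torus. -/
def torusMk (x : Vec n) : UnitAddTorus (Fin n) := fun i => (x i : UnitAddCircle)

/-- A section of `torusMk`, with values in the unit cube. -/
def torusRep (y : UnitAddTorus (Fin n)) : Vec n :=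
  WithLp.toLp 2 fun i => (AddCircle.equivIco (1 : ℝ) 0 (y i) : ℝ)

/-- The normalised Haar measure on the torus. -/
def torusMeasure (n : ℕ) : Measure (UnitAddTorus (Fin n)) :=
  Measure.pi fun _ => AddCircle.haarAddCircle

instance : IsProbabilityMeasure (torusMeasure n) := by unfold torusMeasure; infer_instance

instance : (torusMeasure n).IsAddLeftInvariant := by unfold torusMeasure; infer_instance

lemma torusMk_torusRep (y : UnitAddTorus (Fin n)) : torusMk (torusRep y) = y := by
  ext i
  exact AddCircle.coe_equivIco (a := (0 : ℝ))

lemma torusMk_add (x v : Vec n) : torusMk (x + v) = torusMk x + torusMk v := by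
  ext i
  simp [torusMk]

lemma isOpenQuotientMap_torusMk : IsOpenQuotientMap (torusMk (n := n)) :=
  (IsOpenQuotientMap.piMap fun _ : Fin n =>
    (QuotientAddGroup.isOpenQuotientMap_mk : IsOpenQuotientMap
      (QuotientAddGroup.mk : ℝ → UnitAddCircle))).comp
    (EuclideanSpace.equiv (Fin n) ℝ).toHomeomorph.isOpenQuotientMap

lemma PerZ.congr {β : Type*} {g : Vec n → β} (hg : PerZ g) {x x' : Vec n}
    (h : torusMk x = torusMk x') : g x = g x' := by
  have h1 : ∀ i, ∃ m : ℤ, x i + m = x' i := by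
    intro i
    have h2 : ((x i : ℝ) : UnitAddCircle) = (x' i : ℝ) := congrFun h i
    have h3 : ((x' i - x i : ℝ) : UnitAddCircle) = 0 := by rw [AddCircle.coe_sub, h2, sub_self]
    obtain ⟨m, hm⟩ := (AddCircle.coe_eq_zero_iff 1).1 h3
    exact ⟨m, by simp at hm; linarith⟩
  choose m hm using h1
  rw [← hg x m]
  congr 1
  ext i
  simpa using hm i

lemma PerZ.torusRep_torusMk {β : Type*} {g : Vec n → β} (hg : PerZ g) (x : Vec n) :
    g (torusRep (torusMk x)) = g x := PerZ.congr hg (torusMk_torusRep _)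

lemma continuous_comp_torusRep {β : Type*} [TopologicalSpace β] {g : Vec n → β} (hg : PerZ g)
    (hc : Continuous g) : Continuous fun y => g (torusRep y) := by
  rw [isOpenQuotientMap_torusMk.isQuotientMap.continuous_iff]
  exact hc.congr fun x => (PerZ.torusRep_torusMk hg x).symm

lemma mFourier_add_apply (k : Fin n → ℤ) (y z : UnitAddTorus (Fin n)) :
    mFourier k (y + z) = mFourier k y * mFourier k z := by
  simp only [mFourier, ContinuousMap.coe_mk, Pi.add_apply, ← Finset.prod_mul_distrib]
  refine Finset.prod_congr rfl fun i _ => ?_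
  simp [fourier_apply, smul_add, AddCircle.toCircle_add]

/-- The exponential monomial `x ↦ exp (2πi k·x)`. -/
def fexp (k : Fin n → ℤ) (x : Vec n) : ℂ := mFourier k (torusMk x)

lemma fexp_eq_exp (k : Fin n → ℤ) (x : Vec n) :
    fexp k x = Complex.exp (∑ i, 2 * Real.pi * Complex.I * k i * x i) := by
  simp only [fexp, mFourier, torusMk, ContinuousMap.coe_mk, Complex.exp_sum]
  refine Finset.prod_congr rfl fun i _ => ?_
  rw [fourier_coe_apply]
  simp

lemma norm_mFourier_apply (k : Fin n → ℤ) (y : UnitAddTorus (Fin n)) : ‖mFourier k y‖ = 1 := by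
  simp only [mFourier, fourier_apply, ContinuousMap.coe_mk, norm_prod, Circle.norm_coe,
    Finset.prod_const_one]

lemma norm_fexp (k : Fin n → ℤ) (x : Vec n) : ‖fexp k x‖ = 1 := norm_mFourier_apply _ _

lemma fexp_neg_apply_mul (k m : Fin n → ℤ) (x : Vec n) :
    fexp (-k) x * fexp m x = fexp (-(k - m)) x := by
  rw [neg_sub, sub_eq_add_neg, add_comm, fexp, fexp, ← mFourier_add]; rfl

lemma perZ_fexp (k : Fin n → ℤ) : PerZ (fexp k) := by
  intro x m
  have : torusMk (x + (EuclideanSpace.equiv (Fin n) ℝ).symm fun i => (m i : ℝ)) = torusMk x := by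
    ext i
    simp [torusMk]
  rw [fexp, this]; rfl

lemma contDiff_fexp (k : Fin n → ℤ) : ContDiff ℝ (⊤ : ℕ∞) (fexp k) := by
  have : fexp k = fun x => Complex.exp (∑ i, 2 * Real.pi * Complex.I * k i * x i) :=
    funext (fexp_eq_exp k)
  rw [this]
  refine ContDiff.cexp (ContDiff.sum fun i _ => contDiff_const.mul ?_)
  exact Complex.ofRealCLM.contDiff.comp (EuclideanSpace.proj i : Vec n →L[ℝ] ℝ).contDiff

lemma continuous_fexp (k : Fin n → ℤ) : Continuous (fexp k) := (contDiff_fexp k).continuous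

variable {F : Type*} [NormedAddCommGroup F] [NormedSpace ℂ F]

/-- Fourier coefficients of a periodic function on Euclidean space. -/
def fcoef (G : Vec n → F) (k : Fin n → ℤ) : F :=
  ∫ y, mFourier (-k) y • G (torusRep y) ∂torusMeasure n

lemma fcoef_eq (G : Vec n → F) (k : Fin n → ℤ) :
    fcoef G k = ∫ y, fexp (-k) (torusRep y) • G (torusRep y) ∂torusMeasure n := by
  simp only [fexp, torusMk_torusRep]; rfl

lemma fcoef_translate {G : Vec n → F} (hG : PerZ G) (v : Vec n) (k : Fin n → ℤ) :
    fcoef (fun x => G (x + v)) k = fexp k v • fcoef G k := by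
  have h : ∀ y, G (torusRep y + v) = G (torusRep (torusMk v + y)) := fun y =>
    PerZ.congr hG (by rw [torusMk_add, torusMk_torusRep, torusMk_torusRep, add_comm])
  have h2 : ∀ y : UnitAddTorus (Fin n),
      mFourier (-k) y = fexp k v * mFourier (-k) (torusMk v + y) := by
    intro y
    rw [mFourier_add_apply, ← mul_assoc]
    have : fexp k v * mFourier (-k) (torusMk v) = 1 := by
      have h3 := fexp_neg_apply_mul k k v
      rw [mul_comm, sub_self, neg_zero] at h3
      change fexp k v * fexp (-k) v = 1
      rw [h3, fexp, mFourier_zero]; rfl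
    rw [this, one_mul]
  unfold fcoef
  simp only [h]
  rw [← integral_smul, ← integral_add_left_eq_self (μ := torusMeasure n)
    (fun y => fexp k v • mFourier (-k) y • G (torusRep y)) (torusMk v)]
  refine integral_congr_ae (Eventually.of_forall fun y => ?_)
  simp only [h2 y, mul_smul]

lemma norm_fcoef_le {G : Vec n → F} {C : ℝ} (hC : ∀ x, ‖G x‖ ≤ C) (k : Fin n → ℤ) :
    ‖fcoef G k‖ ≤ C := by
  have := norm_integral_le_of_norm_le_const (μ := torusMeasure n)
    (f := fun y => mFourier (-k) y • G (torusRep y)) (C := C) (Eventually.of_forall fun y => by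
      rw [norm_smul, norm_mFourier_apply, one_mul]; exact hC _)
  simpa [fcoef] using this

lemma integrable_torusMeasure {F : Type*} [NormedAddCommGroup F] {g : UnitAddTorus (Fin n) → F}
    (hg : Continuous g) :
    Integrable g (torusMeasure n) :=
  hg.integrable_of_hasCompactSupport (HasCompactSupport.of_compactSpace g)

lemma integrable_fcoef {G : Vec n → F} (hG : PerZ G) (hc : Continuous G) (k : Fin n → ℤ) :
    Integrable (fun y => mFourier (-k) y • G (torusRep y)) (torusMeasure n) :=
  integrable_torusMeasure ((mFourier (-k)).continuous.smul (continuous_comp_torusRep hG hc))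

lemma fcoef_add {G H : Vec n → F} (hG : PerZ G) (hGc : Continuous G) (hH : PerZ H)
    (hHc : Continuous H) (k : Fin n → ℤ) :
    fcoef (fun x => G x + H x) k = fcoef G k + fcoef H k := by
  simp only [fcoef, smul_add]
  exact integral_add (integrable_fcoef hG hGc k) (integrable_fcoef hH hHc k)

lemma fcoef_sub {G H : Vec n → F} (hG : PerZ G) (hGc : Continuous G) (hH : PerZ H)
    (hHc : Continuous H) (k : Fin n → ℤ) :
    fcoef (fun x => G x - H x) k = fcoef G k - fcoef H k := by
  simp only [fcoef, smul_sub]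
  exact integral_sub (integrable_fcoef hG hGc k) (integrable_fcoef hH hHc k)

lemma fcoef_finset_sum {ι : Type*} (S : Finset ι) {G : ι → Vec n → F} (hG : ∀ i ∈ S, PerZ (G i))
    (hGc : ∀ i ∈ S, Continuous (G i)) (k : Fin n → ℤ) :
    fcoef (fun x => ∑ i ∈ S, G i x) k = ∑ i ∈ S, fcoef (G i) k := by
  simp only [fcoef, Finset.smul_sum]
  exact integral_finsetSum S fun i hi => integrable_fcoef (hG i hi) (hGc i hi) k

lemma fcoef_clm [CompleteSpace F] {F' : Type*} [NormedAddCommGroup F'] [NormedSpace ℂ F']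
    [CompleteSpace F'] (L : F →L[ℂ] F') {G : Vec n → F} (hG : PerZ G) (hGc : Continuous G)
    (k : Fin n → ℤ) : fcoef (fun x => L (G x)) k = L (fcoef G k) := by
  simp only [fcoef, ← L.integral_comp_comm (integrable_fcoef hG hGc k), map_smul]

lemma integral_mFourier (k : Fin n → ℤ) :
    ∫ y, mFourier k y ∂torusMeasure n = if k = 0 then 1 else 0 := by
  have h := orthonormal_iff_ite.mp (orthonormal_mFourier (d := Fin n)) 0 k
  simp only [ContinuousMap.inner_toLp, ← mFourier_neg, ← mFourier_add] at h
  rw [neg_zero, add_zero] at h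
  simp only [@eq_comm _ k 0]
  exact h

/-- A continuous periodic function is determined by its Fourier coefficients. -/
theorem eq_zero_of_fcoef_eq_zero [CompleteSpace F] {G : Vec n → F} (hG : PerZ G) (hGc : Continuous G)
    (h : ∀ k, fcoef G k = 0) (x : Vec n) : G x = 0 := by
  refine SeparatingDual.eq_zero_of_forall_dual_eq_zero (R := ℂ) fun φ => ?_
  let f : C(UnitAddTorus (Fin n), ℂ) :=
    ⟨fun y => φ (G (torusRep y)), φ.continuous.comp (continuous_comp_torusRep hG hGc)⟩
  have hf : mFourierCoeff f = fun _ => 0 := by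
    funext k
    have : mFourierCoeff f k = fcoef (fun x => φ (G x)) k := rfl
    rw [this, fcoef_clm φ hG hGc, h, map_zero]
  have h1 := hasSum_mFourier_series_apply_of_summable (f := f) (by rw [hf]; exact summable_zero)
    (torusMk x)
  rw [hf] at h1
  simp only [zero_smul] at h1
  have h2 : f (torusMk x) = φ (G x) := congrArg φ (PerZ.torusRep_torusMk hG x)
  rw [← h2]
  exact h1.unique hasSum_zero

/-- Fourier coefficients of the product of a matrix function with an absolutely convergent
Fourier series. -/
theorem fcoef_clm_tsum {E E' : Type*} [NormedAddCommGroup E] [NormedSpace ℂ E] [CompleteSpace E]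
    [NormedAddCommGroup E'] [NormedSpace ℂ E'] [CompleteSpace E']
    {A : Vec n → E →L[ℂ] E'} (hA : PerZ A) (hAc : Continuous A) {w : (Fin n → ℤ) → E}
    (hw : Summable fun m => ‖w m‖) (k : Fin n → ℤ) :
    fcoef (fun x => A x (∑' m, fexp m x • w m)) k = ∑' m, fcoef A (k - m) (w m) := by
  have hAr := continuous_comp_torusRep hA hAc
  obtain ⟨C, hC⟩ := isCompact_univ.exists_bound_of_continuousOn hAr.continuousOn
  have h1 : ∀ m, fcoef A (k - m) (w m) =
      ∫ y, fexp (-(k - m)) (torusRep y) • A (torusRep y) (w m) ∂torusMeasure n := by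
    intro m
    rw [fcoef, ContinuousLinearMap.integral_apply (integrable_fcoef hA hAc _)]
    simp only [fexp, torusMk_torusRep]; rfl
  have hcont : ∀ m, Continuous fun y => fexp (-(k - m)) (torusRep y) • A (torusRep y) (w m) :=
    fun m => (continuous_comp_torusRep (perZ_fexp _) (continuous_fexp _)).smul
      (hAr.clm_apply continuous_const)
  have hb : ∀ m y, ‖fexp (-(k - m)) (torusRep y) • A (torusRep y) (w m)‖ ≤ C * ‖w m‖ := by
    intro m y
    rw [norm_smul, norm_fexp, one_mul]
    exact (A (torusRep y)).le_of_opNorm_le (hC y (mem_univ y)) _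
  simp only [h1]
  rw [integral_tsum_of_summable_integral_norm (fun m => integrable_torusMeasure (hcont m))]
  · rw [fcoef_eq]
    refine integral_congr_ae (Eventually.of_forall fun y => ?_)
    have hs : Summable fun m => fexp m (torusRep y) • w m :=
      Summable.of_norm (by simpa [norm_smul, norm_fexp] using hw)
    simp only
    rw [(A (torusRep y)).map_tsum hs, ← tsum_const_smul'']
    refine tsum_congr fun m => ?_
    rw [map_smul, smul_smul, fexp_neg_apply_mul]
  · refine Summable.of_nonneg_of_le (fun m => integral_nonneg fun y => norm_nonneg _) (fun m => ?_)
      (hw.mul_left C)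
    refine (le_abs_self _).trans ?_
    have := norm_integral_le_of_norm_le_const (μ := torusMeasure n) (C := C * ‖w m‖)
      (f := fun y => ‖fexp (-(k - m)) (torusRep y) • A (torusRep y) (w m)‖)
      (Eventually.of_forall fun y => by rw [norm_norm]; exact hb m y)
    simpa using this

end FourierCoefficients

section SmoothPeriodic

open Set Filter Topology MeasureTheory UnitAddTorus
open scoped Pointwise

variable {n : ℕ} {T : ℝ}

/-- The space-time cylinder `ℝ^n × [0, T]`. -/
abbrev cyl (n : ℕ) (T : ℝ) : Set (Vec n × ℝ) := univ ×ˢ Icc 0 T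

lemma uniqueDiffOn_cyl (hT : 0 < T) : UniqueDiffOn ℝ (cyl n T) :=
  uniqueDiffOn_univ.prod (uniqueDiffOn_Icc hT)

lemma convex_cyl : Convex ℝ (cyl n T) := convex_univ.prod (convex_Icc 0 T)

/-- Smooth functions on the cylinder, periodic in space. -/
structure SmoothPer {F : Type*} [NormedAddCommGroup F] [NormedSpace ℝ F] (T : ℝ)
    (G : Vec n → ℝ → F) : Prop where
  smooth : ContDiffOn ℝ (⊤ : ℕ∞) (fun q : Vec n × ℝ => G q.1 q.2) (cyl n T)
  per : PerZ G

section Real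

variable {F : Type*} [NormedAddCommGroup F] [NormedSpace ℝ F] {G H : Vec n → ℝ → F}

/-- The derivative of a space-time function in a space-time direction. -/
def dirDeriv (T : ℝ) (v : Vec n × ℝ) (G : Vec n → ℝ → F) (x : Vec n) (t : ℝ) : F :=
  fderivWithin ℝ (fun q : Vec n × ℝ => G q.1 q.2) (cyl n T) (x, t) v

lemma SmoothPer.perZ_apply (hG : SmoothPer T G) (t : ℝ) : PerZ fun x => G x t :=
  fun x m => congrFun (hG.per x m) t

lemma SmoothPer.contDiff_apply (hG : SmoothPer T G) {t : ℝ} (ht : t ∈ Icc 0 T) :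
    ContDiff ℝ (⊤ : ℕ∞) fun x => G x t := by
  rw [← contDiffOn_univ]
  exact hG.smooth.comp (contDiff_id.prodMk contDiff_const).contDiffOn fun x _ => ⟨mem_univ _, ht⟩

lemma SmoothPer.continuous_apply (hG : SmoothPer T G) {t : ℝ} (ht : t ∈ Icc 0 T) :
    Continuous fun x => G x t := (hG.contDiff_apply ht).continuous

lemma SmoothPer.add (hG : SmoothPer T G) (hH : SmoothPer T H) :
    SmoothPer T fun x t => G x t + H x t :=
  ⟨hG.smooth.add hH.smooth, fun x m => by funext t; simp only [hG.per x m, hH.per x m]⟩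

lemma SmoothPer.sub (hG : SmoothPer T G) (hH : SmoothPer T H) :
    SmoothPer T fun x t => G x t - H x t :=
  ⟨hG.smooth.sub hH.smooth, fun x m => by funext t; simp only [hG.per x m, hH.per x m]⟩

lemma SmoothPer.finset_sum {ι : Type*} {S : Finset ι} {G : ι → Vec n → ℝ → F}
    (hG : ∀ i ∈ S, SmoothPer T (G i)) : SmoothPer T fun x t => ∑ i ∈ S, G i x t :=
  ⟨ContDiffOn.sum fun i hi => (hG i hi).smooth, fun x m => by
    funext t
    exact Finset.sum_congr rfl fun i hi => congrFun ((hG i hi).per x m) t⟩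

lemma SmoothPer.clm {F' : Type*} [NormedAddCommGroup F'] [NormedSpace ℝ F'] (L : F →L[ℝ] F')
    (hG : SmoothPer T G) : SmoothPer T fun x t => L (G x t) :=
  ⟨L.contDiff.comp_contDiffOn hG.smooth, fun x m => by funext t; simp only [hG.per x m]⟩

lemma SmoothPer.hasFDerivWithinAt (hG : SmoothPer T G) {x : Vec n} {t : ℝ} (ht : t ∈ Icc 0 T) :
    HasFDerivWithinAt (fun q : Vec n × ℝ => G q.1 q.2)
      (fderivWithin ℝ (fun q : Vec n × ℝ => G q.1 q.2) (cyl n T) (x, t)) (cyl n T) (x, t) :=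
  ((hG.smooth.differentiableOn (by simp)) (x, t) ⟨mem_univ _, ht⟩).hasFDerivWithinAt

lemma SmoothPer.dirDeriv (hT : 0 < T) (hG : SmoothPer T G) (v : Vec n × ℝ) :
    SmoothPer T (dirDeriv T v G) := by
  refine ⟨?_, fun x m => ?_⟩
  · have := ((contDiffOn_infty_iff_fderivWithin (uniqueDiffOn_cyl hT)).1 hG.smooth).2
    exact (ContinuousLinearMap.apply ℝ F v).contDiff.comp_contDiffOn this
  · funext t
    set z : Vec n := (EuclideanSpace.equiv (Fin n) ℝ).symm fun i => (m i : ℝ) with hz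
    have h1 : (fun q : Vec n × ℝ => G (q + (z, 0)).1 (q + (z, 0)).2) =
        fun q : Vec n × ℝ => G q.1 q.2 := by
      funext q
      have := congrFun (hG.per q.1 m) q.2
      simpa [← hz] using this
    have h2 : ((z, (0 : ℝ)) : Vec n × ℝ) +ᵥ cyl n T = cyl n T := by
      ext q
      rw [Set.mem_vadd_set_iff_neg_vadd_mem]
      simp [cyl, Set.mem_prod]
    have h3 := fderivWithin_comp_add_right (𝕜 := ℝ) (f := fun q : Vec n × ℝ => G q.1 q.2)
      (s := cyl n T) (x := (x, t)) (z, 0)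
    rw [h1, h2] at h3
    simp only [TorusParabolic.dirDeriv, h3, Prod.mk_add_mk, add_zero]

lemma SmoothPer.hasDerivWithinAt_time (hG : SmoothPer T G) (x : Vec n) {t : ℝ}
    (ht : t ∈ Icc 0 T) :
    HasDerivWithinAt (G x) (TorusParabolic.dirDeriv T (0, 1) G x t) (Icc 0 T) t := by
  have h := hG.hasFDerivWithinAt (x := x) ht
  have h2 : HasDerivWithinAt (fun s : ℝ => ((x, s) : Vec n × ℝ)) (0, 1) (Icc 0 T) t :=
    (hasDerivWithinAt_const t _ x).prodMk (hasDerivWithinAt_id t _)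
  exact h.comp_hasDerivWithinAt t h2 fun s hs => ⟨mem_univ _, hs⟩

lemma SmoothPer.hasFDerivAt_space (hG : SmoothPer T G) (x : Vec n) {t : ℝ} (ht : t ∈ Icc 0 T) :
    HasFDerivAt (fun x => G x t)
      ((fderivWithin ℝ (fun q : Vec n × ℝ => G q.1 q.2) (cyl n T) (x, t)).comp
        (ContinuousLinearMap.inl ℝ (Vec n) ℝ)) x := by
  have h := hG.hasFDerivWithinAt (x := x) ht
  have h2 : HasFDerivWithinAt (fun y : Vec n => ((y, t) : Vec n × ℝ))
      (ContinuousLinearMap.inl ℝ (Vec n) ℝ) univ x :=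
    (hasFDerivWithinAt_id x _).prodMk (hasFDerivWithinAt_const t x _)
  exact hasFDerivWithinAt_univ.1 (HasFDerivWithinAt.comp
    (g := fun q : Vec n × ℝ => G q.1 q.2) (t := cyl n T) x h h2
    fun _ _ => mk_mem_prod (mem_univ _) ht)

lemma SmoothPer.hasDerivAt_space (hG : SmoothPer T G) (x v : Vec n) {t : ℝ} (ht : t ∈ Icc 0 T)
    (τ : ℝ) :
    HasDerivAt (fun τ : ℝ => G (x + τ • v) t) (TorusParabolic.dirDeriv T (v, 0) G (x + τ • v) t)
      τ := by
  have h := hG.hasFDerivAt_space (x + τ • v) ht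
  have h2 : HasDerivAt (fun τ : ℝ => x + τ • v) ((1 : ℝ) • v) τ :=
    ((hasDerivAt_id τ).smul_const v).const_add x
  have := h.comp_hasDerivAt τ h2
  simpa [TorusParabolic.dirDeriv, Function.comp_def] using this

lemma norm_torusRep_le (y : UnitAddTorus (Fin n)) : ‖torusRep y‖ ≤ Real.sqrt n := by
  rw [EuclideanSpace.norm_eq]
  refine Real.sqrt_le_sqrt ?_
  have h : ∀ i ∈ Finset.univ, ‖(torusRep y).ofLp i‖ ^ 2 ≤ 1 := by
    intro i _
    have h1 := (AddCircle.equivIco (1 : ℝ) 0 (y i)).2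
    have h2 : (torusRep y).ofLp i = (AddCircle.equivIco (1 : ℝ) 0 (y i) : ℝ) := rfl
    rw [h2, Real.norm_eq_abs, sq_abs]
    have h3 := h1.1
    have h4 := h1.2
    nlinarith
  simpa using Finset.sum_le_card_nsmul _ _ _ h

lemma SmoothPer.exists_bound (hG : SmoothPer T G) :
    ∃ C, 0 ≤ C ∧ ∀ x, ∀ t ∈ Icc 0 T, ‖G x t‖ ≤ C := by
  have hK : IsCompact (Metric.closedBall (0 : Vec n) (Real.sqrt n) ×ˢ Icc 0 T) :=
    (isCompact_closedBall _ _).prod isCompact_Icc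
  obtain ⟨C, hC⟩ := hK.exists_bound_of_continuousOn
    (hG.smooth.continuousOn.mono (prod_mono (subset_univ _) subset_rfl))
  refine ⟨max C 0, le_max_right _ _, fun x t ht => ?_⟩
  rw [← PerZ.torusRep_torusMk (hG.perZ_apply t) x]
  exact (hC (torusRep (torusMk x), t)
    ⟨by simpa using norm_torusRep_le (torusMk x), ht⟩).trans (le_max_left _ _)

end Real

section Complex

variable {F : Type*} [NormedAddCommGroup F] [NormedSpace ℂ F] {G : Vec n → ℝ → F}

lemma hasDerivWithinAt_fcoef {s : Set ℝ} (hs : Convex ℝ s) {G' : Vec n → ℝ → F} {C : ℝ}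
    (hG : ∀ x, ∀ τ ∈ s, HasDerivWithinAt (G x) (G' x τ) s τ) (hC : ∀ x, ∀ τ ∈ s, ‖G' x τ‖ ≤ C)
    (hper : PerZ G) (hcont : ∀ τ ∈ s, Continuous fun x => G x τ) (k : Fin n → ℤ) {τ : ℝ}
    (hτ : τ ∈ s) :
    HasDerivWithinAt (fun τ => fcoef (fun x => G x τ) k) (fcoef (fun x => G' x τ) k) s τ := by
  have hp : ∀ τ, PerZ fun x => G x τ := fun τ x m => congrFun (hper x m) τ
  rw [hasDerivWithinAt_iff_tendsto_slope]
  have hev : ∀ᶠ σ in 𝓝[s \ {τ}] τ, σ ∈ s \ {τ} := eventually_mem_nhdsWithin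
  have key : Tendsto (fun σ => ∫ y, mFourier (-k) y • slope (G (torusRep y)) τ σ ∂torusMeasure n)
      (𝓝[s \ {τ}] τ) (𝓝 (fcoef (fun x => G' x τ) k)) := by
    refine tendsto_integral_filter_of_dominated_convergence (fun _ => C) ?_ ?_
      (integrable_const C) ?_
    · filter_upwards [hev] with σ hσ
      refine (integrable_torusMeasure ?_).aestronglyMeasurable
      simp only [slope_def_module]
      exact (mFourier (-k)).continuous.smul
        (((continuous_comp_torusRep (hp σ) (hcont σ hσ.1)).sub
          (continuous_comp_torusRep (hp τ) (hcont τ hτ))).const_smul _)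
    · filter_upwards [hev] with σ hσ
      refine Eventually.of_forall fun y => ?_
      have h1 := Convex.norm_image_sub_le_of_norm_hasDerivWithin_le (hG (torusRep y))
        (hC (torusRep y)) hs hτ hσ.1
      have h2 : 0 < ‖σ - τ‖ := norm_pos_iff.2 (sub_ne_zero.2 hσ.2)
      rw [norm_smul, norm_mFourier_apply, one_mul, slope_def_module, norm_smul, norm_inv,
        inv_mul_le_iff₀ h2]
      linarith
    · refine Eventually.of_forall fun y => ?_
      exact ((hasDerivWithinAt_iff_tendsto_slope.1 (hG (torusRep y) τ hτ))).const_smul _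
  refine key.congr' ?_
  filter_upwards [hev] with σ hσ
  rw [slope_def_module, fcoef, fcoef, ← integral_sub (integrable_fcoef (hp σ) (hcont σ hσ.1) k)
    (integrable_fcoef (hp τ) (hcont τ hτ) k), ← integral_smul]
  refine integral_congr_ae (Eventually.of_forall fun y => ?_)
  simp only [slope_def_module, ← smul_sub]
  rw [smul_comm]

lemma SmoothPer.hasDerivWithinAt_fcoef (hT : 0 < T) (hG : SmoothPer T G) (k : Fin n → ℤ) {t : ℝ}
    (ht : t ∈ Icc 0 T) :
    HasDerivWithinAt (fun t => fcoef (fun x => G x t) k)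
      (fcoef (fun x => TorusParabolic.dirDeriv T (0, 1) G x t) k) (Icc 0 T) t := by
  obtain ⟨C, -, hC⟩ := (hG.dirDeriv hT (0, 1)).exists_bound
  exact TorusParabolic.hasDerivWithinAt_fcoef (convex_Icc 0 T)
    (fun x τ hτ => hG.hasDerivWithinAt_time x hτ) hC hG.per (fun τ hτ => hG.continuous_apply hτ)
    k ht

/-- The standard basis vector of Euclidean space. -/
abbrev stdVec (i : Fin n) : Vec n := EuclideanSpace.single i 1

/-- The Fourier multiplier of the partial derivative `∂_i`. -/
def freq (k : Fin n → ℤ) (i : Fin n) : ℂ := 2 * Real.pi * Complex.I * k i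

lemma fexp_smul_stdVec (k : Fin n → ℤ) (i : Fin n) (τ : ℝ) :
    fexp k (τ • stdVec i) = Complex.exp (freq k i * τ) := by
  rw [fexp_eq_exp]
  congr 1
  rw [Finset.sum_eq_single i]
  · simp [freq]
  · intro j _ hj
    simp [hj]
  · simp

lemma SmoothPer.fcoef_dirDeriv (hT : 0 < T) (hG : SmoothPer T G) (k : Fin n → ℤ) (i : Fin n)
    {t : ℝ} (ht : t ∈ Icc 0 T) :
    fcoef (fun x => TorusParabolic.dirDeriv T (stdVec i, 0) G x t) k =
      freq k i • fcoef (fun x => G x t) k := by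
  have hd := hG.dirDeriv hT (stdVec i, 0)
  obtain ⟨C, -, hC⟩ := hd.exists_bound
  have h1 := TorusParabolic.hasDerivWithinAt_fcoef (s := univ) convex_univ
    (G := fun x τ => G (x + τ • stdVec i) t)
    (G' := fun x τ => TorusParabolic.dirDeriv T (stdVec i, 0) G (x + τ • stdVec i) t)
    (C := C) (fun x τ _ => (hG.hasDerivAt_space x (stdVec i) ht τ).hasDerivWithinAt)
    (fun x τ _ => hC _ t ht)
    (fun x m => by
      funext τ
      beta_reduce
      rw [add_right_comm]
      exact hG.perZ_apply t _ m)
    (fun τ _ => (hG.continuous_apply ht).comp (continuous_id.add continuous_const)) k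
    (mem_univ (0 : ℝ))
  rw [hasDerivWithinAt_univ] at h1
  simp only [fcoef_translate (hG.perZ_apply t), fexp_smul_stdVec, zero_smul, add_zero] at h1
  have h2 : HasDerivAt (fun τ : ℝ => Complex.exp (freq k i * τ)) (freq k i) 0 := by
    have := ((Complex.ofRealCLM.hasDerivAt (x := (0 : ℝ))).const_mul (freq k i)).cexp
    simpa using this
  exact h1.unique (h2.smul_const _)

lemma norm_freq (k : Fin n → ℤ) (i : Fin n) : ‖freq k i‖ = 2 * Real.pi * |(k i : ℝ)| := by
  simp [freq, abs_of_pos Real.pi_pos]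

lemma norm_le_sum_norm_freq (k : Fin n → ℤ) : ‖k‖ ≤ ∑ i, ‖freq k i‖ := by
  refine (pi_norm_le_iff_of_nonneg (Finset.sum_nonneg fun i _ => norm_nonneg _)).2 fun i => ?_
  refine le_trans ?_ (Finset.single_le_sum (f := fun i => ‖freq k i‖)
    (fun i _ => norm_nonneg _) (Finset.mem_univ i))
  simp only [norm_freq]
  have h1 : ‖k i‖ = |(k i : ℝ)| := by rw [Int.norm_eq_abs]
  rw [h1]
  have h2 := Real.pi_gt_three
  have h3 := abs_nonneg (k i : ℝ)
  nlinarith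

lemma SmoothPer.rapidDecay_fcoef (hT : 0 < T) (hG : SmoothPer T G) :
    RapidDecay T fun k t => fcoef (fun x => G x t) k := by
  intro j
  induction j generalizing G with
  | zero =>
    obtain ⟨C, hC0, hC⟩ := hG.exists_bound
    exact ⟨C, hC0, fun k t ht => by simpa using norm_fcoef_le (fun x => hC x t ht) k⟩
  | succ j ih =>
    obtain ⟨K, hK, h⟩ := ih hG
    choose L hL hl using fun i : Fin n => ih (hG.dirDeriv hT (stdVec i, 0))
    refine ⟨K + ∑ i, L i, add_nonneg hK (Finset.sum_nonneg fun i _ => hL i), fun k t ht => ?_⟩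
    have h0 := wt_pow_pos k j
    calc ‖fcoef (fun x => G x t) k‖ * wt k ^ (j + 1)
        = ‖fcoef (fun x => G x t) k‖ * wt k ^ j * (1 + ‖k‖) := by rw [pow_succ, ← mul_assoc]; rfl
      _ ≤ ‖fcoef (fun x => G x t) k‖ * wt k ^ j * (1 + ∑ i, ‖freq k i‖) := by
        gcongr; exact norm_le_sum_norm_freq k
      _ = ‖fcoef (fun x => G x t) k‖ * wt k ^ j +
          ∑ i, ‖freq k i • fcoef (fun x => G x t) k‖ * wt k ^ j := by
        simp only [norm_smul, mul_add, mul_one, Finset.mul_sum]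
        congr 1
        exact Finset.sum_congr rfl fun i _ => by ring
      _ ≤ K + ∑ i, L i := by
        refine add_le_add (h k t ht) (Finset.sum_le_sum fun i _ => ?_)
        rw [← hG.fcoef_dirDeriv hT k i ht]
        exact hl i k t ht

lemma SmoothPer.timeReg_fcoef (hT : 0 < T) (hG : SmoothPer T G) (p : ℕ) :
    TimeReg T p fun k t => fcoef (fun x => G x t) k := by
  induction p generalizing G with
  | zero => exact ⟨hG.rapidDecay_fcoef hT, fun k t ht =>
      (hG.hasDerivWithinAt_fcoef hT k ht).continuousWithinAt⟩
  | succ p ih => exact ⟨hG.rapidDecay_fcoef hT, _, fun k t ht => hG.hasDerivWithinAt_fcoef hT k ht,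
      ih (hG.dirDeriv hT (0, 1))⟩

end Complex

end SmoothPeriodic

section Synthesis

open Set Filter Topology MeasureTheory UnitAddTorus

variable {n : ℕ} {T : ℝ} {F : Type*} [NormedAddCommGroup F] [NormedSpace ℂ F]

lemma fcoef_const [CompleteSpace F] (a : F) (k : Fin n → ℤ) :
    fcoef (fun _ => a) k = if k = 0 then a else 0 := by
  rw [fcoef, integral_smul_const, integral_mFourier]
  simp only [neg_eq_zero]
  split_ifs <;> simp

/-- The sum of a Fourier series. -/
def fsum (w : (Fin n → ℤ) → F) (x : Vec n) : F := ∑' m, fexp m x • w m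

lemma summable_fexp_smul [CompleteSpace F] {w : (Fin n → ℤ) → F} (hw : Summable fun m => ‖w m‖)
    (x : Vec n) : Summable fun m => fexp m x • w m :=
  Summable.of_norm (by simpa [norm_smul, norm_fexp] using hw)

lemma perZ_fsum (w : (Fin n → ℤ) → F) : PerZ (fsum w) := fun x m => by
  simp only [fsum]
  exact tsum_congr fun k => by rw [perZ_fexp k x m]

lemma continuous_fsum [CompleteSpace F] {w : (Fin n → ℤ) → F} (hw : Summable fun m => ‖w m‖) :
    Continuous (fsum w) :=
  continuous_tsum (fun m => (continuous_fexp m).smul continuous_const) hw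
    fun m x => by rw [norm_smul, norm_fexp, one_mul]

lemma fcoef_fsum [CompleteSpace F] {w : (Fin n → ℤ) → F} (hw : Summable fun m => ‖w m‖)
    (k : Fin n → ℤ) : fcoef (fsum w) k = w k := by
  have h := fcoef_clm_tsum (A := fun _ : Vec n => ContinuousLinearMap.id ℂ F) (fun _ _ => rfl)
    continuous_const hw k
  simp only [fcoef_const, ContinuousLinearMap.id_apply] at h
  rw [tsum_eq_single k] at h
  · change fcoef (fun x => ∑' m, fexp m x • w m) k = w k
    simpa using h
  · intro m hm
    rw [if_neg (sub_ne_zero.2 hm.symm), zero_apply]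

/-- Fourier inversion. -/
theorem fsum_fcoef [CompleteSpace F] {G : Vec n → F} (hG : PerZ G) (hc : Continuous G)
    (hs : Summable fun m => ‖fcoef G m‖) (x : Vec n) : fsum (fcoef G) x = G x := by
  have hp := perZ_fsum (fcoef G)
  have hcs := continuous_fsum hs
  have h : fsum (fcoef G) x - G x = 0 :=
    eq_zero_of_fcoef_eq_zero (G := fun x => fsum (fcoef G) x - G x)
      (fun x m => by simp only [hp x m, hG x m]) (hcs.sub hc)
      (fun k => by rw [fcoef_sub hp hcs hG hc, fcoef_fsum hs, sub_self]) x
  exact sub_eq_zero.1 h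

lemma RapidDecay.summable_bound {F : Type*} [NormedAddCommGroup F]
    {g : (Fin n → ℤ) → ℝ → F} (hg : RapidDecay T g) :
    ∃ K, ∀ k, ∀ t ∈ Icc 0 T, ‖g k t‖ ≤ K * (wt k ^ (2 * n))⁻¹ := by
  obtain ⟨K, -, h⟩ := hg (2 * n)
  exact ⟨K, fun k t ht => le_mul_inv_wt_pow (h k t ht)⟩

lemma RapidDecay.summable_norm {F : Type*} [NormedAddCommGroup F]
    {g : (Fin n → ℤ) → ℝ → F} (hg : RapidDecay T g) {t : ℝ}
    (ht : t ∈ Icc 0 T) : Summable fun k => ‖g k t‖ := by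
  obtain ⟨K, h⟩ := hg.summable_bound
  exact Summable.of_nonneg_of_le (fun _ => norm_nonneg _) (fun k => h k t ht)
    ((summable_inv_wt_pow n).mul_left K)

lemma SmoothPer.fsum_fcoef [CompleteSpace F] (hT : 0 < T) {G : Vec n → ℝ → F}
    (hG : SmoothPer T G) (x : Vec n) {t : ℝ} (ht : t ∈ Icc 0 T) :
    fsum (fcoef fun x => G x t) x = G x t :=
  TorusParabolic.fsum_fcoef (hG.perZ_apply t) (hG.continuous_apply ht)
    ((hG.rapidDecay_fcoef hT).summable_norm ht) x

/-- Fourier coefficients of a matrix-vector product. -/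
theorem SmoothPer.fcoef_clm_apply {E : Type*} [NormedAddCommGroup E] [NormedSpace ℂ E]
    [CompleteSpace E] (hT : 0 < T) {A : Vec n → E →L[ℂ] E} {G : Vec n → ℝ → E}
    (hG : SmoothPer T G) {t : ℝ} (hA : PerZ A) (hAc : Continuous A) (ht : t ∈ Icc 0 T)
    (k : Fin n → ℤ) :
    fcoef (fun x => A x (G x t)) k =
      ∑' m, fcoef A (k - m) (fcoef (fun x => G x t) m) := by
  rw [← fcoef_clm_tsum hA hAc ((hG.rapidDecay_fcoef hT).summable_norm ht)]
  congr 1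
  funext x
  exact congrArg (A x) (hG.fsum_fcoef hT x ht).symm

lemma norm_freq_le (k : Fin n → ℤ) (i : Fin n) : ‖freq k i‖ ≤ 2 * Real.pi * wt k ^ 1 := by
  rw [norm_freq, pow_one]
  have := Real.pi_pos
  gcongr
  exact (abs_apply_le_norm k i).trans (norm_le_wt k)

lemma hasFDerivAt_fexp (k : Fin n → ℤ) (x : Vec n) :
    HasFDerivAt (fexp k)
      (∑ i, (EuclideanSpace.proj i : Vec n →L[ℝ] ℝ).smulRight (fexp k x * freq k i)) x := by
  have h0 : fexp k = fun x => Complex.exp (∑ i, freq k i * (x i : ℂ)) := funext (fexp_eq_exp k)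
  have h1 : ∀ i, HasFDerivAt (fun x : Vec n => freq k i * (x i : ℂ))
      (freq k i • Complex.ofRealCLM.comp (EuclideanSpace.proj i : Vec n →L[ℝ] ℝ)) x := fun i =>
    (Complex.ofRealCLM.comp (EuclideanSpace.proj i : Vec n →L[ℝ] ℝ)).hasFDerivAt.const_mul _
  have h2 := (HasFDerivAt.fun_sum fun i (_ : i ∈ Finset.univ) => h1 i).cexp
  have h3 : Complex.exp (∑ i, freq k i * (x i : ℂ)) = fexp k x := (fexp_eq_exp k x).symm
  rw [h3, ← h0] at h2
  refine h2.congr_fderiv ?_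
  ext v
  simp only [smul_apply, sum_apply, ContinuousLinearMap.smulRight_apply, smul_eq_mul,
    ContinuousLinearMap.comp_apply, Finset.mul_sum]
  refine Finset.sum_congr rfl fun i _ => ?_
  simp
  ring

lemma TimeReg.freq_smul {p : ℕ} {g : (Fin n → ℤ) → ℝ → F} (hg : TimeReg T p g) (i : Fin n) :
    TimeReg T p fun k t => freq k i • g k t := by
  refine hg.clm (fun k => ((freq k i • ContinuousLinearMap.id ℂ F).restrictScalars ℝ)) (q := 1)
    (C := 2 * Real.pi) (by positivity) fun k => ?_
  refine le_trans ?_ (norm_freq_le k i)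
  refine ContinuousLinearMap.opNorm_le_bound _ (norm_nonneg _) fun v => ?_
  simp [norm_smul]

variable [CompleteSpace F]

lemma TimeReg.contDiffOn_fsum (hT : 0 < T) {p : ℕ} {g : (Fin n → ℤ) → ℝ → F}
    (hg : TimeReg T p g) :
    ContDiffOn ℝ p (fun q : Vec n × ℝ => fsum (fun k => g k q.2) q.1) (cyl n T) := by
  induction p generalizing g with
  | zero =>
    obtain ⟨K, hK⟩ := hg.rapidDecay.summable_bound
    rw [Nat.cast_zero, contDiffOn_zero]
    refine continuousOn_tsum (fun k => ?_) ((summable_inv_wt_pow n).mul_left K)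
      fun k q hq => ?_
    · exact ((continuous_fexp k).comp continuous_fst).continuousOn.smul
        ((hg.continuousOn k).comp continuousOn_snd fun q hq => hq.2)
    · rw [norm_smul, norm_fexp, one_mul]
      exact hK k q.2 hq.2
  | succ p ih =>
    have hp := hg.pred
    obtain ⟨h0, g', h1, hg'⟩ := hg
    have hi := fun i => hp.freq_smul i
    have hir := fun i => (hi i).rapidDecay
    choose K hK using fun i => (hir i).summable_bound
    obtain ⟨L, hL⟩ := hg'.rapidDecay.summable_bound
    let P : Fin n → F →L[ℝ] (Vec n × ℝ →L[ℝ] F) := fun i =>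
      ContinuousLinearMap.smulRightL ℝ (Vec n × ℝ) F
        ((EuclideanSpace.proj i : Vec n →L[ℝ] ℝ).comp (ContinuousLinearMap.fst ℝ (Vec n) ℝ))
    let Q : F →L[ℝ] (Vec n × ℝ →L[ℝ] F) :=
      ContinuousLinearMap.smulRightL ℝ (Vec n × ℝ) F (ContinuousLinearMap.snd ℝ (Vec n) ℝ)
    have hsi : ∀ i, ∀ q ∈ cyl n T, Summable fun k => fexp k q.1 • freq k i • g k q.2 :=
      fun i q hq => summable_fexp_smul ((hir i).summable_norm hq.2) q.1
    have hst : ∀ q ∈ cyl n T, Summable fun k => fexp k q.1 • g' k q.2 :=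
      fun q hq => summable_fexp_smul (hg'.rapidDecay.summable_norm hq.2) q.1
    rw [Nat.cast_add, Nat.cast_one,
      contDiffOn_succ_iff_hasFDerivWithinAt_of_uniqueDiffOn (uniqueDiffOn_cyl hT)]
    refine ⟨fun h => by simp at h, fun q =>
      (∑ i, P i (fsum (fun k => freq k i • g k q.2) q.1)) + Q (fsum (fun k => g' k q.2) q.1),
      ?_, fun q hq => ?_⟩
    · exact (ContDiffOn.sum fun i _ => (P i).contDiff.comp_contDiffOn (ih (hi i))).add
        (Q.contDiff.comp_contDiffOn (ih hg'))
    · have key := hasFDerivWithinAt_tsum_of_bound (convex_cyl (n := n) (T := T))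
        (f := fun k q => fexp k q.1 • g k q.2)
        (f' := fun k q => (∑ i, P i (fexp k q.1 • freq k i • g k q.2)) +
          Q (fexp k q.1 • g' k q.2))
        (a := fun k => (∑ i, ‖P i‖ * (K i * (wt k ^ (2 * n))⁻¹)) + ‖Q‖ * (L * (wt k ^ (2 * n))⁻¹))
        ((summable_sum fun i _ => ((summable_inv_wt_pow n).mul_left _).mul_left _).add
          (((summable_inv_wt_pow n).mul_left _).mul_left _))
        (fun k q hq => ?_)
        (fun q hq => summable_fexp_smul (h0.summable_norm hq.2) q.1) (fun k q hq => ?_) hq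
      · refine key.congr_fderiv ?_
        rw [Summable.tsum_add (summable_sum fun i _ => (P i).summable (hsi i q hq))
          (Q.summable (hst q hq)), Summable.tsum_finsetSum
            fun i _ => (P i).summable (hsi i q hq)]
        congr 1
        · exact Finset.sum_congr rfl fun i _ => ((P i).map_tsum (hsi i q hq)).symm
        · exact (Q.map_tsum (hst q hq)).symm
      · have e1 : HasFDerivWithinAt (fun q : Vec n × ℝ => fexp k q.1)
            ((∑ i, (EuclideanSpace.proj i : Vec n →L[ℝ] ℝ).smulRight
              (fexp k q.1 * freq k i)).comp (ContinuousLinearMap.fst ℝ (Vec n) ℝ)) (cyl n T) q :=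
          ((hasFDerivAt_fexp k q.1).comp q hasFDerivAt_fst).hasFDerivWithinAt
        have e2 : HasFDerivWithinAt (fun q : Vec n × ℝ => g k q.2)
            ((ContinuousLinearMap.toSpanSingleton ℝ (g' k q.2)).comp
              (ContinuousLinearMap.snd ℝ (Vec n) ℝ)) (cyl n T) q :=
          HasFDerivWithinAt.comp (g := g k) (t := Icc 0 T) q
            (h1 k q.2 hq.2).hasFDerivWithinAt hasFDerivWithinAt_snd fun q hq => hq.2
        refine (e1.smul e2).congr_fderiv ?_
        ext v
        · simp [P, Q, smul_smul, Finset.sum_smul]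
          exact Finset.sum_congr rfl fun i _ => by rw [mul_smul, Complex.coe_smul]
        · simp [P, Q, smul_smul]
      · refine (norm_add_le _ _).trans (add_le_add ((norm_sum_le _ _).trans
          (Finset.sum_le_sum fun i _ => ?_)) ?_)
        · refine (P i).le_opNorm_of_le ?_
          rw [norm_smul, norm_fexp, one_mul]
          exact hK i k q.2 hq.2
        · refine Q.le_opNorm_of_le ?_
          rw [norm_smul, norm_fexp, one_mul]
          exact hL k q.2 hq.2

lemma smoothPer_fsum (hT : 0 < T) {g : (Fin n → ℤ) → ℝ → F} (hg : ∀ p, TimeReg T p g) :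
    SmoothPer T fun x t => fsum (fun k => g k t) x :=
  ⟨contDiffOn_infty.2 fun p => (hg p).contDiffOn_fsum hT, fun x m => by
    funext t; exact perZ_fsum _ x m⟩

end Synthesis

section QuadraticForm

open Set Filter Topology MeasureTheory UnitAddTorus
open scoped InnerProductSpace

variable {n : ℕ} {E : Type*} [NormedAddCommGroup E] [InnerProductSpace ℂ E]

lemma inner_mFourier_sum (B : E →L[ℂ] E) (y : UnitAddTorus (Fin n)) (S : Finset (Fin n → ℤ))
    (w : (Fin n → ℤ) → E) :
    (⟪∑ k ∈ S, mFourier k y • w k, B (∑ m ∈ S, mFourier m y • w m)⟫_ℂ).re =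
      ∑ k ∈ S, ∑ m ∈ S, (⟪w k, (mFourier (-(k - m)) y • B) (w m)⟫_ℂ).re := by
  rw [sum_inner, Complex.re_sum]
  refine Finset.sum_congr rfl fun k _ => ?_
  rw [map_sum, inner_sum, Complex.re_sum]
  refine Finset.sum_congr rfl fun m _ => ?_
  rw [map_smul, inner_smul_left, inner_smul_right, smul_apply, inner_smul_right, ← mul_assoc,
    ← mFourier_neg, ← mFourier_add]
  congr 4
  abel_nf

variable [CompleteSpace E]

lemma integral_form {P : Vec n → E →L[ℂ] E} (hP : PerZ P) (hc : Continuous P)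
    (S : Finset (Fin n → ℤ)) (w : (Fin n → ℤ) → E) :
    Integrable (fun y => ∑ k ∈ S, ∑ m ∈ S,
      (⟪w k, (mFourier (-(k - m)) y • P (torusRep y)) (w m)⟫_ℂ).re) (torusMeasure n) ∧
    ∫ y, ∑ k ∈ S, ∑ m ∈ S,
      (⟪w k, (mFourier (-(k - m)) y • P (torusRep y)) (w m)⟫_ℂ).re ∂torusMeasure n =
      ∑ k ∈ S, ∑ m ∈ S, (⟪w k, fcoef P (k - m) (w m)⟫_ℂ).re := by
  let L : (Fin n → ℤ) → (Fin n → ℤ) → (E →L[ℂ] E) →L[ℝ] ℝ := fun k m =>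
    Complex.reCLM.comp (((innerSL ℂ (w k)).comp
      (ContinuousLinearMap.apply ℂ E (w m))).restrictScalars ℝ)
  have hi : ∀ k m, Integrable (fun y => L k m (mFourier (-(k - m)) y • P (torusRep y)))
      (torusMeasure n) := fun k m => (L k m).integrable_comp (integrable_fcoef hP hc (k - m))
  refine ⟨integrable_finsetSum _ fun k _ => integrable_finsetSum _ fun m _ => hi k m, ?_⟩
  refine (integral_finsetSum _ fun k _ => integrable_finsetSum _ fun m _ => hi k m).trans ?_
  refine Finset.sum_congr rfl fun k _ => ?_
  refine (integral_finsetSum _ fun m _ => hi k m).trans ?_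
  refine Finset.sum_congr rfl fun m _ => ?_
  exact (L k m).integral_comp_comm (integrable_fcoef hP hc (k - m))

/-- A pointwise bound for a quadratic form passes to the block Toeplitz matrix of its Fourier
coefficients. -/
theorem form_fcoef_le {P : Vec n → E →L[ℂ] E} (hP : PerZ P) (hc : Continuous P) {c : ℝ}
    (h : ∀ x v, (⟪v, P x v⟫_ℂ).re ≤ c * ‖v‖ ^ 2) (S : Finset (Fin n → ℤ))
    (w : (Fin n → ℤ) → E) :
    ∑ k ∈ S, ∑ m ∈ S, (⟪w k, fcoef P (k - m) (w m)⟫_ℂ).re ≤ c * ∑ k ∈ S, ‖w k‖ ^ 2 := by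
  classical
  obtain ⟨h1, h2⟩ := integral_form hP hc S w
  obtain ⟨h3, h4⟩ := integral_form (P := fun _ : Vec n => ContinuousLinearMap.id ℂ E)
    (fun _ _ => rfl) continuous_const S w
  have h5 : ∑ k ∈ S, ∑ m ∈ S,
      (⟪w k, fcoef (fun _ : Vec n => ContinuousLinearMap.id ℂ E) (k - m) (w m)⟫_ℂ).re =
      ∑ k ∈ S, ‖w k‖ ^ 2 := by
    refine Finset.sum_congr rfl fun k hk => ?_
    rw [Finset.sum_eq_single_of_mem k hk]
    · rw [fcoef_const, if_pos (sub_self k), ContinuousLinearMap.id_apply, inner_self_eq_norm_sq_to_K]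
      norm_cast
    · intro m _ hm
      rw [fcoef_const, if_neg (sub_ne_zero.2 hm.symm), zero_apply, inner_zero_right,
        Complex.zero_re]
  rw [← h5, ← h2, ← h4, ← integral_const_mul]
  refine integral_mono h1 (h3.const_mul c) fun y => ?_
  simp only
  rw [← inner_mFourier_sum, ← inner_mFourier_sum, ContinuousLinearMap.id_apply,
    inner_self_eq_norm_sq_to_K]
  refine (h _ _).trans (le_of_eq ?_)
  norm_cast

end QuadraticForm

section Monomials

variable {n : ℕ}

/-- The symbol of an iterated partial derivative. -/
def dsymb {k : ℕ} (I : Fin k → Fin n) (m : Fin n → ℤ) : ℂ := ∏ j, freq m (I j)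

lemma norm_dsymb_le {k : ℕ} (I : Fin k → Fin n) (m : Fin n → ℤ) :
    ‖dsymb I m‖ ≤ (2 * Real.pi) ^ k * wt m ^ k := by
  rw [dsymb, norm_prod, ← mul_pow]
  calc ∏ j, ‖freq m (I j)‖ ≤ ∏ _j : Fin k, (2 * Real.pi * wt m) :=
        Finset.prod_le_prod (fun _ _ => norm_nonneg _) fun j _ => by
          simpa using norm_freq_le m (I j)
    _ = _ := by simp

lemma freq_add (ξ η : Fin n → ℤ) (i : Fin n) : freq (ξ + η) i = freq ξ i + freq η i := by
  simp only [freq, Pi.add_apply, Int.cast_add]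
  ring

lemma wt_add_le_mul (ξ η : Fin n → ℤ) : wt (ξ + η) ≤ wt η * wt ξ := by
  have h1 := norm_add_le ξ η
  have h2 := mul_nonneg (norm_nonneg ξ) (norm_nonneg η)
  simp only [wt]
  nlinarith

lemma norm_dsymb_sub_le {k : ℕ} (I : Fin k → Fin n) (ξ η : Fin n → ℤ) :
    ‖dsymb I ξ - dsymb I (ξ + η)‖ * wt ξ ≤
      k * (2 * Real.pi) ^ k * wt η ^ k * wt ξ ^ k := by
  induction k with
  | zero => simp [dsymb]
  | succ k ih =>
    have hpi := Real.pi_pos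
    set J : Fin k → Fin n := fun j => I j.succ
    have e : ∀ m, dsymb I m = freq m (I 0) * dsymb J m := fun m => Fin.prod_univ_succ _
    have e2 : dsymb I ξ - dsymb I (ξ + η) =
        freq ξ (I 0) * (dsymb J ξ - dsymb J (ξ + η)) - freq η (I 0) * dsymb J (ξ + η) := by
      rw [e, e, freq_add]; ring
    have h1 := norm_freq_le ξ (I 0)
    have h2 := norm_freq_le η (I 0)
    rw [pow_one] at h1 h2
    have h3 := ih J
    have h4 : ‖dsymb J (ξ + η)‖ ≤ (2 * Real.pi) ^ k * (wt η ^ k * wt ξ ^ k) := by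
      refine (norm_dsymb_le J _).trans ?_
      rw [← mul_pow (wt η)]
      have := (wt_pos (ξ + η)).le
      have := wt_add_le_mul ξ η
      gcongr
    have w1 := wt_pos ξ
    have w2 := wt_pos η
    have w3 : wt η ^ k ≤ wt η ^ (k + 1) := wt_pow_mono η (Nat.le_succ k)
    calc ‖dsymb I ξ - dsymb I (ξ + η)‖ * wt ξ
        ≤ (‖freq ξ (I 0)‖ * ‖dsymb J ξ - dsymb J (ξ + η)‖ +
            ‖freq η (I 0)‖ * ‖dsymb J (ξ + η)‖) * wt ξ := by
          rw [e2, ← norm_mul, ← norm_mul]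
          exact mul_le_mul_of_nonneg_right (norm_sub_le _ _) w1.le
      _ = ‖freq ξ (I 0)‖ * (‖dsymb J ξ - dsymb J (ξ + η)‖ * wt ξ) +
            ‖freq η (I 0)‖ * ‖dsymb J (ξ + η)‖ * wt ξ := by ring
      _ ≤ 2 * Real.pi * wt ξ * (k * (2 * Real.pi) ^ k * wt η ^ k * wt ξ ^ k) +
            2 * Real.pi * wt η * ((2 * Real.pi) ^ k * (wt η ^ k * wt ξ ^ k)) * wt ξ := by
          gcongr
      _ ≤ 2 * Real.pi * wt ξ * (k * (2 * Real.pi) ^ k * wt η ^ (k + 1) * wt ξ ^ k) +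
            2 * Real.pi * wt η * ((2 * Real.pi) ^ k * (wt η ^ k * wt ξ ^ k)) * wt ξ := by
          gcongr
      _ = _ := by push_cast; ring

end Monomials

section OperatorMatrix

open Set Filter Topology MeasureTheory UnitAddTorus
open scoped InnerProductSpace

variable {n : ℕ} {T : ℝ} {E : Type*} [NormedAddCommGroup E] [InnerProductSpace ℂ E]
  [CompleteSpace E]

/-- The matrix of a differential operator of order `r` in the Fourier basis. -/
def opMat (r : ℕ) (a : (k : ℕ) → (Fin k → Fin n) → Vec n → ℝ → E →L[ℂ] E) (t : ℝ)
    (k m : Fin n → ℤ) : E →L[ℂ] E :=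
  ∑ i ∈ Finset.range (r + 1), ∑ I : Fin i → Fin n, dsymb I m • fcoef (fun x => a i I x t) (k - m)

lemma matReg_opMat (hT : 0 < T) {r : ℕ}
    {a : (k : ℕ) → (Fin k → Fin n) → Vec n → ℝ → E →L[ℂ] E}
    (ha : ∀ k, k ≤ r → ∀ I, SmoothPer T (a k I)) (p : ℕ) : MatReg T r p (opMat r a) := by
  have hpi := Real.pi_pos
  refine MatReg.sum _ fun i hi => MatReg.sum _ fun I _ => ?_
  have hir : i ≤ r := Nat.lt_succ_iff.1 (Finset.mem_range.1 hi)
  refine ((ha i hir I).timeReg_fcoef hT p).matReg_smul (C := (2 * Real.pi) ^ i) (by positivity)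
    fun m => (norm_dsymb_le I m).trans ?_
  have := wt_pow_mono m hir
  gcongr

lemma norm_sum_smul_mul_le {ι F : Type*} [NormedAddCommGroup F] [NormedSpace ℂ F] (S : Finset ι)
    {c : ι → ℂ} {b : ι → F} {K : ι → ℝ} {X W : ℝ} (hW : 0 ≤ W)
    (hc : ∀ i ∈ S, ‖c i‖ ≤ X) (hb : ∀ i ∈ S, ‖b i‖ * W ≤ K i) :
    ‖∑ i ∈ S, c i • b i‖ * W ≤ (∑ i ∈ S, K i) * X := by
  rw [Finset.sum_mul]
  calc ‖∑ i ∈ S, c i • b i‖ * W ≤ (∑ i ∈ S, ‖c i • b i‖) * W :=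
        mul_le_mul_of_nonneg_right (norm_sum_le _ _) hW
    _ = ∑ i ∈ S, ‖c i • b i‖ * W := Finset.sum_mul _ _ _
    _ ≤ _ := Finset.sum_le_sum fun i hi => by
      rw [norm_smul, mul_assoc, mul_comm]
      exact mul_le_mul (hb i hi) (hc i hi) (norm_nonneg _)
        ((mul_nonneg (norm_nonneg _) hW).trans (hb i hi))

/-- The matrix of a strongly elliptic operator satisfies Gårding's inequality. -/
theorem isGarding_opMat (hT : 0 < T) {ρ : ℕ} {lam : ℝ} (hlam : 0 < lam)
    {a : (k : ℕ) → (Fin k → Fin n) → Vec n → ℝ → E →L[ℂ] E}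
    (ha : ∀ k, k ≤ ρ + 2 → ∀ I, SmoothPer T (a k I))
    (hell : ∀ x, ∀ t ∈ Icc 0 T, ∀ (ξ : Fin n → ℤ) (v : E),
      (⟪v, (∑ I : Fin (ρ + 2) → Fin n, dsymb I ξ • a (ρ + 2) I x t) v⟫_ℂ).re ≤
        -lam * ‖ξ‖ ^ (ρ + 2) * ‖v‖ ^ 2) :
    IsGarding T (ρ + 2) (opMat (ρ + 2) a) := by
  refine ⟨(matReg_opMat hT ha 0).continuousOn, (matReg_opMat hT ha 0).offDiagDecay, fun s => ?_⟩
  have hpi := Real.pi_pos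
  have hpi1 : 1 ≤ 2 * Real.pi := by linarith [Real.pi_gt_three]
  set N := 2 * n + (ρ + 2) + (s + 1) with hN
  have hdec : ∀ i (I : Fin i → Fin n), ∃ K, 0 ≤ K ∧ (i ≤ ρ + 2 → ∀ k, ∀ t ∈ Icc 0 T,
      ‖fcoef (fun x => a i I x t) k‖ * wt k ^ N ≤ K) := by
    intro i I
    by_cases hi : i ≤ ρ + 2
    · obtain ⟨K, hK, h⟩ := (ha i hi I).rapidDecay_fcoef hT N
      exact ⟨K, hK, fun _ => h⟩
    · exact ⟨0, le_rfl, fun h => absurd h hi⟩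
  choose K hK0 hK using hdec
  set K₁ : ℝ := ∑ I, K (ρ + 2) I with hK₁
  set K₂ : ℝ := ∑ i ∈ Finset.range (ρ + 2), ∑ I, K i I with hK₂
  have hK₁0 : 0 ≤ K₁ := Finset.sum_nonneg fun I _ => hK0 _ _
  have hK₂0 : 0 ≤ K₂ := Finset.sum_nonneg fun i _ => Finset.sum_nonneg fun I _ => hK0 _ _
  set C₀ : ℝ := ((ρ + 2 : ℕ) : ℝ) * (2 * Real.pi) ^ (ρ + 2) with hC₀
  have hC₀1 : (2 * Real.pi) ^ (ρ + 2) ≤ C₀ := by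
    refine le_mul_of_one_le_left (by positivity) ?_
    exact_mod_cast Nat.succ_le_succ (Nat.zero_le _)
  have hC₀0 : 0 ≤ C₀ := by positivity
  have hKK : K₁ * C₀ ≤ (K₁ + K₂) * C₀ := by gcongr; linarith
  have hKK2 : K₂ * C₀ ≤ (K₁ + K₂) * C₀ := by gcongr; linarith
  obtain ⟨C, hC0, hC⟩ := garding (n := n) (E := E) ρ s (K := (K₁ + K₂) * C₀) (by positivity) hlam
  refine ⟨C, hC0, fun t ht S v => ?_⟩
  have main := hC
    (fun j ξ => ∑ I : Fin (ρ + 2) → Fin n, dsymb I ξ • fcoef (fun x => a (ρ + 2) I x t) j)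
    (fun j ξ => ∑ i ∈ Finset.range (ρ + 2), ∑ I : Fin i → Fin n,
      dsymb I ξ • fcoef (fun x => a i I x t) j) ?_ ?_ ?_ ?_ S v
  · refine le_trans (le_of_eq ?_) main
    refine Finset.sum_congr rfl fun k _ => Finset.sum_congr rfl fun m _ => ?_
    rw [opMat, Finset.sum_range_succ, add_comm]
  · intro j ξ
    have := wt_pow_pos ξ (ρ + 2)
    refine (norm_sum_smul_mul_le Finset.univ (X := C₀ * wt ξ ^ (ρ + 2))
      (wt_pow_pos _ _).le (fun I _ => (norm_dsymb_le I ξ).trans ?_)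
      fun I _ => hK (ρ + 2) I le_rfl j t ht).trans ?_
    · gcongr
    · rw [← mul_assoc]; gcongr
  · intro j ξ η
    have h1 := wt_pow_pos η (ρ + 2)
    have h2 := wt_pow_pos ξ (ρ + 1)
    have h3 := wt_pos ξ
    rw [← Finset.sum_sub_distrib]
    simp only [← sub_smul]
    refine (norm_sum_smul_mul_le Finset.univ (X := C₀ * wt η ^ (ρ + 2) * wt ξ ^ (ρ + 1))
      (wt_pow_pos _ _).le (fun I _ => ?_)
      fun I _ => hK (ρ + 2) I le_rfl j t ht).trans ?_
    · have := norm_dsymb_sub_le I ξ η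
      rw [pow_succ (wt ξ) (ρ + 1), ← mul_assoc] at this
      exact le_of_mul_le_mul_right this h3
    · rw [← mul_assoc, ← mul_assoc]; gcongr
  · intro j ξ
    have h2 := wt_pow_pos ξ (ρ + 1)
    have hW := (wt_pow_pos j N).le
    calc _ ≤ (∑ i ∈ Finset.range (ρ + 2), ‖∑ I : Fin i → Fin n,
          dsymb I ξ • fcoef (fun x => a i I x t) j‖) * wt j ^ N :=
          mul_le_mul_of_nonneg_right (norm_sum_le _ _) hW
      _ = ∑ i ∈ Finset.range (ρ + 2), ‖∑ I : Fin i → Fin n,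
          dsymb I ξ • fcoef (fun x => a i I x t) j‖ * wt j ^ N := Finset.sum_mul _ _ _
      _ ≤ ∑ i ∈ Finset.range (ρ + 2), (∑ I, K i I) * (C₀ * wt ξ ^ (ρ + 1)) := by
          refine Finset.sum_le_sum fun i hi => ?_
          have hi := Finset.mem_range.1 hi
          refine norm_sum_smul_mul_le Finset.univ hW
            (fun I _ => (norm_dsymb_le I ξ).trans ?_) fun I _ => hK i I hi.le j t ht
          have h4 := wt_pow_mono ξ (Nat.lt_succ_iff.1 hi)
          have h5 := (pow_le_pow_right₀ hpi1 hi.le).trans hC₀1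
          have := wt_pow_pos ξ i
          gcongr
      _ = K₂ * C₀ * wt ξ ^ (ρ + 1) := by rw [← Finset.sum_mul, ← hK₂]; ring
      _ ≤ _ := by gcongr
  · intro ξ S w
    have hs : ∀ I : Fin (ρ + 2) → Fin n, PerZ (fun x => dsymb I ξ • a (ρ + 2) I x t) ∧
        Continuous fun x => dsymb I ξ • a (ρ + 2) I x t := fun I =>
      ⟨fun x m => by simp only [(ha _ le_rfl I).perZ_apply t x m],
        by
        have := (ha _ le_rfl I).continuous_apply ht
        exact this.fun_const_smul (dsymb I ξ)⟩
    have h := form_fcoef_le (P := fun x => ∑ I : Fin (ρ + 2) → Fin n,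
      dsymb I ξ • a (ρ + 2) I x t)
      (fun x m => Finset.sum_congr rfl fun I _ => (hs I).1 x m)
      (continuous_finsetSum _ fun I _ => (hs I).2) (fun x v => hell x t ht ξ v) S w
    refine le_trans (le_of_eq ?_) h
    refine Finset.sum_congr rfl fun k _ => Finset.sum_congr rfl fun m _ => ?_
    rw [fcoef_finset_sum _ (fun I _ => (hs I).1) fun I _ => (hs I).2]
    congr 4
    refine Finset.sum_congr rfl fun I _ => ?_
    exact (fcoef_clm (dsymb I ξ • ContinuousLinearMap.id ℂ (E →L[ℂ] E))
      ((ha _ le_rfl I).perZ_apply t) ((ha _ le_rfl I).continuous_apply ht) (k - m)).symm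

end OperatorMatrix

section IteratedDerivatives

open Set Filter Topology

variable {n : ℕ} {T : ℝ}

section Real

variable {F : Type*} [NormedAddCommGroup F] [NormedSpace ℝ F] {G H : Vec n → ℝ → F}

/-- Iterated spatial derivative of a function on the cylinder. -/
def spIter (T : ℝ) : (k : ℕ) → (Fin k → Fin n) → (Vec n → ℝ → F) → Vec n → ℝ → F
  | 0, _, G => G
  | k + 1, I, G => dirDeriv T (stdVec (I 0), 0) (spIter T k (fun j => I j.succ) G)

lemma SmoothPer.spIter (hT : 0 < T) (hG : SmoothPer T G) (k : ℕ) (I : Fin k → Fin n) :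
    SmoothPer T (spIter T k I G) := by
  induction k with
  | zero => exact hG
  | succ k ih => exact (ih _).dirDeriv hT _

lemma dirDeriv_congr (h : ∀ x, ∀ t ∈ Icc 0 T, G x t = H x t) (v : Vec n × ℝ) (x : Vec n) {t : ℝ}
    (ht : t ∈ Icc 0 T) : dirDeriv T v G x t = dirDeriv T v H x t := by
  have := fderivWithin_congr (𝕜 := ℝ) (s := cyl n T) (f := fun q : Vec n × ℝ => H q.1 q.2)
    (f₁ := fun q : Vec n × ℝ => G q.1 q.2) (x := (x, t)) (fun q hq => h q.1 q.2 hq.2) (h x t ht)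
  rw [dirDeriv, dirDeriv, this]

lemma SmoothPer.dirDeriv_clm (hT : 0 < T) {F' : Type*} [NormedAddCommGroup F'] [NormedSpace ℝ F']
    (L : F →L[ℝ] F') (hG : SmoothPer T G) (v : Vec n × ℝ) (x : Vec n) {t : ℝ}
    (ht : t ∈ Icc 0 T) :
    TorusParabolic.dirDeriv T v (fun x t => L (G x t)) x t =
      L (TorusParabolic.dirDeriv T v G x t) := by
  have h := (L.hasFDerivAt.comp_hasFDerivWithinAt (x, t)
    (hG.hasFDerivWithinAt (x := x) ht)).fderivWithin
      (uniqueDiffOn_cyl hT (x, t) ⟨mem_univ x, ht⟩)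
  exact congrArg (fun D => D v) h

lemma SmoothPer.spIter_clm (hT : 0 < T) {F' : Type*} [NormedAddCommGroup F'] [NormedSpace ℝ F']
    (L : F →L[ℝ] F') (hG : SmoothPer T G) (k : ℕ) (I : Fin k → Fin n) (x : Vec n) {t : ℝ}
    (ht : t ∈ Icc 0 T) :
    TorusParabolic.spIter T k I (fun x t => L (G x t)) x t =
      L (TorusParabolic.spIter T k I G x t) := by
  induction k generalizing x t with
  | zero => rfl
  | succ k ih =>
    refine (dirDeriv_congr (fun x t ht => ih (fun j => I j.succ) x ht) _ x ht).trans ?_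
    exact (hG.spIter hT k _).dirDeriv_clm hT L _ x ht

lemma SmoothPer.iteratedFDeriv_eq_spIter (hT : 0 < T) (hG : SmoothPer T G) (k : ℕ)
    (I : Fin k → Fin n) (x : Vec n) {t : ℝ} (ht : t ∈ Icc 0 T) :
    iteratedFDeriv ℝ k (fun y => G y t) x (fun j => stdVec (I j)) =
      TorusParabolic.spIter T k I G x t := by
  induction k generalizing x with
  | zero => rfl
  | succ k ih =>
    have hd : DifferentiableAt ℝ (iteratedFDeriv ℝ k fun y => G y t) x :=
      ((hG.contDiff_apply ht).differentiable_iteratedFDeriv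
        (by exact_mod_cast ENat.natCast_lt_top k)) x
    let J : Fin k → Fin n := fun j => I j.succ
    let L := ContinuousMultilinearMap.apply ℝ (fun _ : Fin k => Vec n) F (fun j => stdVec (J j))
    have h1 : HasFDerivAt (fun y => TorusParabolic.spIter T k J G y t)
        (L.comp (fderiv ℝ (iteratedFDeriv ℝ k fun y => G y t) x)) x := by
      have : (fun y => TorusParabolic.spIter T k J G y t) =
          fun y => L (iteratedFDeriv ℝ k (fun y => G y t) y) := funext fun y => (ih J y).symm
      rw [this]
      exact L.hasFDerivAt.comp x hd.hasFDerivAt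
    have h2 := h1.unique ((hG.spIter hT k J).hasFDerivAt_space x ht)
    rw [iteratedFDeriv_succ_apply_left]
    exact congrArg (fun D => D (stdVec (I 0))) h2

end Real

lemma SmoothPer.fcoef_spIter {F : Type*} [NormedAddCommGroup F] [NormedSpace ℂ F]
    {G : Vec n → ℝ → F} (hT : 0 < T) (hG : SmoothPer T G) (k : ℕ) (I : Fin k → Fin n)
    (m : Fin n → ℤ) {t : ℝ} (ht : t ∈ Icc 0 T) :
    fcoef (fun x => TorusParabolic.spIter T k I G x t) m =
      dsymb I m • fcoef (fun x => G x t) m := by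
  induction k with
  | zero => simp [TorusParabolic.spIter, dsymb]
  | succ k ih =>
    refine ((hG.spIter hT k fun j => I j.succ).fcoef_dirDeriv hT m (I 0) ht).trans ?_
    rw [ih, smul_smul]
    congr 1
    exact (Fin.prod_univ_succ fun j => freq m (I j)).symm

end IteratedDerivatives

section ComplexSystem

open Set Filter Topology
open scoped InnerProductSpace

variable {n : ℕ} {T : ℝ} {E : Type*} [NormedAddCommGroup E] [InnerProductSpace ℂ E]
  {r : ℕ} {a : (k : ℕ) → (Fin k → Fin n) → Vec n → ℝ → E →L[ℂ] E} {G f : Vec n → ℝ → E}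

/-- A linear differential operator with operator-valued coefficients. -/
def diffOp (T : ℝ) (r : ℕ) (a : (k : ℕ) → (Fin k → Fin n) → Vec n → ℝ → E →L[ℂ] E)
    (G : Vec n → ℝ → E) (x : Vec n) (t : ℝ) : E :=
  ∑ i ∈ Finset.range (r + 1), ∑ I : Fin i → Fin n, a i I x t (spIter T i I G x t)

lemma SmoothPer.clm_apply {A : Vec n → ℝ → E →L[ℂ] E} (hA : SmoothPer T A)
    (hG : SmoothPer T G) : SmoothPer T fun x t => A x t (G x t) :=
  ⟨((ContinuousLinearMap.restrictScalarsL ℂ E E ℝ ℝ).contDiff.comp_contDiffOn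
    hA.smooth).clm_apply hG.smooth, fun x m => by
      funext t; simp only [hA.per x m, hG.per x m]⟩

lemma SmoothPer.diffOp (hT : 0 < T) (ha : ∀ k, k ≤ r → ∀ I, SmoothPer T (a k I))
    (hG : SmoothPer T G) : SmoothPer T (diffOp T r a G) :=
  SmoothPer.finset_sum fun i hi => SmoothPer.finset_sum fun I _ =>
    (ha i (Nat.lt_succ_iff.1 (Finset.mem_range.1 hi)) I).clm_apply (hG.spIter hT i I)

variable [CompleteSpace E]

lemma SmoothPer.fcoef_diffOp (hT : 0 < T) (ha : ∀ k, k ≤ r → ∀ I, SmoothPer T (a k I))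
    (hG : SmoothPer T G) (k : Fin n → ℤ) {t : ℝ} (ht : t ∈ Icc 0 T) :
    fcoef (fun x => TorusParabolic.diffOp T r a G x t) k =
      ∑' m, opMat r a t k m (fcoef (fun x => G x t) m) := by
  have hle : ∀ i ∈ Finset.range (r + 1), i ≤ r := fun i hi =>
    Nat.lt_succ_iff.1 (Finset.mem_range.1 hi)
  have hs : ∀ i ∈ Finset.range (r + 1), ∀ I : Fin i → Fin n,
      SmoothPer T fun x t => a i I x t (TorusParabolic.spIter T i I G x t) := fun i hi I =>
    (ha i (hle i hi) I).clm_apply (hG.spIter hT i I)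
  have hs' : ∀ i ∈ Finset.range (r + 1),
      SmoothPer T fun x t => ∑ I : Fin i → Fin n, a i I x t (TorusParabolic.spIter T i I G x t) := fun i hi =>
    SmoothPer.finset_sum fun I _ => hs i hi I
  have hrd := hG.rapidDecay_fcoef hT
  have hsum : ∀ i ∈ Finset.range (r + 1), ∀ I : Fin i → Fin n,
      Summable fun m => (dsymb I m • fcoef (fun x => a i I x t) (k - m))
        (fcoef (fun x => G x t) m) := by
    intro i hi I
    have hM : MatReg T i 0 fun t k m => dsymb I m • fcoef (fun x => a i I x t) (k - m) :=
      ((ha i (hle i hi) I).timeReg_fcoef hT 0).matReg_smul (C := (2 * Real.pi) ^ i)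
        (by have := Real.pi_pos; positivity) fun m => norm_dsymb_le I m
    exact hM.offDiagDecay.summable hrd k ht
  calc fcoef (fun x => TorusParabolic.diffOp T r a G x t) k
      = ∑ i ∈ Finset.range (r + 1), ∑ I : Fin i → Fin n,
          fcoef (fun x => a i I x t (TorusParabolic.spIter T i I G x t)) k := by
        refine (fcoef_finset_sum _ (fun i hi => (hs' i hi).perZ_apply t)
          (fun i hi => (hs' i hi).continuous_apply ht) k).trans ?_
        exact Finset.sum_congr rfl fun i hi => fcoef_finset_sum _
          (fun I _ => (hs i hi I).perZ_apply t) (fun I _ => (hs i hi I).continuous_apply ht) k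
    _ = ∑ i ∈ Finset.range (r + 1), ∑ I : Fin i → Fin n,
          ∑' m, (dsymb I m • fcoef (fun x => a i I x t) (k - m)) (fcoef (fun x => G x t) m) := by
        refine Finset.sum_congr rfl fun i hi => Finset.sum_congr rfl fun I _ => ?_
        rw [(hG.spIter hT i I).fcoef_clm_apply hT ((ha i (hle i hi) I).perZ_apply t)
          ((ha i (hle i hi) I).continuous_apply ht) ht]
        refine tsum_congr fun m => ?_
        rw [hG.fcoef_spIter hT i I m ht, map_smul, smul_apply]
    _ = _ := by
        simp only [opMat, sum_apply]
        rw [Summable.tsum_finsetSum fun i hi => summable_sum fun I _ => hsum i hi I]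
        refine Finset.sum_congr rfl fun i hi => ?_
        rw [Summable.tsum_finsetSum fun I _ => hsum i hi I]

lemma SmoothPer.hasDerivWithinAt_fcoef_of_eq (hT : 0 < T)
    (ha : ∀ k, k ≤ r → ∀ I, SmoothPer T (a k I)) (hG : SmoothPer T G) (hf : SmoothPer T f)
    (heq : ∀ x, ∀ t ∈ Icc 0 T,
      TorusParabolic.dirDeriv T (0, 1) G x t = TorusParabolic.diffOp T r a G x t + f x t)
    (k : Fin n → ℤ) {t : ℝ} (ht : t ∈ Icc 0 T) :
    HasDerivWithinAt (fun t => fcoef (fun x => G x t) k)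
      ((∑' m, opMat r a t k m (fcoef (fun x => G x t) m)) + fcoef (fun x => f x t) k)
      (Icc 0 T) t := by
  have h := hG.hasDerivWithinAt_fcoef hT k ht
  have hD := hG.diffOp hT ha
  rwa [show (fun x => TorusParabolic.dirDeriv T (0, 1) G x t) =
    fun x => TorusParabolic.diffOp T r a G x t + f x t from funext fun x => heq x t ht,
    fcoef_add (hD.perZ_apply t) (hD.continuous_apply ht) (hf.perZ_apply t)
      (hf.continuous_apply ht), hG.fcoef_diffOp hT ha k ht] at h

/-- Solvability of the Cauchy problem in terms of Gårding's inequality. -/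
theorem exists_smoothPer_solution (hT : 0 < T) (ha : ∀ k, k ≤ r → ∀ I, SmoothPer T (a k I))
    (hM : IsGarding T r (opMat r a)) (hf : SmoothPer T f) {u₀ : Vec n → E}
    (hu₀ : SmoothPer T fun x _ => u₀ x) :
    ∃ G, SmoothPer T G ∧ (∀ x, G x 0 = u₀ x) ∧ ∀ x, ∀ t ∈ Icc 0 T,
      dirDeriv T (0, 1) G x t = diffOp T r a G x t + f x t := by
  have h0 : (0 : ℝ) ∈ Icc 0 T := ⟨le_rfl, hT.le⟩
  have hur := hu₀.rapidDecay_fcoef hT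
  obtain ⟨w, hw, hw0, hode⟩ := hM.exists_solution hT.le
    (f := fun k t => fcoef (fun x => f x t) k) (u₀ := fcoef u₀)
    (hf.timeReg_fcoef hT 0).continuousOn (hf.rapidDecay_fcoef hT)
    fun j => by
      obtain ⟨K, hK, h⟩ := hur j
      exact ⟨K, hK, fun k => h k 0 h0⟩
  have hreg := MatReg.timeReg_of_ode (matReg_opMat hT ha) (hf.timeReg_fcoef hT) hw hode
  have hG := smoothPer_fsum hT hreg
  set G : Vec n → ℝ → E := fun x t => fsum (fun k => w k t) x with hGdef
  have hco : ∀ t ∈ Icc 0 T, ∀ k, fcoef (fun x => G x t) k = w k t := fun t ht k =>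
    fcoef_fsum (hw.summable_norm ht) k
  refine ⟨G, hG, fun x => ?_, fun x t ht => ?_⟩
  · have h1 : (fun k => w k 0) = fcoef u₀ := funext hw0
    change fsum (fun k => w k 0) x = u₀ x
    rw [h1]
    exact hu₀.fsum_fcoef hT x h0
  · have hR := (hG.diffOp hT ha).add hf
    have hH := (hG.dirDeriv hT (0, 1)).sub hR
    refine sub_eq_zero.1 (eq_zero_of_fcoef_eq_zero (hH.perZ_apply t) (hH.continuous_apply ht)
      (fun k => ?_) x)
    have hD := hG.dirDeriv hT (0, 1)
    have hL := hG.diffOp hT ha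
    rw [fcoef_sub (hD.perZ_apply t) (hD.continuous_apply ht) (hR.perZ_apply t)
      (hR.continuous_apply ht), fcoef_add (hL.perZ_apply t) (hL.continuous_apply ht)
      (hf.perZ_apply t) (hf.continuous_apply ht), hG.fcoef_diffOp hT ha k ht, sub_eq_zero]
    have e1 := hG.hasDerivWithinAt_fcoef hT k ht
    have e2 := (hode k t ht).congr (fun s hs => hco s hs k) (hco t ht k)
    have e3 := (uniqueDiffOn_Icc hT t ht).eq_deriv _ e1 e2
    rw [e3]
    congr 1
    exact tsum_congr fun m => by rw [hco t ht m]

/-- Uniqueness for the Cauchy problem in terms of Gårding's inequality. -/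
theorem SmoothPer.eq_zero_of_homogeneous (hT : 0 < T)
    (ha : ∀ k, k ≤ r → ∀ I, SmoothPer T (a k I)) (hM : IsGarding T r (opMat r a))
    (hG : SmoothPer T G) (hG0 : ∀ x, G x 0 = 0)
    (heq : ∀ x, ∀ t ∈ Icc 0 T,
      TorusParabolic.dirDeriv T (0, 1) G x t = TorusParabolic.diffOp T r a G x t)
    (x : Vec n) {t : ℝ} (ht : t ∈ Icc 0 T) : G x t = 0 := by
  have hz : SmoothPer (n := n) (F := E) T fun _ _ => 0 := ⟨contDiffOn_const, fun _ _ => rfl⟩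
  have h := hM.eq_zero_of_homogeneous hT.le (hG.rapidDecay_fcoef hT)
    (fun k => by simp [hG0, fcoef]) fun k t ht => by
      have := hG.hasDerivWithinAt_fcoef_of_eq hT ha hz
        (fun x t ht => by rw [heq x t ht, add_zero]) k ht
      simpa [fcoef_const] using this
  exact eq_zero_of_fcoef_eq_zero (hG.perZ_apply t) (hG.continuous_apply ht)
    (fun k => h k t ht) x

end ComplexSystem

section ComplexUniqueness

open Set Filter Topology

variable {n : ℕ} {T : ℝ}

lemma SmoothPer.dirDeriv_sub {F : Type*} [NormedAddCommGroup F] [NormedSpace ℝ F]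
    {G H : Vec n → ℝ → F} (hT : 0 < T) (hG : SmoothPer T G) (hH : SmoothPer T H) (v : Vec n × ℝ)
    (x : Vec n) {t : ℝ} (ht : t ∈ Icc 0 T) :
    TorusParabolic.dirDeriv T v (fun x t => G x t - H x t) x t =
      TorusParabolic.dirDeriv T v G x t - TorusParabolic.dirDeriv T v H x t := by
  have h := ((hG.hasFDerivWithinAt (x := x) ht).sub
    (hH.hasFDerivWithinAt (x := x) ht)).fderivWithin (uniqueDiffOn_cyl hT (x, t) ⟨mem_univ x, ht⟩)
  exact congrArg (fun D => D v) h

lemma SmoothPer.spIter_sub {F : Type*} [NormedAddCommGroup F] [NormedSpace ℝ F]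
    {G H : Vec n → ℝ → F} (hT : 0 < T) (hG : SmoothPer T G) (hH : SmoothPer T H) (k : ℕ)
    (I : Fin k → Fin n) (x : Vec n) {t : ℝ} (ht : t ∈ Icc 0 T) :
    TorusParabolic.spIter T k I (fun x t => G x t - H x t) x t =
      TorusParabolic.spIter T k I G x t - TorusParabolic.spIter T k I H x t := by
  induction k generalizing x t with
  | zero => rfl
  | succ k ih =>
    refine (dirDeriv_congr (fun x t ht => ih (fun j => I j.succ) x ht) _ x ht).trans ?_
    exact (hG.spIter hT k _).dirDeriv_sub hT (hH.spIter hT k _) _ x ht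

variable {E : Type*} [NormedAddCommGroup E] [InnerProductSpace ℂ E] [CompleteSpace E]
  {r : ℕ} {a : (k : ℕ) → (Fin k → Fin n) → Vec n → ℝ → E →L[ℂ] E} {G H f : Vec n → ℝ → E}

theorem SmoothPer.eq_of_cauchy (hT : 0 < T) (ha : ∀ k, k ≤ r → ∀ I, SmoothPer T (a k I))
    (hM : IsGarding T r (opMat r a)) (hG : SmoothPer T G) (hH : SmoothPer T H)
    (h0 : ∀ x, G x 0 = H x 0)
    (heG : ∀ x, ∀ t ∈ Icc 0 T,
      TorusParabolic.dirDeriv T (0, 1) G x t = TorusParabolic.diffOp T r a G x t + f x t)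
    (heH : ∀ x, ∀ t ∈ Icc 0 T,
      TorusParabolic.dirDeriv T (0, 1) H x t = TorusParabolic.diffOp T r a H x t + f x t)
    (x : Vec n) {t : ℝ} (ht : t ∈ Icc 0 T) : G x t = H x t := by
  refine sub_eq_zero.1 ((hG.sub hH).eq_zero_of_homogeneous hT ha hM
    (fun x => sub_eq_zero.2 (h0 x)) (fun x t ht => ?_) x ht)
  rw [hG.dirDeriv_sub hT hH _ x ht, heG x t ht, heH x t ht, add_sub_add_right_eq_sub]
  simp only [TorusParabolic.diffOp, ← Finset.sum_sub_distrib]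
  refine Finset.sum_congr rfl fun i _ => Finset.sum_congr rfl fun I _ => ?_
  rw [hG.spIter_sub hT hH i I x ht, map_sub]

end ComplexUniqueness

section Complexification

open Set Filter Topology
open scoped InnerProductSpace ComplexConjugate

variable {n l r : ℕ} {T : ℝ}

/-- Complex Euclidean space, whose real structure is obtained by restriction of scalars. -/
def CVec (l : ℕ) : Type := EuclideanSpace ℂ (Fin l)

instance : NormedAddCommGroup (CVec l) := inferInstanceAs (NormedAddCommGroup (EuclideanSpace ℂ _))

instance : InnerProductSpace ℂ (CVec l) :=
  inferInstanceAs (InnerProductSpace ℂ (EuclideanSpace ℂ (Fin l)))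

instance : CompleteSpace (CVec l) := inferInstanceAs (CompleteSpace (EuclideanSpace ℂ (Fin l)))

/-- Coordinates on `ℂ^l`. -/
def ccoord (a : Fin l) : CVec l →L[ℂ] ℂ := (EuclideanSpace.proj a : EuclideanSpace ℂ (Fin l) →L[ℂ] ℂ)

/-- The standard basis of `ℂ^l`. -/
def cbasis (a : Fin l) : CVec l := EuclideanSpace.single a (1 : ℂ)

lemma CVec.ext {v w : CVec l} (h : ∀ a, ccoord a v = ccoord a w) : v = w :=
  PiLp.ext h

lemma ccoord_cbasis (a b : Fin l) : ccoord a (cbasis b) = if a = b then 1 else 0 := by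
  change (EuclideanSpace.single b (1 : ℂ)) a = _
  simp

lemma CVec.inner_eq (v w : CVec l) : ⟪v, w⟫_ℂ = ∑ a, conj (ccoord a v) * ccoord a w := by
  refine (PiLp.inner_apply (𝕜 := ℂ) (f := fun _ : Fin l => ℂ) v w).trans ?_
  exact Finset.sum_congr rfl fun a _ => mul_comm _ _

/-- The inclusion of `ℝ^l` in `ℂ^l`. -/
def cplx : Vec l →L[ℝ] CVec l :=
  ∑ a, (EuclideanSpace.proj a : Vec l →L[ℝ] ℝ).smulRight (cbasis a)

/-- The real part. -/
def rePart : CVec l →L[ℝ] Vec l :=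
  ∑ a, (Complex.reCLM.comp ((ccoord a).restrictScalars ℝ)).smulRight (EuclideanSpace.single a 1)

lemma ccoord_cplx (a : Fin l) (v : Vec l) : ccoord a (cplx v) = (v a : ℂ) := by
  simp only [cplx, sum_apply, ContinuousLinearMap.smulRight_apply, map_sum]
  rw [Finset.sum_eq_single a]
  · rw [← Complex.coe_smul, map_smul, ccoord_cbasis]
    simp
  · intro b _ hb
    rw [← Complex.coe_smul, map_smul, ccoord_cbasis, if_neg hb.symm, smul_zero]
  · simp

lemma rePart_apply (v : CVec l) (a : Fin l) : rePart v a = (ccoord a v).re := by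
  simp only [rePart, sum_apply, ContinuousLinearMap.smulRight_apply, WithLp.ofLp_sum,
    Finset.sum_apply]
  rw [Finset.sum_eq_single a]
  · simp
  · intro b _ hb
    simp [hb.symm]
  · simp

/-- A real matrix acting on `ℂ^l`. -/
def cmat (B : Fin l → Fin l → ℝ) : CVec l →L[ℂ] CVec l :=
  ∑ a, ∑ b, (B a b : ℂ) • (ccoord b).smulRight (cbasis a)

lemma ccoord_cmat (B : Fin l → Fin l → ℝ) (v : CVec l) (a : Fin l) :
    ccoord a (cmat B v) = ∑ b, (B a b : ℂ) * ccoord b v := by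
  simp only [cmat, sum_apply, smul_apply, ContinuousLinearMap.smulRight_apply, map_sum, map_smul,
    ccoord_cbasis, smul_eq_mul]
  rw [Finset.sum_eq_single a]
  · simp
  · intro b _ hb
    simp [hb.symm]
  · simp

lemma re_inner_cmat (B : Fin l → Fin l → ℝ) (v : CVec l) :
    (⟪v, cmat B v⟫_ℂ).re = ∑ a, ∑ b, B a b *
      ((ccoord a v).re * (ccoord b v).re + (ccoord a v).im * (ccoord b v).im) := by
  simp only [CVec.inner_eq, ccoord_cmat, Complex.re_sum, Finset.mul_sum]
  refine Finset.sum_congr rfl fun a _ => Finset.sum_congr rfl fun b _ => ?_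
  simp
  ring

lemma smoothPer_cmat {B : Fin l → Fin l → Vec n → ℝ → ℝ} (hB : ∀ a b, SmoothPer T (B a b)) :
    SmoothPer T fun x t => cmat fun a b => B a b x t :=
  SmoothPer.finset_sum fun a _ => SmoothPer.finset_sum fun b _ =>
    (hB a b).clm (Complex.ofRealCLM.smulRight ((ccoord b).smulRight (cbasis a)))

end Complexification

section RealSystem

open Set Filter Topology
open scoped InnerProductSpace

variable {n l r : ℕ} {T : ℝ}

lemma dsymb_eq {k : ℕ} (I : Fin k → Fin n) (ξ : Fin n → ℤ) :
    dsymb I ξ = (2 * Real.pi * Complex.I) ^ k * ((∏ j, (ξ (I j) : ℝ) : ℝ) : ℂ) := by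
  simp [dsymb, freq, Finset.prod_mul_distrib]

lemma dsymb_eq_of_even {s : ℕ} (I : Fin (2 * (s + 1)) → Fin n) (ξ : Fin n → ℤ) :
    dsymb I ξ =
      ((-(2 * Real.pi) ^ (2 * (s + 1)) * ((-1) ^ s * ∏ j, (ξ (I j) : ℝ)) : ℝ) : ℂ) := by
  rw [dsymb_eq, mul_pow, pow_mul Complex.I, Complex.I_sq, pow_succ (-1 : ℂ)]
  push_cast
  ring

lemma sq_norm_eq_re_add_im (v : CVec l) :
    ‖v‖ ^ 2 = ‖rePart v‖ ^ 2 + ‖rePart (-Complex.I • v)‖ ^ 2 := by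
  have h : ‖v‖ ^ 2 = ∑ a, ‖ccoord a v‖ ^ 2 :=
    EuclideanSpace.norm_sq_eq (𝕜 := ℂ) (n := Fin l) v
  rw [h, EuclideanSpace.norm_sq_eq, EuclideanSpace.norm_sq_eq, ← Finset.sum_add_distrib]
  refine Finset.sum_congr rfl fun a _ => ?_
  rw [rePart_apply, rePart_apply, map_smul, Complex.sq_norm, Complex.normSq_apply]
  simp [sq]

/-- Complex form of the Legendre–Hadamard condition at integral frequencies. -/
lemma StrongEllip.re_inner_le {A : (k : ℕ) → (Fin k → Fin n) → Fin l → Fin l → Vec n → ℝ → ℝ}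
    {lam : ℝ} (hlam : 0 < lam) (hr : 2 ≤ r) (hrev : Even r)
    (hell : StrongEllip r A (univ ×ˢ Icc 0 T) lam) (x : Vec n) {t : ℝ} (ht : t ∈ Icc 0 T)
    (ξ : Fin n → ℤ) (v : CVec l) :
    (⟪v, (∑ I : Fin r → Fin n, dsymb I ξ • cmat fun a b => A r I a b x t) v⟫_ℂ).re ≤
      -lam * ‖ξ‖ ^ r * ‖v‖ ^ 2 := by
  obtain ⟨s, rfl⟩ : ∃ s, r = 2 * (s + 1) := by
    obtain ⟨c, hc⟩ := hrev
    exact ⟨c - 1, by omega⟩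
  set η : Vec n := WithLp.toLp 2 fun i => (ξ i : ℝ) with hη
  set q : Vec l → ℝ := fun w => (-1 : ℝ) ^ s *
    ∑ I : Fin (2 * (s + 1)) → Fin n, ∑ a, ∑ b, A (2 * (s + 1)) I a b x t * (∏ j, η (I j)) *
      w a * w b with hq
  have hqb : ∀ w, lam * ‖η‖ ^ (2 * (s + 1)) * ‖w‖ ^ 2 ≤ q w := fun w => by
    have := hell (x, t) ⟨mem_univ x, ht⟩ η w
    rwa [show 2 * (s + 1) / 2 - 1 = s by omega] at this
  have hnorm : ‖ξ‖ ≤ ‖η‖ := by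
    refine (pi_norm_le_iff_of_nonneg (norm_nonneg _)).2 fun i => ?_
    rw [Int.norm_eq_abs]
    exact PiLp.norm_apply_le η i
  have key : (⟪v, (∑ I : Fin (2 * (s + 1)) → Fin n,
      dsymb I ξ • cmat fun a b => A (2 * (s + 1)) I a b x t) v⟫_ℂ).re =
      -(2 * Real.pi) ^ (2 * (s + 1)) * (q (rePart v) + q (rePart (-Complex.I • v))) := by
    simp only [hq, ← mul_add, ← Finset.sum_add_distrib, Finset.mul_sum, sum_apply, inner_sum,
      Complex.re_sum]
    refine Finset.sum_congr rfl fun I _ => ?_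
    rw [smul_apply, inner_smul_right, dsymb_eq_of_even, Complex.re_ofReal_mul, re_inner_cmat,
      Finset.mul_sum]
    refine Finset.sum_congr rfl fun a _ => ?_
    rw [Finset.mul_sum]
    refine Finset.sum_congr rfl fun b _ => ?_
    simp only [rePart_apply, map_smul, hη]
    simp
    ring
  rw [key, sq_norm_eq_re_add_im v]
  have h1 := add_le_add (hqb (rePart v)) (hqb (rePart (-Complex.I • v)))
  rw [← mul_add] at h1
  set N := ‖rePart v‖ ^ 2 + ‖rePart (-Complex.I • v)‖ ^ 2 with hN
  have hN0 : 0 ≤ N := by positivity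
  have h2 : lam * ‖ξ‖ ^ (2 * (s + 1)) * N ≤ lam * ‖η‖ ^ (2 * (s + 1)) * N := by gcongr
  have h3 : 1 ≤ (2 * Real.pi) ^ (2 * (s + 1)) :=
    one_le_pow₀ (by linarith [Real.pi_gt_three])
  have h4 : 0 ≤ lam * ‖ξ‖ ^ (2 * (s + 1)) * N := by positivity
  nlinarith [mul_le_mul h3 (h2.trans h1) h4 (by linarith)]

lemma SmoothPer.spDerivW_eq (hT : 0 < T) {u : Vec n → ℝ → Vec l} (hu : SmoothPer T u) (k : ℕ)
    (I : Fin k → Fin n) (x : Vec n) {t : ℝ} (ht : t ∈ Icc 0 T) :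
    spDerivW univ k I u x t = TorusParabolic.spIter T k I u x t := by
  rw [← hu.iteratedFDeriv_eq_spIter hT k I x ht, spDerivW, pderivW, iteratedFDerivWithin_univ]

lemma SmoothPer.tDerivW_eq (hT : 0 < T) {u : Vec n → ℝ → Vec l} (hu : SmoothPer T u)
    (x : Vec n) {t : ℝ} (ht : t ∈ Icc 0 T) :
    tDerivW (Icc 0 T) u x t = TorusParabolic.dirDeriv T (0, 1) u x t :=
  (hu.hasDerivWithinAt_time x ht).derivWithin (uniqueDiffOn_Icc hT t ht)

lemma applyL_apply (A : (k : ℕ) → (Fin k → Fin n) → Fin l → Fin l → Vec n → ℝ → ℝ)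
    (D : Set (Vec n)) (u : Vec n → ℝ → Vec l) (x : Vec n) (t : ℝ) (a : Fin l) :
    applyL r D A u x t a = ∑ k ∈ Finset.range (r + 1), ∑ I : Fin k → Fin n, ∑ b,
      A k I a b x t * spDerivW D k I u x t b := rfl

lemma SmoothPer.diffOp_cplx (hT : 0 < T)
    (A : (k : ℕ) → (Fin k → Fin n) → Fin l → Fin l → Vec n → ℝ → ℝ) {u : Vec n → ℝ → Vec l}
    (hu : SmoothPer T u) (x : Vec n) {t : ℝ} (ht : t ∈ Icc 0 T) :
    TorusParabolic.diffOp T r (fun k I x t => cmat fun a b => A k I a b x t)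
      (fun x t => cplx (u x t)) x t = cplx (applyL r univ A u x t) := by
  refine CVec.ext fun a => ?_
  rw [ccoord_cplx, applyL_apply]
  push_cast
  simp only [TorusParabolic.diffOp, map_sum, ccoord_cmat]
  refine Finset.sum_congr rfl fun i _ => Finset.sum_congr rfl fun I _ =>
    Finset.sum_congr rfl fun b _ => ?_
  rw [hu.spIter_clm hT cplx i I x ht, ccoord_cplx, hu.spDerivW_eq hT i I x ht]

lemma SmoothPer.rePart_diffOp (hT : 0 < T)
    (A : (k : ℕ) → (Fin k → Fin n) → Fin l → Fin l → Vec n → ℝ → ℝ) {G : Vec n → ℝ → CVec l}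
    (hG : SmoothPer T G) (x : Vec n) {t : ℝ} (ht : t ∈ Icc 0 T) :
    rePart (TorusParabolic.diffOp T r (fun k I x t => cmat fun a b => A k I a b x t) G x t) =
      applyL r univ A (fun x t => rePart (G x t)) x t := by
  refine PiLp.ext fun a => ?_
  rw [rePart_apply, applyL_apply]
  simp only [TorusParabolic.diffOp, map_sum, ccoord_cmat, Complex.re_sum]
  refine Finset.sum_congr rfl fun i _ => Finset.sum_congr rfl fun I _ =>
    Finset.sum_congr rfl fun b _ => ?_
  rw [(hG.clm rePart).spDerivW_eq hT i I x ht, hG.spIter_clm hT rePart i I x ht, rePart_apply,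
    Complex.re_ofReal_mul]

lemma rePart_cplx (v : Vec l) : rePart (cplx v) = v :=
  PiLp.ext fun a => by rw [rePart_apply, ccoord_cplx, Complex.ofReal_re]

lemma SmoothPer.dirDeriv_cplx_eq (hT : 0 < T)
    {A : (k : ℕ) → (Fin k → Fin n) → Fin l → Fin l → Vec n → ℝ → ℝ} {u f : Vec n → ℝ → Vec l}
    (hu : SmoothPer T u)
    (heq : ∀ x, ∀ t ∈ Icc 0 T, tDerivW (Icc 0 T) u x t = applyL r univ A u x t + f x t)
    (x : Vec n) (t : ℝ) (ht : t ∈ Icc 0 T) :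
    TorusParabolic.dirDeriv T (0, 1) (fun x t => cplx (u x t)) x t =
      TorusParabolic.diffOp T r (fun k I x t => cmat fun a b => A k I a b x t)
        (fun x t => cplx (u x t)) x t + cplx (f x t) := by
  rw [hu.dirDeriv_clm hT cplx _ x ht, hu.diffOp_cplx hT A x ht, ← hu.tDerivW_eq hT x ht,
    heq x t ht, map_add]

end RealSystem

end TorusParabolic

/-- **Smooth solvability of linear strongly parabolic systems on the torus**
(Theorem 2.6 for `M = 𝕋^n` with the trivial bundle): for `C^∞`, `ℤ^n`-periodic,
strongly elliptic coefficients and `C^∞` periodic data `f`, `u₀`, there is one and only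
one `C^∞` periodic solution of `∂u/∂t = L_t u + f`, `u(⋅,0) = u₀` on `ℝ^n × [0,T]`. -/
theorem smooth_linear_parabolic_torus
    (n l r : ℕ) (hn : 1 ≤ n) (hl : 1 ≤ l) (hr : 2 ≤ r) (hrev : Even r)
    (T : ℝ) (hT : 0 < T) (lam : ℝ) (hlam : 0 < lam)
    (A : (k : ℕ) → (Fin k → Fin n) → Fin l → Fin l → Vec n → ℝ → ℝ)
    (hAsm : ∀ k, k ≤ r → ∀ I : Fin k → Fin n, ∀ a b : Fin l,
      ContDiffOn ℝ (⊤ : ℕ∞) (fun q : Vec n × ℝ => A k I a b q.1 q.2)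
        (Set.univ ×ˢ Set.Icc 0 T))
    (hAper : ∀ k, k ≤ r → ∀ I : Fin k → Fin n, ∀ a b : Fin l, PerZ (A k I a b))
    (hell : StrongEllip r A (Set.univ ×ˢ Set.Icc 0 T) lam)
    (f : Vec n → ℝ → Vec l)
    (hfsm : ContDiffOn ℝ (⊤ : ℕ∞) (fun q : Vec n × ℝ => f q.1 q.2) (Set.univ ×ˢ Set.Icc 0 T))
    (hfper : PerZ f)
    (u₀ : Vec n → Vec l) (hu₀sm : ContDiff ℝ (⊤ : ℕ∞) u₀) (hu₀per : PerZ u₀) :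
    ∃ u : Vec n → ℝ → Vec l,
      (ContDiffOn ℝ (⊤ : ℕ∞) (fun q : Vec n × ℝ => u q.1 q.2) (Set.univ ×ˢ Set.Icc 0 T) ∧
        PerZ u ∧
        (∀ x : Vec n, ∀ t ∈ Set.Icc (0 : ℝ) T,
          tDerivW (Set.Icc 0 T) u x t = applyL r Set.univ A u x t + f x t) ∧
        (∀ x : Vec n, u x 0 = u₀ x)) ∧
      ∀ u' : Vec n → ℝ → Vec l,
        (ContDiffOn ℝ (⊤ : ℕ∞) (fun q : Vec n × ℝ => u' q.1 q.2) (Set.univ ×ˢ Set.Icc 0 T) ∧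
          PerZ u' ∧
          (∀ x : Vec n, ∀ t ∈ Set.Icc (0 : ℝ) T,
            tDerivW (Set.Icc 0 T) u' x t = applyL r Set.univ A u' x t + f x t) ∧
          (∀ x : Vec n, u' x 0 = u₀ x)) →
        ∀ x : Vec n, ∀ t ∈ Set.Icc (0 : ℝ) T, u' x t = u x t := by
  open TorusParabolic in
  obtain ⟨ρ, rfl⟩ := Nat.exists_eq_add_of_le' hr
  have ha : ∀ k, k ≤ ρ + 2 → ∀ I : Fin k → Fin n,
      SmoothPer T fun x t => cmat fun a b => A k I a b x t := fun k hk I =>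
    smoothPer_cmat fun a b => ⟨hAsm k hk I a b, hAper k hk I a b⟩
  have hM := isGarding_opMat hT hlam ha fun x t ht ξ v =>
    StrongEllip.re_inner_le hlam hr hrev hell x ht ξ v
  have hf : SmoothPer T f := ⟨hfsm, hfper⟩
  have hu₀ : SmoothPer T fun x _ => u₀ x :=
    ⟨(hu₀sm.comp contDiff_fst).contDiffOn, fun x m => funext fun _ => hu₀per x m⟩
  obtain ⟨G, hG, hG0, hGe⟩ := exists_smoothPer_solution hT ha hM (hf.clm cplx) (hu₀.clm cplx)
  have hu := hG.clm rePart
  have hue : ∀ x : Vec n, ∀ t ∈ Set.Icc (0 : ℝ) T,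
      tDerivW (Set.Icc 0 T) (fun x t => rePart (G x t)) x t =
        applyL (ρ + 2) Set.univ A (fun x t => rePart (G x t)) x t + f x t := fun x t ht => by
    rw [hu.tDerivW_eq hT x ht, hG.dirDeriv_clm hT rePart _ x ht, hGe x t ht, map_add,
      hG.rePart_diffOp hT A x ht, rePart_cplx]
  have hu0 : ∀ x, rePart (G x 0) = u₀ x := fun x => by rw [hG0, rePart_cplx]
  refine ⟨fun x t => rePart (G x t), ⟨hu.smooth, hu.per, hue, hu0⟩, ?_⟩
  rintro u' ⟨hs', hp', he', h0'⟩ x t ht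
  have hu' : SmoothPer T u' := ⟨hs', hp'⟩
  have h := (hu'.clm cplx).eq_of_cauchy hT ha hM (hu.clm cplx)
    (fun x => by simp only [h0', hu0]) (hu'.dirDeriv_cplx_eq hT he') (hu.dirDeriv_cplx_eq hT hue)
    x ht
  rw [← rePart_cplx (u' x t), h, rePart_cplx]
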